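/- Let ℓ ≥ 2 be an integer, let c, c₁ ∈ (0,1), δ > 0, λ > 0 and K ≥ 1, and set θ(c,c₁) = min{c + c₁, 1/2 − 2c₁}. There exist C > 0 and ε₀ > 0 such that for every ε ∈ (0, ε₀) and every interval I ⊆ [0,1] whose length satisfies K⁻¹·ε^c ≤ |I| ≤ K·ε^c, one has |G_{ℓ,I,ε}(λ) − c_I·G_ℓ(λ)| ≤ C·ε^{θ(c,c₁)−δ}. -/

import Mathlib

open MeasureTheory Real Set Filter
open scoped ENNReal Pointwise

noncomputable def Li2 (x : ℝ) : ℝ := ∑' n : ℕ, x ^ (n + 1) / ((n : ℝ) + 1) ^ 2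

noncomputable def zeta2 : ℝ := π ^ 2 / 6

noncomputable def Cconst (l : ℕ) : ℝ :=
  ((Nat.totient l : ℝ) / l) * ∏' p : {p : ℕ // p.Prime ∧ ¬ p ∣ l}, (1 - 1 / (p.1 : ℝ) ^ 2)

noncomputable def Aconst (l : ℕ) : ℝ := 1 / zeta2 - 2 * Cconst l / l

noncomputable def H2 (x : ℝ) : ℝ :=
  3 * x - 2 + zeta2 - (Real.log x) ^ 2 + 2 * (1 - x) * Real.log (1 / x - 1) - 2 * Li2 x

noncomputable def H3 (x : ℝ) : ℝ := Li2 (1 / x) - (x - 1) * Real.log (1 - 1 / x) - 1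

noncomputable def Gfun (l : ℕ) (x : ℝ) : ℝ :=
  if x ≤ 1 / 2 then 1 - (1 / zeta2 + Aconst l) * x
  else if x ≤ 1 then 1 - x / zeta2 + Aconst l * H2 x
  else (2 * Cconst l / l) * H3 x

def Zl (l : ℕ) : Set (ℝ × ℝ) :=
  {p | ∃ m n : ℤ, p = ((m : ℝ), (n : ℝ)) ∧ ¬ ((l : ℤ) ∣ (m - n))}

/-- The vertical segment `V_ε = {0} × [-ε, ε]`. -/
def Vseg (ε : ℝ) : Set (ℝ × ℝ) := {(0 : ℝ)} ×ˢ Set.Icc (-ε) ε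

/-- The horizontal free path length `q_{ℓ,ε}(ω)`, with value `∞` when no scatterer is met. -/
noncomputable def qfree (l : ℕ) (ε ω : ℝ) : ℝ≥0∞ :=
  ⨅ q : {q : ℝ // 0 < q ∧ (q, q * Real.tan ω) ∈ Zl l + Vseg ε}, ENNReal.ofReal q.1

/-- The repartition function `G_{ℓ,I,ε}(λ)` of the horizontal free path length. -/
noncomputable def Grep (l : ℕ) (I : Set ℝ) (ε lam : ℝ) : ℝ :=
  (volume {ω ∈ Real.arctan '' I | ENNReal.ofReal (lam / ε) < qfree l ε ω}).toReal

section Kloosterman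

/-- The complete Kloosterman sum modulo `b`. -/
noncomputable def kloosterman (b : ℕ) [NeZero b] (h k : ZMod b) : ℂ :=
  ∑ x : (ZMod b)ˣ, ZMod.stdAddChar (h * (x : ZMod b) + k * ((x⁻¹ : (ZMod b)ˣ) : ZMod b))

variable {b : ℕ} [NeZero b]

lemma card_mul_eq_le (a c : ZMod b) :
    (Finset.univ.filter fun x : ZMod b => a * x = c).card ≤ Nat.gcd a.val b := by
  classical
  have hg : 0 < Nat.gcd a.val b := Nat.gcd_pos_of_pos_right _ (NeZero.pos b)
  have h0 : (Finset.univ.filter fun x : ZMod b => a * x = 0).card ≤ Nat.gcd a.val b := by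
    refine le_trans (Finset.card_le_card ?_)
      (IsAddCyclic.card_nsmul_eq_zero_le (α := ZMod b) hg)
    intro x hx
    simp only [Finset.mem_filter, Finset.mem_univ, true_and] at hx ⊢
    have hb := Nat.gcd_eq_gcd_ab a.val b
    have h1 : ((Nat.gcd a.val b : ℤ) : ZMod b) = a * (Nat.gcdA a.val b : ℤ) := by
      rw [hb]; push_cast; simp
    rw [nsmul_eq_mul]
    have h2 : ((Nat.gcd a.val b : ℕ) : ZMod b) = a * (Nat.gcdA a.val b : ℤ) := by
      rw [← h1]; push_cast; rfl
    rw [h2]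
    calc a * (Nat.gcdA a.val b : ℤ) * x = (Nat.gcdA a.val b : ℤ) * (a * x) := by ring
      _ = 0 := by rw [hx, mul_zero]
  by_cases hne : (Finset.univ.filter fun x : ZMod b => a * x = c).Nonempty
  · obtain ⟨x0, hx0⟩ := hne
    simp only [Finset.mem_filter, Finset.mem_univ, true_and] at hx0
    refine le_trans (Finset.card_le_card_of_injOn (fun x => x - x0) ?_ ?_) h0
    · intro x hx
      simp only [Finset.coe_filter, Finset.mem_univ, true_and, Set.mem_ofPred_eq] at hx ⊢
      rw [mul_sub, hx, hx0, sub_self]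
    · intro x _ y _ hxy
      exact sub_left_injective hxy
  · rw [Finset.not_nonempty_iff_eq_empty] at hne
    rw [hne]; simp

lemma sum_gcd_val_le :
    ∑ u : ZMod b, Nat.gcd u.val b ≤ b * b.divisors.card := by
  classical
  have hb : b ≠ 0 := NeZero.ne b
  have h1 : ∀ u : ZMod b, Nat.gcd u.val b ≤ ∑ d ∈ b.divisors, if d ∣ u.val then d else 0 := by
    intro u
    have hmem : Nat.gcd u.val b ∈ b.divisors := by
      simp [Nat.gcd_dvd_right, hb]
    refine le_trans ?_ (Finset.single_le_sum (f := fun d => if d ∣ u.val then d else 0)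
      (fun _ _ => Nat.zero_le _) hmem)
    simp [Nat.gcd_dvd_left]
  refine (Finset.sum_le_sum fun u _ => h1 u).trans ?_
  rw [Finset.sum_comm]
  rw [mul_comm, ← smul_eq_mul]
  refine Finset.sum_le_card_nsmul _ _ _ ?_
  intro d hd
  have hdb : d ∣ b := Nat.dvd_of_mem_divisors hd
  obtain ⟨e, rfl⟩ := hdb
  have hd0 : 0 < d := Nat.pos_of_ne_zero (by rintro rfl; simp at hb)
  rw [← Finset.sum_filter, Finset.sum_const, smul_eq_mul, mul_comm]
  refine Nat.mul_le_mul_left _ ?_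
  have : (Finset.univ.filter fun u : ZMod (d * e) => d ∣ u.val).card ≤ (Finset.range e).card := by
    refine Finset.card_le_card_of_injOn (fun u => u.val / d) ?_ ?_
    · intro u _
      simp only [Finset.coe_range, Set.mem_Iio]
      exact Nat.div_lt_of_lt_mul (ZMod.val_lt u)
    · intro u hu v hv huv
      simp only [Finset.coe_filter, Finset.mem_univ, true_and, Set.mem_ofPred_eq] at hu hv
      apply ZMod.val_injective
      simp only at huv
      rw [← Nat.div_mul_cancel hu, ← Nat.div_mul_cancel hv, huv]
  simpa using this

lemma sum_stdAddChar_mul (a : ZMod b) :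
    ∑ h : ZMod b, (ZMod.stdAddChar (h * a) : ℂ) = if a = 0 then (b : ℂ) else 0 := by
  have := AddChar.sum_mulShift a (ZMod.isPrimitive_stdAddChar b)
  simpa [ZMod.card] using this

lemma sum_norm_sq_eq {ι : Type*} [Fintype ι] [DecidableEq ι] (a c : ι → ZMod b) :
    ∑ h : ZMod b, ∑ k : ZMod b,
      ‖∑ i, (ZMod.stdAddChar (h * a i + k * c i) : ℂ)‖ ^ 2 =
    (b : ℝ) ^ 2 * ((Finset.univ.filter fun p : ι × ι => a p.1 = a p.2 ∧ c p.1 = c p.2).card : ℝ)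
    := by
  have hC : ((∑ h : ZMod b, ∑ k : ZMod b,
      ‖∑ i, (ZMod.stdAddChar (h * a i + k * c i) : ℂ)‖ ^ 2 : ℝ) : ℂ) =
    (b : ℂ) ^ 2 *
      ((Finset.univ.filter fun p : ι × ι => a p.1 = a p.2 ∧ c p.1 = c p.2).card : ℂ) := by
    push_cast
    have h1 : ∀ h k : ZMod b, ((‖∑ i, (ZMod.stdAddChar (h * a i + k * c i) : ℂ)‖ : ℂ) ^ 2)
        = ∑ p : ι × ι, (ZMod.stdAddChar (h * (a p.1 - a p.2)) : ℂ) *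
            ZMod.stdAddChar (k * (c p.1 - c p.2)) := by
      intro h k
      rw [← Complex.mul_conj', map_sum, Finset.sum_mul_sum, Fintype.sum_prod_type]
      refine Finset.sum_congr rfl fun i _ => Finset.sum_congr rfl fun j _ => ?_
      rw [← AddChar.map_neg_eq_conj, ← AddChar.map_add_eq_mul, ← AddChar.map_add_eq_mul]
      congr 1; ring
    simp_rw [h1]
    calc ∑ h : ZMod b, ∑ k : ZMod b, ∑ p : ι × ι,
          (ZMod.stdAddChar (h * (a p.1 - a p.2)) : ℂ) * ZMod.stdAddChar (k * (c p.1 - c p.2))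
        = ∑ p : ι × ι, (∑ h : ZMod b, (ZMod.stdAddChar (h * (a p.1 - a p.2)) : ℂ)) *
            ∑ k : ZMod b, (ZMod.stdAddChar (k * (c p.1 - c p.2)) : ℂ) := by
          simp_rw [Finset.sum_mul_sum]
          rw [Finset.sum_comm]
          simp_rw [Finset.sum_comm (s := Finset.univ (α := ZMod b)) (t := Finset.univ (α := ι × ι))]
          refine Finset.sum_congr rfl fun p _ => Finset.sum_comm
      _ = ∑ p : ι × ι, if a p.1 = a p.2 ∧ c p.1 = c p.2 then (b : ℂ) ^ 2 else 0 := by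
          refine Finset.sum_congr rfl fun p _ => ?_
          rw [sum_stdAddChar_mul, sum_stdAddChar_mul]
          simp only [sub_eq_zero]
          by_cases h1 : a p.1 = a p.2 <;> by_cases h2 : c p.1 = c p.2 <;> simp [h1, h2, sq]
      _ = _ := by
          rw [← Finset.sum_filter, Finset.sum_const, nsmul_eq_mul, mul_comm]
  exact_mod_cast hC

lemma gcd_val_mul_le (a c : ZMod b) :
    Nat.gcd (a * c).val b ≤ Nat.gcd a.val b * Nat.gcd c.val b := by
  have hv : Nat.gcd (a * c).val b = Nat.gcd (a.val * c.val) b := by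
    rw [ZMod.val_mul, ← Nat.gcd_rec, Nat.gcd_comm]
  rw [hv]
  exact Nat.le_of_dvd (Nat.mul_pos (Nat.gcd_pos_of_pos_right _ (NeZero.pos b))
    (Nat.gcd_pos_of_pos_right _ (NeZero.pos b))) (Nat.gcd_mul_left_dvd_mul_gcd _ _ _)

lemma card_kloosterman_quadruples_le :
    (Finset.univ.filter fun p : ((ZMod b)ˣ × (ZMod b)ˣ) × ((ZMod b)ˣ × (ZMod b)ˣ) =>
      ((p.1.1 : ZMod b) + p.1.2 = p.2.1 + p.2.2) ∧
      (((p.1.1⁻¹ : (ZMod b)ˣ) : ZMod b) + ((p.1.2⁻¹ : (ZMod b)ˣ) : ZMod b) =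
        ((p.2.1⁻¹ : (ZMod b)ˣ) : ZMod b) + ((p.2.2⁻¹ : (ZMod b)ˣ) : ZMod b))).card
      ≤ 2 * (b * b.divisors.card) ^ 2 := by
  classical
  have key : ∀ x₁ x₂ x₃ x₄ : (ZMod b)ˣ, ((x₁ : ZMod b) + x₂ = x₃ + x₄) →
      (((x₁⁻¹ : (ZMod b)ˣ) : ZMod b) + ((x₂⁻¹ : (ZMod b)ˣ) : ZMod b) =
        ((x₃⁻¹ : (ZMod b)ˣ) : ZMod b) + ((x₄⁻¹ : (ZMod b)ˣ) : ZMod b)) →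
      ((x₁ : ZMod b) + x₂) * ((x₁ - x₃) * (x₃ - x₂)) = 0 := by
    intro x₁ x₂ x₃ x₄ h1 h2
    have e1 := Units.mul_inv x₁
    have e2 := Units.mul_inv x₂
    have e3 := Units.mul_inv x₃
    have e4 := Units.mul_inv x₄
    generalize ((x₁⁻¹ : (ZMod b)ˣ) : ZMod b) = y₁ at *
    generalize ((x₂⁻¹ : (ZMod b)ˣ) : ZMod b) = y₂ at *
    generalize ((x₃⁻¹ : (ZMod b)ˣ) : ZMod b) = y₃ at *
    generalize ((x₄⁻¹ : (ZMod b)ˣ) : ZMod b) = y₄ at *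
    have h4 : (x₄ : ZMod b) = x₁ + x₂ - x₃ := by linear_combination -h1
    have h5 : ((x₁ : ZMod b) + x₂) * (x₃ * x₄) = (x₃ + x₄) * (x₁ * x₂) := by
      linear_combination (x₁ * x₂ * x₃ * x₄ : ZMod b) * h2 - (x₂ * x₃ * x₄ : ZMod b) * e1
        - (x₁ * x₃ * x₄ : ZMod b) * e2 + (x₁ * x₂ * x₄ : ZMod b) * e3
        + (x₁ * x₂ * x₃ : ZMod b) * e4
    rw [← h1, h4] at h5
    linear_combination h5
  have hinj : (Finset.univ.filter fun p : ((ZMod b)ˣ × (ZMod b)ˣ) × ((ZMod b)ˣ × (ZMod b)ˣ) =>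
      ((p.1.1 : ZMod b) + p.1.2 = p.2.1 + p.2.2) ∧
      (((p.1.1⁻¹ : (ZMod b)ˣ) : ZMod b) + ((p.1.2⁻¹ : (ZMod b)ˣ) : ZMod b) =
        ((p.2.1⁻¹ : (ZMod b)ˣ) : ZMod b) + ((p.2.2⁻¹ : (ZMod b)ˣ) : ZMod b))).card ≤
      (Finset.univ.sigma fun q : ZMod b × ZMod b => Finset.univ.filter fun x : ZMod b =>
        (2 * (q.1 * q.2)) * x = (q.1 + q.2) * (q.1 * q.2)).card := by
    refine Finset.card_le_card_of_injOn
      (fun p => ⟨((p.1.1 : ZMod b) - p.2.1, (p.2.1 : ZMod b) - p.1.2), (p.1.1 : ZMod b)⟩) ?_ ?_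
    · rintro ⟨⟨x₁, x₂⟩, ⟨x₃, x₄⟩⟩ hp
      simp only [Finset.coe_filter, Finset.mem_univ, true_and, Set.mem_ofPred_eq] at hp
      simp only [Finset.coe_sigma, Set.mem_sigma_iff, Finset.coe_univ, Set.mem_univ, true_and,
        Finset.coe_filter, Finset.mem_univ, Set.mem_ofPred_eq]
      have := key x₁ x₂ x₃ x₄ hp.1 hp.2
      linear_combination this
    · rintro ⟨⟨x₁, x₂⟩, ⟨x₃, x₄⟩⟩ hp ⟨⟨y₁, y₂⟩, ⟨y₃, y₄⟩⟩ hq heq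
      simp only [Finset.coe_filter, Finset.mem_univ, true_and, Set.mem_ofPred_eq] at hp hq
      simp only [Sigma.mk.injEq, Prod.mk.injEq, heq_eq_eq] at heq
      obtain ⟨⟨h1, h2⟩, h3⟩ := heq
      have e1 : x₁ = y₁ := Units.ext h3
      have e3 : x₃ = y₃ := Units.ext (by linear_combination h3 - h1)
      have e2 : x₂ = y₂ := Units.ext (by linear_combination h3 - h1 - h2)
      have e4 : x₄ = y₄ := Units.ext (by
        have hp1 := hp.1
        have hq1 := hq.1
        rw [e1, e2, e3] at hp1
        linear_combination hq1 - hp1)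
      rw [e1, e2, e3, e4]
  refine hinj.trans ?_
  rw [Finset.card_sigma]
  calc ∑ q : ZMod b × ZMod b, (Finset.univ.filter fun x : ZMod b =>
        (2 * (q.1 * q.2)) * x = (q.1 + q.2) * (q.1 * q.2)).card
      ≤ ∑ q : ZMod b × ZMod b, 2 * (Nat.gcd q.1.val b * Nat.gcd q.2.val b) := by
        refine Finset.sum_le_sum fun q _ => (card_mul_eq_le _ _).trans ?_
        have h2 : Nat.gcd (2 : ZMod b).val b ≤ 2 := by
          have : (2 : ZMod b).val = 2 % b := ZMod.val_natCast b 2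
          rw [this, ← Nat.gcd_rec, Nat.gcd_comm]
          exact Nat.gcd_le_left _ (by norm_num)
        refine (gcd_val_mul_le _ _).trans ?_
        exact Nat.mul_le_mul h2 (gcd_val_mul_le _ _)
    _ = 2 * (∑ u : ZMod b, Nat.gcd u.val b) ^ 2 := by
        rw [sq, Finset.sum_mul_sum, Finset.mul_sum, Fintype.sum_prod_type]
        simp_rw [Finset.mul_sum]
    _ ≤ _ := by
        gcongr
        exact sum_gcd_val_le

lemma sum_norm_kloosterman_pow_four_le :
    ∑ h : ZMod b, ∑ k : ZMod b, ‖kloosterman b h k‖ ^ 4 ≤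
      2 * (b : ℝ) ^ 4 * (b.divisors.card : ℝ) ^ 2 := by
  classical
  have h1 : ∀ h k : ZMod b, ‖kloosterman b h k‖ ^ 4 =
      ‖∑ p : (ZMod b)ˣ × (ZMod b)ˣ, (ZMod.stdAddChar (h * ((p.1 : ZMod b) + (p.2 : ZMod b)) +
        k * (((p.1⁻¹ : (ZMod b)ˣ) : ZMod b) + ((p.2⁻¹ : (ZMod b)ˣ) : ZMod b))) : ℂ)‖ ^ 2 := by
    intro h k
    have : (∑ p : (ZMod b)ˣ × (ZMod b)ˣ, (ZMod.stdAddChar (h * ((p.1 : ZMod b) + (p.2 : ZMod b)) +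
        k * (((p.1⁻¹ : (ZMod b)ˣ) : ZMod b) + ((p.2⁻¹ : (ZMod b)ˣ) : ZMod b))) : ℂ)) =
        kloosterman b h k * kloosterman b h k := by
      rw [kloosterman, Finset.sum_mul_sum, Fintype.sum_prod_type]
      refine Finset.sum_congr rfl fun i _ => Finset.sum_congr rfl fun j _ => ?_
      rw [← AddChar.map_add_eq_mul]
      congr 1; ring
    rw [this, norm_mul]; ring
  simp_rw [h1]
  rw [sum_norm_sq_eq (fun p : (ZMod b)ˣ × (ZMod b)ˣ => (p.1 : ZMod b) + (p.2 : ZMod b))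
    (fun p => ((p.1⁻¹ : (ZMod b)ˣ) : ZMod b) + ((p.2⁻¹ : (ZMod b)ˣ) : ZMod b))]
  have h2 := card_kloosterman_quadruples_le (b := b)
  have h3 : ((Finset.univ.filter fun p : ((ZMod b)ˣ × (ZMod b)ˣ) × ((ZMod b)ˣ × (ZMod b)ˣ) =>
      ((p.1.1 : ZMod b) + p.1.2 = p.2.1 + p.2.2) ∧
      (((p.1.1⁻¹ : (ZMod b)ˣ) : ZMod b) + ((p.1.2⁻¹ : (ZMod b)ˣ) : ZMod b) =
        ((p.2.1⁻¹ : (ZMod b)ˣ) : ZMod b) + ((p.2.2⁻¹ : (ZMod b)ˣ) : ZMod b))).card : ℝ)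
      ≤ 2 * (b * b.divisors.card) ^ 2 := by exact_mod_cast h2
  calc _ ≤ (b : ℝ) ^ 2 * (2 * (b * b.divisors.card) ^ 2) := by gcongr
    _ = _ := by ring

lemma kloosterman_mul_unit (h k : ZMod b) (w : (ZMod b)ˣ) :
    kloosterman b (h * w) (k * ((w⁻¹ : (ZMod b)ˣ) : ZMod b)) = kloosterman b h k := by
  unfold kloosterman
  refine Fintype.sum_equiv (Equiv.mulLeft w) _ _ fun x => ?_
  simp only [Equiv.coe_mulLeft, mul_inv_rev, Units.val_mul]
  congr 1; ring

lemma le_totient_mul_card_divisors (n : ℕ) : n ≤ n.totient * n.divisors.card := by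
  rcases Nat.eq_zero_or_pos n with rfl | hn
  · simp
  conv_lhs => rw [← Nat.sum_totient n]
  rw [mul_comm, ← smul_eq_mul]
  refine Finset.sum_le_card_nsmul _ _ _ fun d hd => ?_
  exact Nat.le_of_dvd (Nat.totient_pos.2 hn) (Nat.totient_dvd_of_dvd (Nat.dvd_of_mem_divisors hd))

/-- A fourth-moment bound for Kloosterman sums. -/
lemma norm_kloosterman_pow_four_le (h k : ZMod b) :
    ‖kloosterman b h k‖ ^ 4 ≤
      2 * (Nat.gcd h.val b : ℝ) * (b : ℝ) ^ 3 * (b.divisors.card : ℝ) ^ 3 := by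
  classical
  have hb : 0 < b := NeZero.pos b
  set F : ZMod b × ZMod b → ℝ := fun q => ‖kloosterman b q.1 q.2‖ ^ 4 with hF
  have hF0 : ∀ q, 0 ≤ F q := fun q => by positivity
  have h1 : (b.totient : ℝ) * ‖kloosterman b h k‖ ^ 4 =
      ∑ w : (ZMod b)ˣ, F (h * w, k * ((w⁻¹ : (ZMod b)ˣ) : ZMod b)) := by
    simp only [hF, kloosterman_mul_unit]
    rw [Finset.sum_const, nsmul_eq_mul, Finset.card_univ, ZMod.card_units_eq_totient]
  have h2 : ∑ w : (ZMod b)ˣ, F (h * w, k * ((w⁻¹ : (ZMod b)ˣ) : ZMod b)) ≤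
      (Nat.gcd h.val b : ℝ) * ∑ q : ZMod b × ZMod b, F q := by
    rw [← Finset.sum_fiberwise_of_maps_to (s := Finset.univ)
      (t := (Finset.univ : Finset (ZMod b × ZMod b)))
      (g := fun w : (ZMod b)ˣ => (h * w, k * ((w⁻¹ : (ZMod b)ˣ) : ZMod b)))
      (fun _ _ => Finset.mem_univ _), Finset.mul_sum]
    refine Finset.sum_le_sum fun q _ => ?_
    have : ∀ w ∈ (Finset.univ.filter fun w : (ZMod b)ˣ =>
        (h * w, k * ((w⁻¹ : (ZMod b)ˣ) : ZMod b)) = q),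
        F (h * w, k * ((w⁻¹ : (ZMod b)ˣ) : ZMod b)) = F q := by
      intro w hw
      rw [(Finset.mem_filter.1 hw).2]
    rw [Finset.sum_congr rfl this, Finset.sum_const, nsmul_eq_mul]
    refine mul_le_mul_of_nonneg_right ?_ (hF0 q)
    have hle := card_mul_eq_le h q.1
    have : (Finset.univ.filter fun w : (ZMod b)ˣ =>
        (h * w, k * ((w⁻¹ : (ZMod b)ˣ) : ZMod b)) = q).card ≤
        (Finset.univ.filter fun x : ZMod b => h * x = q.1).card := by
      refine Finset.card_le_card_of_injOn (fun w => (w : ZMod b)) ?_ ?_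
      · intro w hw
        simp only [Finset.coe_filter, Finset.mem_univ, true_and, Set.mem_ofPred_eq] at hw ⊢
        rw [← hw]
      · intro x _ y _ hxy
        exact Units.ext hxy
    exact_mod_cast this.trans hle
  have h3 : ∑ q : ZMod b × ZMod b, F q ≤ 2 * (b : ℝ) ^ 4 * (b.divisors.card : ℝ) ^ 2 := by
    rw [Fintype.sum_prod_type]
    exact sum_norm_kloosterman_pow_four_le
  have h4 : (b : ℝ) ≤ b.totient * b.divisors.card := by
    exact_mod_cast le_totient_mul_card_divisors b
  have hg : (0 : ℝ) ≤ (Nat.gcd h.val b : ℝ) := by positivity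
  have hb' : (0 : ℝ) < b := by exact_mod_cast hb
  have h5 : (b : ℝ) * ‖kloosterman b h k‖ ^ 4 ≤
      b * (2 * (Nat.gcd h.val b : ℝ) * (b : ℝ) ^ 3 * (b.divisors.card : ℝ) ^ 3) := by
    calc (b : ℝ) * ‖kloosterman b h k‖ ^ 4
        ≤ (b.totient * b.divisors.card) * ‖kloosterman b h k‖ ^ 4 := by gcongr
      _ = b.divisors.card * (b.totient * ‖kloosterman b h k‖ ^ 4) := by ring
      _ ≤ b.divisors.card * ((Nat.gcd h.val b : ℝ) *
          (2 * (b : ℝ) ^ 4 * (b.divisors.card : ℝ) ^ 2)) := by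
        rw [h1]; gcongr; exact h2.trans (by gcongr)
      _ = _ := by ring
  exact le_of_mul_le_mul_left h5 hb'

end Kloosterman

section Equidistribution

variable {b : ℕ} [NeZero b]

lemma sum_inv_Ico_le (b : ℕ) : ∑ v ∈ Finset.Ico 1 b, (1 : ℝ) / v ≤ 1 + Real.log b := by
  rcases Nat.eq_zero_or_pos b with rfl | hb
  · simp
  have h := harmonic_le_one_add_log b
  refine le_trans ?_ h
  rw [harmonic, Rat.cast_sum]
  have : ∑ i ∈ Finset.range b, (((((i + 1 : ℕ) : ℚ)⁻¹ : ℚ)) : ℝ) =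
      ∑ v ∈ Finset.Ico 1 (b + 1), (1 : ℝ) / v := by
    rw [Finset.sum_Ico_eq_sum_range]
    refine Finset.sum_congr (by simp) fun i _ => ?_
    push_cast
    rw [one_div, add_comm]
  rw [this]
  refine Finset.sum_le_sum_of_subset_of_nonneg (Finset.Ico_subset_Ico_right (Nat.le_succ b)) ?_
  intros; positivity

lemma sum_inv_add_inv_le (b : ℕ) :
    ∑ v ∈ Finset.Ico 1 b, (b : ℝ) / 2 * (1 / (v : ℝ) + 1 / ((b : ℝ) - v)) ≤
      b * (1 + Real.log b) := by
  have h1 : ∑ v ∈ Finset.Ico 1 b, 1 / ((b : ℝ) - v) = ∑ v ∈ Finset.Ico 1 b, (1 : ℝ) / v := by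
    refine Finset.sum_nbij' (fun v => b - v) (fun v => b - v) ?_ ?_ ?_ ?_ ?_
    · intro v hv; simp only [Finset.mem_Ico] at hv ⊢; omega
    · intro v hv; simp only [Finset.mem_Ico] at hv ⊢; omega
    · intro v hv; simp only [Finset.mem_Ico] at hv ⊢; omega
    · intro v hv; simp only [Finset.mem_Ico] at hv ⊢; omega
    · intro v hv
      simp only [Finset.mem_Ico] at hv
      rw [Nat.cast_sub hv.2.le]
  rw [← Finset.mul_sum, Finset.sum_add_distrib, h1]
  have := sum_inv_Ico_le b
  have hb : (0 : ℝ) ≤ b := by positivity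
  nlinarith

lemma sum_gcd_div_le (b : ℕ) :
    ∑ v ∈ Finset.Ico 1 b, (Nat.gcd v b : ℝ) / v ≤ b.divisors.card * (1 + Real.log b) := by
  rcases Nat.eq_zero_or_pos b with rfl | hb
  · simp
  have h1 : ∀ v ∈ Finset.Ico 1 b, (Nat.gcd v b : ℝ) / v ≤
      ∑ d ∈ b.divisors, if d ∣ v then (d : ℝ) / v else 0 := by
    intro v _
    have hmem : Nat.gcd v b ∈ b.divisors := by simp [Nat.gcd_dvd_right, hb.ne']
    refine le_trans ?_ (Finset.single_le_sum (f := fun d : ℕ => if d ∣ v then (d : ℝ) / v else 0)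
      (fun _ _ => by positivity) hmem)
    simp [Nat.gcd_dvd_left]
  refine (Finset.sum_le_sum h1).trans ?_
  rw [Finset.sum_comm, ← nsmul_eq_mul]
  refine Finset.sum_le_card_nsmul _ _ _ fun d hd => ?_
  rw [← Finset.sum_filter]
  have hd0 : 0 < d := Nat.pos_of_mem_divisors hd
  refine le_trans ?_ (sum_inv_Ico_le b)
  have hinj : Set.InjOn (fun v => v / d) ((Finset.Ico 1 b).filter (d ∣ ·) : Set ℕ) := by
    intro u hu v hv huv
    simp only [Finset.coe_filter, Set.mem_ofPred_eq] at hu hv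
    simp only at huv
    rw [← Nat.div_mul_cancel hu.2, ← Nat.div_mul_cancel hv.2, huv]
  calc ∑ v ∈ (Finset.Ico 1 b).filter (d ∣ ·), (d : ℝ) / v
      = ∑ v ∈ (Finset.Ico 1 b).filter (d ∣ ·), (1 : ℝ) / ((v / d : ℕ) : ℝ) := by
        refine Finset.sum_congr rfl fun v hv => ?_
        rw [Finset.mem_filter] at hv
        rw [Nat.cast_div hv.2 (by positivity)]
        field_simp
    _ = ∑ w ∈ ((Finset.Ico 1 b).filter (d ∣ ·)).image (fun v => v / d), (1 : ℝ) / w := by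
        rw [Finset.sum_image hinj]
    _ ≤ _ := by
        refine Finset.sum_le_sum_of_subset_of_nonneg ?_ (fun _ _ _ => by positivity)
        intro w hw
        simp only [Finset.mem_image, Finset.mem_filter, Finset.mem_Ico] at hw ⊢
        obtain ⟨v, ⟨⟨hv1, hv2⟩, hdv⟩, rfl⟩ := hw
        exact ⟨Nat.div_pos (Nat.le_of_dvd hv1 hdv) hd0, (Nat.div_le_self _ _).trans_lt hv2⟩

lemma sum_ne_zero_eq_sum_Ico (f : ℕ → ℝ) :
    ∑ a ∈ (Finset.univ : Finset (ZMod b)).erase 0, f a.val = ∑ v ∈ Finset.Ico 1 b, f v := by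
  refine Finset.sum_nbij' (fun a => a.val) (fun v => (v : ZMod b)) ?_ ?_ ?_ ?_ ?_
  · intro a ha
    simp only [Finset.mem_erase, Finset.mem_univ, and_true, Finset.mem_Ico] at ha ⊢
    exact ⟨Nat.pos_of_ne_zero (by simpa [ZMod.val_eq_zero] using ha), ZMod.val_lt a⟩
  · intro v hv
    simp only [Finset.mem_erase, Finset.mem_univ, and_true, Finset.mem_Ico] at hv ⊢
    rw [Ne, ZMod.natCast_eq_zero_iff]
    intro hd
    exact absurd (Nat.le_of_dvd hv.1 hd) (not_le.2 hv.2)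
  · intro a _; simp
  · intro v hv
    simp only [Finset.mem_Ico] at hv
    exact ZMod.val_cast_of_lt hv.2
  · intro a _; rfl

lemma two_mul_min_le_norm_sub_one (a : ZMod b) :
    4 / (b : ℝ) * min (a.val : ℝ) (b - a.val) ≤ ‖(ZMod.stdAddChar a : ℂ) - 1‖ := by
  have hb : (0 : ℝ) < b := by exact_mod_cast NeZero.pos b
  have hv : (a.val : ℝ) < b := by exact_mod_cast ZMod.val_lt a
  have hv0 : (0 : ℝ) ≤ a.val := by positivity
  have h1 : (ZMod.stdAddChar a : ℂ) = Complex.exp (Complex.I * ((2 * π * a.val / b : ℝ) : ℂ)) := by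
    have : a = (((a.val : ℕ) : ℤ) : ZMod b) := by simp
    conv_lhs => rw [this, ZMod.stdAddChar_coe]
    push_cast
    congr 1; ring
  rw [h1, Complex.norm_exp_I_mul_ofReal_sub_one, Real.norm_eq_abs, abs_mul, abs_two]
  have h2 : 2 * π * a.val / b / 2 = π * a.val / b := by ring
  rw [h2]
  have key : 2 / (b : ℝ) * min (a.val : ℝ) (b - a.val) ≤ Real.sin (π * a.val / b) := by
    rcases le_total (a.val : ℝ) (b - a.val) with h | h
    · rw [min_eq_left h]
      have := Real.mul_le_sin (x := π * a.val / b) (by positivity) (by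
        rw [div_le_div_iff₀ hb two_pos]; nlinarith [Real.pi_pos])
      refine le_trans (le_of_eq ?_) this
      field_simp
    · rw [min_eq_right h]
      have hx : π - π * a.val / b = π * (b - a.val) / b := by field_simp
      rw [← Real.sin_pi_sub, hx]
      have := Real.mul_le_sin (x := π * (b - a.val) / b)
        (div_nonneg (mul_nonneg Real.pi_pos.le (by linarith)) hb.le) (by
        rw [div_le_div_iff₀ hb two_pos]; nlinarith [Real.pi_pos])
      refine le_trans (le_of_eq ?_) this
      field_simp
  have := le_abs_self (Real.sin (π * a.val / b))
  calc 4 / (b : ℝ) * min (a.val : ℝ) (b - a.val)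
      = 2 * (2 / (b : ℝ) * min (a.val : ℝ) (b - a.val)) := by ring
    _ ≤ _ := by linarith

lemma norm_sum_stdAddChar_Ico_le (a : ZMod b) (ha : a ≠ 0) (m n : ℤ) :
    ‖∑ i ∈ Finset.Ico m n, (ZMod.stdAddChar (a * (i : ZMod b)) : ℂ)‖ ≤
      (b : ℝ) / 2 * (1 / (a.val : ℝ) + 1 / ((b : ℝ) - a.val)) := by
  have hb : (0 : ℝ) < b := by exact_mod_cast NeZero.pos b
  have hv : (a.val : ℝ) < b := by exact_mod_cast ZMod.val_lt a
  have hv0 : (0 : ℝ) < a.val := by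
    exact_mod_cast Nat.pos_of_ne_zero (by simpa [ZMod.val_eq_zero] using ha)
  have hv1 : (0 : ℝ) < b - a.val := by linarith
  have tel : ((ZMod.stdAddChar a : ℂ) - 1) *
      ∑ i ∈ Finset.Ico m n, (ZMod.stdAddChar (a * (i : ZMod b)) : ℂ) =
      if m ≤ n then (ZMod.stdAddChar (a * (n : ZMod b)) : ℂ) - ZMod.stdAddChar (a * (m : ZMod b))
      else 0 := by
    by_cases hmn : m ≤ n
    · rw [if_pos hmn]
      induction n, hmn using Int.leInduction with
      | base => simp
      | succ k hk ih =>
        rw [← Finset.insert_Ico_right_eq_Ico_add_one hk, Finset.sum_insert (by simp), mul_add, ih]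
        have : (ZMod.stdAddChar (a * ((k + 1 : ℤ) : ZMod b)) : ℂ) =
            ZMod.stdAddChar a * ZMod.stdAddChar (a * (k : ZMod b)) := by
          rw [← AddChar.map_add_eq_mul]; push_cast; congr 1; ring
        rw [this]; ring
    · rw [if_neg hmn, Finset.Ico_eq_empty (by omega)]; simp
  have hnorm : ∀ x : ZMod b, ‖(ZMod.stdAddChar x : ℂ)‖ = 1 := fun x => by simp
  have h1 : ‖(ZMod.stdAddChar a : ℂ) - 1‖ *
      ‖∑ i ∈ Finset.Ico m n, (ZMod.stdAddChar (a * (i : ZMod b)) : ℂ)‖ ≤ 2 := by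
    rw [← norm_mul, tel]
    split_ifs
    · refine (norm_sub_le _ _).trans ?_
      rw [hnorm, hnorm]; norm_num
    · simp
  have h2 := two_mul_min_le_norm_sub_one a
  set S := ‖∑ i ∈ Finset.Ico m n, (ZMod.stdAddChar (a * (i : ZMod b)) : ℂ)‖
  have hS : 0 ≤ S := norm_nonneg _
  have h3 : 4 / (b : ℝ) * min (a.val : ℝ) (b - a.val) * S ≤ 2 :=
    (mul_le_mul_of_nonneg_right h2 hS).trans h1
  have hmin : 0 < min (a.val : ℝ) (b - a.val) := lt_min hv0 hv1
  have h4 : S ≤ (b : ℝ) / 2 * (1 / min (a.val : ℝ) (b - a.val)) := by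
    have : S * (4 / (b : ℝ) * min (a.val : ℝ) (b - a.val)) ≤ 2 := by linarith
    rw [← le_div_iff₀ (by positivity)] at this
    refine this.trans (le_of_eq ?_)
    field_simp; norm_num
  refine h4.trans ?_
  gcongr
  rcases min_choice (a.val : ℝ) (b - a.val) with h | h <;> rw [h]
  · have : 0 ≤ 1 / ((b : ℝ) - a.val) := by positivity
    linarith
  · have : 0 ≤ 1 / (a.val : ℝ) := by positivity
    linarith

lemma sum_norm_sum_stdAddChar_le (l : ℕ) (hl : 0 < l) (m n : ℤ) :
    ∑ h : ZMod b, ‖∑ i ∈ Finset.Ico m n, (ZMod.stdAddChar (h * ((l : ZMod b) * (i : ZMod b))) : ℂ)‖ ≤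
      l * ((Finset.Ico m n).card + b * (1 + Real.log b)) := by
  classical
  set T : ZMod b → ℝ := fun a => ‖∑ i ∈ Finset.Ico m n, (ZMod.stdAddChar (a * (i : ZMod b)) : ℂ)‖
    with hT
  have hT0 : ∀ a, 0 ≤ T a := fun a => norm_nonneg _
  have h1 : ∀ h : ZMod b, ‖∑ i ∈ Finset.Ico m n,
      (ZMod.stdAddChar (h * ((l : ZMod b) * (i : ZMod b))) : ℂ)‖ = T ((l : ZMod b) * h) := by
    intro h
    simp only [hT]
    congr 1
    refine Finset.sum_congr rfl fun i _ => ?_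
    congr 1; ring
  simp_rw [h1]
  have h2 : ∑ h : ZMod b, T ((l : ZMod b) * h) ≤ l * ∑ a : ZMod b, T a := by
    rw [← Finset.sum_fiberwise_of_maps_to (s := Finset.univ)
      (t := (Finset.univ : Finset (ZMod b)))
      (g := fun h : ZMod b => (l : ZMod b) * h) (fun _ _ => Finset.mem_univ _), Finset.mul_sum]
    refine Finset.sum_le_sum fun q _ => ?_
    have : ∀ w ∈ (Finset.univ.filter fun w : ZMod b => (l : ZMod b) * w = q),
        T ((l : ZMod b) * w) = T q := by
      intro w hw
      rw [(Finset.mem_filter.1 hw).2]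
    rw [Finset.sum_congr rfl this, Finset.sum_const, nsmul_eq_mul]
    refine mul_le_mul_of_nonneg_right ?_ (hT0 q)
    have hle := card_mul_eq_le (l : ZMod b) q
    rw [ZMod.val_natCast, ← Nat.gcd_rec, Nat.gcd_comm] at hle
    exact_mod_cast hle.trans (Nat.gcd_le_left _ hl)
  refine h2.trans ?_
  gcongr
  rw [← Finset.add_sum_erase _ _ (Finset.mem_univ (0 : ZMod b))]
  refine add_le_add ?_ ?_
  · simp [hT]
  · refine (Finset.sum_le_sum fun a ha => norm_sum_stdAddChar_Ico_le a
      (Finset.ne_of_mem_erase ha) m n).trans ?_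
    rw [sum_ne_zero_eq_sum_Ico fun v => (b : ℝ) / 2 * (1 / (v : ℝ) + 1 / ((b : ℝ) - v))]
    exact sum_inv_add_inv_le b

lemma sum_norm_sum_mul_gcd_le (r₁ r₂ : ℤ) :
    ∑ k ∈ (Finset.univ : Finset (ZMod b)).erase 0,
      ‖∑ j ∈ Finset.Ico r₁ r₂, (ZMod.stdAddChar (k * (j : ZMod b)) : ℂ)‖ * Nat.gcd k.val b ≤
      b * (b.divisors.card * (1 + Real.log b)) := by
  have hb : (0 : ℝ) < b := by exact_mod_cast NeZero.pos b
  refine (Finset.sum_le_sum fun k hk => mul_le_mul_of_nonneg_right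
    (norm_sum_stdAddChar_Ico_le k (Finset.ne_of_mem_erase hk) r₁ r₂) (by positivity)).trans ?_
  rw [sum_ne_zero_eq_sum_Ico fun v => (b : ℝ) / 2 * (1 / (v : ℝ) + 1 / ((b : ℝ) - v)) *
    (Nat.gcd v b : ℝ)]
  have h1 : ∑ v ∈ Finset.Ico 1 b, (Nat.gcd v b : ℝ) / ((b : ℝ) - v) =
      ∑ v ∈ Finset.Ico 1 b, (Nat.gcd v b : ℝ) / v := by
    refine Finset.sum_nbij' (fun v => b - v) (fun v => b - v) ?_ ?_ ?_ ?_ ?_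
    · intro v hv; simp only [Finset.mem_Ico] at hv ⊢; omega
    · intro v hv; simp only [Finset.mem_Ico] at hv ⊢; omega
    · intro v hv; simp only [Finset.mem_Ico] at hv ⊢; omega
    · intro v hv; simp only [Finset.mem_Ico] at hv ⊢; omega
    · intro v hv
      simp only [Finset.mem_Ico] at hv
      rw [Nat.cast_sub hv.2.le, Nat.gcd_comm (b - v) b, Nat.gcd_self_sub_right hv.2.le,
        Nat.gcd_comm]
  have h2 := sum_gcd_div_le b
  calc ∑ v ∈ Finset.Ico 1 b, (b : ℝ) / 2 * (1 / (v : ℝ) + 1 / ((b : ℝ) - v)) * (Nat.gcd v b : ℝ)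
      = b / 2 * (∑ v ∈ Finset.Ico 1 b, (Nat.gcd v b : ℝ) / v +
          ∑ v ∈ Finset.Ico 1 b, (Nat.gcd v b : ℝ) / ((b : ℝ) - v)) := by
        rw [← Finset.sum_add_distrib, Finset.mul_sum]
        refine Finset.sum_congr rfl fun v _ => by ring
    _ = b * ∑ v ∈ Finset.Ico 1 b, (Nat.gcd v b : ℝ) / v := by rw [h1]; ring
    _ ≤ _ := by gcongr

lemma norm_kloosterman_le (h k : ZMod b) :
    ‖kloosterman b h k‖ ≤
      2 * (Nat.gcd h.val b : ℝ) * (b.divisors.card : ℝ) * (b : ℝ) ^ (3 / 4 : ℝ) := by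
  have hb : (0 : ℝ) < b := by exact_mod_cast NeZero.pos b
  have hg : (1 : ℝ) ≤ Nat.gcd h.val b := by
    exact_mod_cast Nat.gcd_pos_of_pos_right _ (NeZero.pos b)
  have ht : (1 : ℝ) ≤ b.divisors.card := by
    exact_mod_cast Finset.card_pos.2 (Nat.nonempty_divisors.2 (NeZero.ne b))
  have h4 := norm_kloosterman_pow_four_le h k
  rw [← pow_le_pow_iff_left₀ (norm_nonneg _) (by positivity) (by norm_num : (4 : ℕ) ≠ 0)]
  refine h4.trans ?_
  have hr : ((b : ℝ) ^ (3 / 4 : ℝ)) ^ 4 = (b : ℝ) ^ 3 := by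
    rw [← Real.rpow_natCast, ← Real.rpow_mul hb.le]
    norm_num
  rw [mul_pow, mul_pow, mul_pow, hr]
  set g : ℝ := (Nat.gcd h.val b : ℝ)
  set t : ℝ := (b.divisors.card : ℝ)
  have e1 : g ≤ g ^ 4 := le_self_pow₀ hg (by norm_num)
  have e2 : t ^ 3 ≤ t ^ 4 := pow_le_pow_right₀ ht (by norm_num)
  calc 2 * g * (b : ℝ) ^ 3 * t ^ 3 ≤ 2 * g ^ 4 * (b : ℝ) ^ 3 * t ^ 4 := by gcongr
    _ ≤ 2 ^ 4 * g ^ 4 * t ^ 4 * (b : ℝ) ^ 3 := by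
      have : 0 ≤ g ^ 4 * t ^ 4 * (b : ℝ) ^ 3 := by positivity
      nlinarith

set_option maxHeartbeats 1000000 in
/-- The number of solutions of `j * n ≡ κ (mod b)` with `n` in an arithmetic progression and `j`
in an interval is close to its expected value. -/
lemma abs_card_mul_eq_sub_le (l : ℕ) (hl : 0 < l) (d₀ : ℤ) (κ : (ZMod b)ˣ) (m n r₁ r₂ : ℤ) :
    |((((Finset.Ico m n) ×ˢ (Finset.Ico r₁ r₂)).filter fun p : ℤ × ℤ =>
        (p.2 : ZMod b) * ((d₀ + l * p.1 : ℤ) : ZMod b) = κ).card : ℝ) -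
      ((Finset.Ico r₁ r₂).card : ℝ) / b *
        ((Finset.Ico m n).filter fun i : ℤ => IsUnit ((d₀ + l * i : ℤ) : ZMod b)).card| ≤
      2 * l * (b.divisors.card : ℝ) ^ 2 * (1 + Real.log b) ^ 2 * (b : ℝ) ^ (3 / 4 : ℝ) *
        ((Finset.Ico m n).card / b + 1) := by
  classical
  have hb : (0 : ℝ) < b := by exact_mod_cast NeZero.pos b
  have hbC : (b : ℂ) ≠ 0 := by exact_mod_cast hb.ne'
  set ν : ℤ → ZMod b := fun i => ((d₀ + l * i : ℤ) : ZMod b) with hν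
  set S : ZMod b → ℂ := fun k => ∑ j ∈ Finset.Ico r₁ r₂, (ZMod.stdAddChar (k * (j : ZMod b)) : ℂ)
    with hS
  set g : ZMod b → ZMod b → ℂ := fun x k => ∑ w : (ZMod b)ˣ, if (w : ZMod b) = x then
    (ZMod.stdAddChar (-(k * (κ : ZMod b) * ((w⁻¹ : (ZMod b)ˣ) : ZMod b))) : ℂ) else 0 with hg
  set G : ZMod b → ℂ := fun k => ∑ i ∈ Finset.Ico m n, g (ν i) k with hG
  -- detection of the congruence by additive characters
  have hdet : ∀ (x : ZMod b) (j : ZMod b),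
      (∑ k : ZMod b, (ZMod.stdAddChar (k * j) : ℂ) * g x k) =
        b * if j * x = (κ : ZMod b) then 1 else 0 := by
    intro x j
    simp only [hg, Finset.mul_sum]
    rw [Finset.sum_comm]
    have : ∀ w : (ZMod b)ˣ, (∑ k : ZMod b, (ZMod.stdAddChar (k * j) : ℂ) *
        (if (w : ZMod b) = x then
          (ZMod.stdAddChar (-(k * (κ : ZMod b) * ((w⁻¹ : (ZMod b)ˣ) : ZMod b))) : ℂ) else 0)) =
        if (w : ZMod b) = x ∧ j * x = (κ : ZMod b) then (b : ℂ) else 0 := by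
      intro w
      by_cases hw : (w : ZMod b) = x
      · simp only [hw, if_true, true_and]
        have : ∀ k : ZMod b, (ZMod.stdAddChar (k * j) : ℂ) *
            ZMod.stdAddChar (-(k * (κ : ZMod b) * ((w⁻¹ : (ZMod b)ˣ) : ZMod b))) =
            ZMod.stdAddChar (k * (j - (κ : ZMod b) * ((w⁻¹ : (ZMod b)ˣ) : ZMod b))) := by
          intro k
          rw [← AddChar.map_add_eq_mul]; congr 1; ring
        simp_rw [this]
        rw [sum_stdAddChar_mul]
        have hiff : j - (κ : ZMod b) * ((w⁻¹ : (ZMod b)ˣ) : ZMod b) = 0 ↔ j * x = (κ : ZMod b) := by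
          rw [sub_eq_zero, Units.eq_mul_inv_iff_mul_eq, hw]
        simp only [hiff]
      · simp [hw]
    simp_rw [this]
    by_cases hj : j * x = (κ : ZMod b)
    · have hx : IsUnit x := by
        have : IsUnit (j * x) := hj ▸ κ.isUnit
        exact (IsUnit.mul_iff.1 this).2
      obtain ⟨w, rfl⟩ := hx
      simp only [hj, and_true, if_true, mul_one, Units.ext_iff.symm]
      simp
    · simp [hj]
  have hcount : ((((Finset.Ico m n) ×ˢ (Finset.Ico r₁ r₂)).filter fun p : ℤ × ℤ =>
        (p.2 : ZMod b) * ((d₀ + l * p.1 : ℤ) : ZMod b) = κ).card : ℂ) * b = ∑ k, S k * G k := by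
    rw [Finset.card_filter]
    push_cast
    rw [Finset.sum_product, Finset.sum_mul]
    have hSG : ∀ k, S k * G k = ∑ i ∈ Finset.Ico m n, ∑ j ∈ Finset.Ico r₁ r₂,
        (ZMod.stdAddChar (k * (j : ZMod b)) : ℂ) * g (ν i) k := by
      intro k
      simp only [hS, hG, Finset.sum_mul_sum]
      exact Finset.sum_comm
    simp_rw [hSG]
    rw [Finset.sum_comm]
    refine Finset.sum_congr rfl fun i _ => ?_
    rw [Finset.sum_mul, Finset.sum_comm]
    refine Finset.sum_congr rfl fun j _ => ?_
    rw [hdet]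
    simp only [hν]
    push_cast
    ring
  have hS0 : S 0 = ((Finset.Ico r₁ r₂).card : ℂ) := by simp [hS]
  have hG0 : G 0 = (((Finset.Ico m n).filter fun i : ℤ =>
      IsUnit ((d₀ + l * i : ℤ) : ZMod b)).card : ℂ) := by
    rw [Finset.card_filter]
    push_cast
    simp only [hG, hg]
    refine Finset.sum_congr rfl fun i _ => ?_
    by_cases hx : IsUnit (ν i)
    · have h1 : IsUnit ((d₀ : ZMod b) + (l : ZMod b) * (i : ZMod b)) := by
        simpa [hν] using hx
      rw [if_pos h1]
      obtain ⟨w, hw⟩ := hx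
      rw [← hw]
      simp [Units.ext_iff.symm]
    · have h1 : ¬ IsUnit ((d₀ : ZMod b) + (l : ZMod b) * (i : ZMod b)) := by
        simpa [hν] using hx
      rw [if_neg h1]
      refine Finset.sum_eq_zero fun w _ => ?_
      rw [if_neg]
      rintro hw
      exact hx (hw ▸ w.isUnit)
  have hgK : ∀ x k : ZMod b, (b : ℂ) * g x k =
      ∑ h : ZMod b, (ZMod.stdAddChar (h * x) : ℂ) * kloosterman b (k * (-κ : (ZMod b)ˣ)) (-h) := by
    intro x k
    simp only [kloosterman, hg, Finset.mul_sum]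
    rw [Finset.sum_comm]
    refine Fintype.sum_equiv (Equiv.inv _) _ _ fun w => ?_
    simp only [Equiv.inv_apply, inv_inv]
    have : ∀ h : ZMod b, (ZMod.stdAddChar (h * x) : ℂ) *
        ZMod.stdAddChar (k * ((-κ : (ZMod b)ˣ) : ZMod b) * ((w⁻¹ : (ZMod b)ˣ) : ZMod b) +
          -h * (w : ZMod b)) =
        ZMod.stdAddChar (h * (x - (w : ZMod b))) *
          ZMod.stdAddChar (-(k * (κ : ZMod b) * ((w⁻¹ : (ZMod b)ˣ) : ZMod b))) := by
      intro h
      rw [← AddChar.map_add_eq_mul, ← AddChar.map_add_eq_mul]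
      congr 1
      push_cast
      ring
    simp_rw [this]
    rw [← Finset.sum_mul, sum_stdAddChar_mul]
    simp only [sub_eq_zero, eq_comm (a := x)]
    split_ifs <;> simp
  set N : ℝ := ((Finset.Ico m n).card : ℝ) with hN
  set L : ℝ := 1 + Real.log b with hL
  set t : ℝ := (b.divisors.card : ℝ) with ht
  have hL1 : 1 ≤ L := by
    have : 0 ≤ Real.log b := Real.log_natCast_nonneg b
    linarith
  have hGle : ∀ k : ZMod b, ‖G k‖ * b ≤
      (2 * (Nat.gcd k.val b : ℝ) * t * (b : ℝ) ^ (3 / 4 : ℝ)) * (l * (N + b * L)) := by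
    intro k
    have h1 : G k * b = ∑ h : ZMod b, kloosterman b (k * (-κ : (ZMod b)ˣ)) (-h) *
        ∑ i ∈ Finset.Ico m n, (ZMod.stdAddChar (h * ν i) : ℂ) := by
      simp only [hG, Finset.sum_mul, Finset.mul_sum]
      rw [Finset.sum_comm]
      refine Finset.sum_congr rfl fun i _ => ?_
      rw [mul_comm, hgK]
      refine Finset.sum_congr rfl fun h _ => mul_comm _ _
    have h2 : ‖G k‖ * b = ‖G k * b‖ := by rw [norm_mul]; simp
    rw [h2, h1]
    refine (norm_sum_le _ _).trans ?_
    have hK : ∀ h : ZMod b, ‖kloosterman b (k * (-κ : (ZMod b)ˣ)) (-h)‖ ≤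
        2 * (Nat.gcd k.val b : ℝ) * t * (b : ℝ) ^ (3 / 4 : ℝ) := by
      intro h
      refine (norm_kloosterman_le _ _).trans ?_
      have hle := gcd_val_mul_le k ((-κ : (ZMod b)ˣ) : ZMod b)
      have hco : Nat.gcd ((-κ : (ZMod b)ˣ) : ZMod b).val b = 1 := ZMod.val_coe_unit_coprime _
      rw [hco, mul_one] at hle
      have : (Nat.gcd (k * ((-κ : (ZMod b)ˣ) : ZMod b)).val b : ℝ) ≤ Nat.gcd k.val b := by
        exact_mod_cast hle
      gcongr
    have hE : ∀ h : ZMod b, ‖∑ i ∈ Finset.Ico m n, (ZMod.stdAddChar (h * ν i) : ℂ)‖ =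
        ‖∑ i ∈ Finset.Ico m n, (ZMod.stdAddChar (h * ((l : ZMod b) * (i : ZMod b))) : ℂ)‖ := by
      intro h
      have : ∑ i ∈ Finset.Ico m n, (ZMod.stdAddChar (h * ν i) : ℂ) =
          (ZMod.stdAddChar (h * (d₀ : ZMod b)) : ℂ) *
          ∑ i ∈ Finset.Ico m n, (ZMod.stdAddChar (h * ((l : ZMod b) * (i : ZMod b))) : ℂ) := by
        rw [Finset.mul_sum]
        refine Finset.sum_congr rfl fun i _ => ?_
        rw [← AddChar.map_add_eq_mul]
        simp only [hν]; push_cast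
        congr 1; ring
      rw [this, norm_mul]
      simp
    calc _ ≤ ∑ h : ZMod b, (2 * (Nat.gcd k.val b : ℝ) * t * (b : ℝ) ^ (3 / 4 : ℝ)) *
          ‖∑ i ∈ Finset.Ico m n, (ZMod.stdAddChar (h * ((l : ZMod b) * (i : ZMod b))) : ℂ)‖ := by
          refine Finset.sum_le_sum fun h _ => ?_
          rw [norm_mul, hE]
          gcongr
          exact hK h
      _ ≤ _ := by
          rw [← Finset.mul_sum]
          gcongr
          exact sum_norm_sum_stdAddChar_le l hl m n
  set X : ℝ := ((((Finset.Ico m n) ×ˢ (Finset.Ico r₁ r₂)).filter fun p : ℤ × ℤ =>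
        (p.2 : ZMod b) * ((d₀ + l * p.1 : ℤ) : ZMod b) = κ).card : ℝ) with hX
  set R : ℝ := ((Finset.Ico r₁ r₂).card : ℝ) with hR
  set U : ℝ := (((Finset.Ico m n).filter fun i : ℤ =>
      IsUnit ((d₀ + l * i : ℤ) : ZMod b)).card : ℝ) with hU
  have hdiff : ((X - R / b * U : ℝ) : ℂ) * b = ∑ k ∈ Finset.univ.erase 0, S k * G k := by
    have h1 : ∑ k, S k * G k = S 0 * G 0 + ∑ k ∈ Finset.univ.erase 0, S k * G k :=
      (Finset.add_sum_erase _ _ (Finset.mem_univ _)).symm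
    rw [h1, hS0, hG0] at hcount
    have hXc : ((X : ℝ) : ℂ) * b = (R : ℂ) * (U : ℂ) + ∑ k ∈ Finset.univ.erase 0, S k * G k := by
      rw [← Complex.ofReal_natCast] at hcount
      simpa [hX, hR, hU] using hcount
    push_cast
    rw [sub_mul, hXc]
    field_simp
    ring
  have hbound : |X - R / b * U| * (b * b) ≤
      (b * (t * L)) * (2 * t * (b : ℝ) ^ (3 / 4 : ℝ) * (l * (N + b * L))) := by
    have h1 : |X - R / b * U| * b = ‖((X - R / b * U : ℝ) : ℂ) * b‖ := by
      rw [norm_mul, Complex.norm_real]; simp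
    calc |X - R / b * U| * (b * b) = ‖∑ k ∈ Finset.univ.erase 0, S k * G k‖ * b := by
          rw [← hdiff, ← h1]; ring
      _ ≤ (∑ k ∈ Finset.univ.erase 0, ‖S k * G k‖) * b := by
          gcongr; exact norm_sum_le _ _
      _ = ∑ k ∈ Finset.univ.erase 0, ‖S k‖ * (‖G k‖ * b) := by
          rw [Finset.sum_mul]
          refine Finset.sum_congr rfl fun k _ => by rw [norm_mul]; ring
      _ ≤ ∑ k ∈ Finset.univ.erase 0, ‖S k‖ *
          ((2 * (Nat.gcd k.val b : ℝ) * t * (b : ℝ) ^ (3 / 4 : ℝ)) * (l * (N + b * L))) := by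
          refine Finset.sum_le_sum fun k _ => ?_
          exact mul_le_mul_of_nonneg_left (hGle k) (norm_nonneg _)
      _ = (∑ k ∈ Finset.univ.erase 0, ‖S k‖ * (Nat.gcd k.val b : ℝ)) *
          (2 * t * (b : ℝ) ^ (3 / 4 : ℝ) * (l * (N + b * L))) := by
          rw [Finset.sum_mul]
          refine Finset.sum_congr rfl fun k _ => by ring
      _ ≤ _ := by
          gcongr
          exact sum_norm_sum_mul_gcd_le r₁ r₂
  have hfin : |X - R / b * U| ≤ 2 * l * t ^ 2 * L * (b : ℝ) ^ (3 / 4 : ℝ) * (N / b + L) := by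
    refine le_of_mul_le_mul_right (hbound.trans (le_of_eq ?_)) (mul_pos hb hb)
    field_simp
  refine hfin.trans ?_
  have hNb : 0 ≤ N / b := by positivity
  calc 2 * l * t ^ 2 * L * (b : ℝ) ^ (3 / 4 : ℝ) * (N / b + L)
      ≤ 2 * l * t ^ 2 * L * (b : ℝ) ^ (3 / 4 : ℝ) * (L * (N / b + 1)) := by
        gcongr; nlinarith
    _ = _ := by ring

end Equidistribution

section DivisorBound

lemma card_divisors_le_rpow (δ : ℝ) (hδ : 0 < δ) :
    ∃ C : ℝ, 1 ≤ C ∧ ∀ n : ℕ, 0 < n → (n.divisors.card : ℝ) ≤ C * (n : ℝ) ^ δ := by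
  set M : ℕ := ⌈(2 : ℝ) ^ (1 / δ)⌉₊ with hM
  set C₁ : ℝ := 1 + 1 / (δ * Real.log 2) with hC₁
  have hlog : 0 < Real.log 2 := Real.log_pos one_lt_two
  have hC1 : 1 ≤ C₁ := by
    have : 0 ≤ 1 / (δ * Real.log 2) := by positivity
    linarith
  refine ⟨C₁ ^ M, one_le_pow₀ hC1, fun n hn => ?_⟩
  have hfac : (n : ℝ) ^ δ = ∏ p ∈ n.primeFactors, ((p : ℝ) ^ (n.factorization p)) ^ δ := by
    rw [Real.finsetProd_rpow _ _ (fun _ _ => by positivity)]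
    congr 1
    conv_lhs => rw [← Nat.prod_factorization_pow_eq_self hn.ne']
    rw [Finsupp.prod, Nat.support_factorization]
    push_cast
    rfl
  have hterm : ∀ p ∈ n.primeFactors, ((n.factorization p + 1 : ℕ) : ℝ) ≤
      (if p < M then C₁ else 1) * ((p : ℝ) ^ (n.factorization p)) ^ δ := by
    intro p hp
    set a := n.factorization p
    have hp2 : (2 : ℝ) ≤ p := by exact_mod_cast (Nat.prime_of_mem_primeFactors hp).two_le
    split_ifs with h
    · have h1 : ((2 : ℝ) ^ a) ^ δ ≤ ((p : ℝ) ^ a) ^ δ := by gcongr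
      have h2 : ((2 : ℝ) ^ a) ^ δ = Real.exp (Real.log 2 * (a * δ)) := by
        rw [← Real.rpow_natCast, ← Real.rpow_mul (by norm_num), Real.rpow_def_of_pos (by norm_num)]
      have h3 : Real.log 2 * (a * δ) + 1 ≤ ((2 : ℝ) ^ a) ^ δ := by
        rw [h2]; exact Real.add_one_le_exp _
      have ha : (0 : ℝ) ≤ a := by positivity
      calc ((a + 1 : ℕ) : ℝ) ≤ C₁ * (Real.log 2 * (a * δ) + 1) := by
            have : C₁ * (Real.log 2 * (a * δ) + 1) =
              Real.log 2 * (a * δ) + 1 + a + 1 / (δ * Real.log 2) := by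
              rw [hC₁]; field_simp; ring
            rw [this]; push_cast
            have h5 : 0 ≤ Real.log 2 * (a * δ) := by positivity
            have h6 : 0 ≤ 1 / (δ * Real.log 2) := by positivity
            linarith
        _ ≤ _ := by gcongr; exact h3.trans h1
    · have h1 : (2 : ℝ) ^ (1 / δ) ≤ p := (Nat.le_ceil _).trans (by exact_mod_cast not_lt.1 h)
      have h2 : (2 : ℝ) ≤ (p : ℝ) ^ δ := by
        calc (2 : ℝ) = ((2 : ℝ) ^ (1 / δ)) ^ δ := by
              rw [← Real.rpow_mul (by norm_num), one_div_mul_cancel hδ.ne', Real.rpow_one]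
          _ ≤ _ := by gcongr
      have h3 : ((p : ℝ) ^ a) ^ δ = ((p : ℝ) ^ δ) ^ a := by
        rw [← Real.rpow_natCast, ← Real.rpow_natCast, ← Real.rpow_mul (by positivity),
          ← Real.rpow_mul (by positivity), mul_comm]
      rw [one_mul, h3]
      have h4 : ((a + 1 : ℕ) : ℝ) ≤ (2 : ℝ) ^ a := by
        exact_mod_cast Nat.succ_le_of_lt (Nat.lt_two_pow_self)
      exact h4.trans (by gcongr)
  have hprod : ∏ p ∈ n.primeFactors, (if p < M then C₁ else 1) ≤ C₁ ^ M := by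
    rw [Finset.prod_ite, Finset.prod_const_one, mul_one, Finset.prod_const]
    refine pow_le_pow_right₀ hC1 ?_
    calc _ ≤ (Finset.range M).card := Finset.card_le_card fun p hp => by
            simpa using (Finset.mem_filter.1 hp).2
      _ = M := Finset.card_range M
  rw [Nat.card_divisors hn.ne', hfac]
  push_cast
  calc ∏ p ∈ n.primeFactors, ((n.factorization p : ℝ) + 1)
      ≤ ∏ p ∈ n.primeFactors, ((if p < M then C₁ else 1) *
          ((p : ℝ) ^ (n.factorization p)) ^ δ) := by
        refine Finset.prod_le_prod (fun _ _ => by positivity) fun p hp => ?_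
        exact_mod_cast hterm p hp
    _ = (∏ p ∈ n.primeFactors, (if p < M then C₁ else 1)) *
        ∏ p ∈ n.primeFactors, ((p : ℝ) ^ (n.factorization p)) ^ δ := Finset.prod_mul_distrib
    _ ≤ _ := by gcongr

end DivisorBound

section Discrepancy

lemma exists_Ico_of_convex (c : ℤ → Prop) (hconv : ∀ i j k, i ≤ j → j ≤ k → c i → c k → c j)
    (D : ℝ) (hD : 0 ≤ D) (hb : ∀ i k, i ≤ k → c i → c k → ((k - i : ℤ) : ℝ) ≤ D) :
    ∃ m n : ℤ, (∀ i, i ∈ Finset.Ico m n ↔ c i) ∧ ((Finset.Ico m n).card : ℝ) ≤ D + 1 := by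
  classical
  by_cases hne : ∃ i, c i
  · obtain ⟨i₀, hi₀⟩ := hne
    have hup : ∀ k, c k → k ≤ i₀ + ⌈D⌉ := by
      intro k hk
      rcases le_total k i₀ with h | h
      · have : 0 ≤ ⌈D⌉ := Int.ceil_nonneg hD
        omega
      · have h1 := (hb i₀ k h hi₀ hk).trans (Int.le_ceil D)
        have : k - i₀ ≤ ⌈D⌉ := by exact_mod_cast h1
        omega
    have hlo : ∀ k, c k → i₀ - ⌈D⌉ ≤ k := by
      intro k hk
      rcases le_total i₀ k with h | h
      · have : 0 ≤ ⌈D⌉ := Int.ceil_nonneg hD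
        omega
      · have h1 := (hb k i₀ h hk hi₀).trans (Int.le_ceil D)
        have : i₀ - k ≤ ⌈D⌉ := by exact_mod_cast h1
        omega
    obtain ⟨M, hM, hM'⟩ := Int.exists_greatest_of_bdd (P := c) ⟨_, hup⟩ ⟨i₀, hi₀⟩
    obtain ⟨m, hm, hm'⟩ := Int.exists_least_of_bdd (P := c) ⟨_, hlo⟩ ⟨i₀, hi₀⟩
    refine ⟨m, M + 1, fun i => ?_, ?_⟩
    · rw [Finset.mem_Ico]
      constructor
      · rintro ⟨h1, h2⟩
        exact hconv m i M h1 (by omega) hm hM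
      · intro h
        exact ⟨hm' i h, by have := hM' i h; omega⟩
    · have hmM : m ≤ M := hm' M hM
      have := hb m M hmM hm hM
      rw [Int.card_Ico]
      have h2 : (((M + 1 - m).toNat : ℕ) : ℤ) = M + 1 - m := Int.toNat_of_nonneg (by omega)
      have h3 : (((M + 1 - m).toNat : ℕ) : ℝ) = ((M + 1 - m : ℤ) : ℝ) := by exact_mod_cast h2
      rw [h3]; push_cast at this ⊢; linarith
  · push Not at hne
    exact ⟨0, 0, fun i => by simp [hne i], by simp; linarith⟩

lemma affine_pos_of_between {A B i j k : ℝ} (hij : i ≤ j) (hjk : j ≤ k) (hi : 0 < A + B * i)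
    (hk : 0 < A + B * k) : 0 < A + B * j := by
  rcases le_total 0 B with h | h
  · nlinarith [mul_le_mul_of_nonneg_left hij h]
  · nlinarith [mul_le_mul_of_nonpos_left hjk h]

lemma affine_nonneg_of_between {A B i j k : ℝ} (hij : i ≤ j) (hjk : j ≤ k) (hi : 0 ≤ A + B * i)
    (hk : 0 ≤ A + B * k) : 0 ≤ A + B * j := by
  rcases le_total 0 B with h | h
  · nlinarith [mul_le_mul_of_nonneg_left hij h]
  · nlinarith [mul_le_mul_of_nonpos_left hjk h]

/-- Lattice points `(Q, p)` with `1 ≤ Q ≤ n`, slope in `(α, β]` and residues modulo `l`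
satisfying `P`, with coprime coordinates. -/
noncomputable def primSet (l : ℕ) (P : ZMod l → ZMod l → Prop) (α β : ℝ) (n : ℕ) :
    Finset (Σ _ : ℕ, ℤ) :=
  open Classical in
  (Finset.Icc 1 n).sigma fun Q => (Finset.Ioc ⌊α * Q⌋ ⌊β * Q⌋).filter fun p =>
    P Q p ∧ IsCoprime (Q : ℤ) p

/-- The points `(Q, p)` as in `primSet` together with `Q'` such that `Q ∣ Q' p - σ` and
`Q' / Q ∈ (x, y)`. -/
noncomputable def compSet (l : ℕ) (P : ZMod l → ZMod l → Prop) (α β : ℝ) (σ : ℤ) (x y : ℝ)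
    (n : ℕ) : Finset (Σ _ : ℕ, ℤ × ℤ) :=
  open Classical in
  (Finset.Icc 1 n).sigma fun Q =>
    ((Finset.Ioc ⌊α * Q⌋ ⌊β * Q⌋) ×ˢ (Finset.Ico (0 : ℤ) Q)).filter fun w =>
    P Q w.1 ∧ (Q : ℤ) ∣ w.2 * w.1 - σ ∧ x * Q < w.2 ∧ (w.2 : ℝ) < y * Q

lemma mem_primSet {l : ℕ} {P : ZMod l → ZMod l → Prop} {α β : ℝ} {n : ℕ} {v : Σ _ : ℕ, ℤ} :
    v ∈ primSet l P α β n ↔ (1 ≤ v.1 ∧ v.1 ≤ n) ∧ (α * v.1 < v.2 ∧ (v.2 : ℝ) ≤ β * v.1) ∧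
      P v.1 v.2 ∧ IsCoprime (v.1 : ℤ) v.2 := by
  simp [primSet, Int.floor_lt, Int.le_floor]

lemma mem_compSet {l : ℕ} {P : ZMod l → ZMod l → Prop} {α β : ℝ} {σ : ℤ} {x y : ℝ} {n : ℕ}
    {v : Σ _ : ℕ, ℤ × ℤ} :
    v ∈ compSet l P α β σ x y n ↔ (1 ≤ v.1 ∧ v.1 ≤ n) ∧
      ((α * v.1 < v.2.1 ∧ (v.2.1 : ℝ) ≤ β * v.1) ∧ 0 ≤ v.2.2 ∧ v.2.2 < v.1) ∧
      P v.1 v.2.1 ∧ (v.1 : ℤ) ∣ v.2.2 * v.2.1 - σ ∧ x * v.1 < v.2.2 ∧ (v.2.2 : ℝ) < y * v.1 := by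
  simp [compSet, Int.floor_lt, Int.le_floor]

set_option maxHeartbeats 1000000 in
lemma card_compSet_fibre_ge {l : ℕ} (hl : 0 < l) (P : ZMod l → ZMod l → Prop)
    {α β Y : ℝ} (hY : β - α ≤ Y) (hY0 : 0 ≤ Y) (n : ℕ) {s r u t b d₀ σ : ℤ}
    (hs : 1 ≤ s) (hd₀ : 0 ≤ d₀ ∧ d₀ < l) (hdet : s * t - r * u = 1) (hb : b ≠ 0) (hσ : σ = 1 ∨ σ = -1)
    {x y : ℝ} (hx : 0 ≤ x) (hxy : x ≤ y) (hy : y ≤ 1) :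
    (y - x) * (((primSet l P α β n).filter fun v =>
        s < v.1 ∧ s * v.2 - r * v.1 = b ∧ (t * v.1 - u * v.2) % l = d₀).card : ℝ) -
      (2 * l * (b.natAbs.divisors.card : ℝ) ^ 2 * (1 + Real.log b.natAbs) ^ 2 *
        (b.natAbs : ℝ) ^ (3 / 4 : ℝ) + 3) *
        (((n : ℝ) ^ (7 / 4 : ℝ) * Y ^ (3 / 4 : ℝ) * (b.natAbs : ℝ) ^ (-(3 / 4) : ℝ) + 1) /
          b.natAbs + 1) ≤
      (((compSet l P α β σ x y n).filter fun v =>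
        s < v.1 ∧ s * v.2.1 - r * v.1 = b ∧ (t * v.1 - u * v.2.1) % l = d₀).card : ℝ) := by
  classical
  set m : ℕ := b.natAbs with hm
  have hm0 : 0 < m := Int.natAbs_pos.2 hb
  have : NeZero m := ⟨hm0.ne'⟩
  have hm0' : (0 : ℝ) < m := by exact_mod_cast hm0
  have hlR : (0 : ℝ) < l := by exact_mod_cast hl
  obtain ⟨η, hη, hbη⟩ : ∃ η : ℤ, (η = 1 ∨ η = -1) ∧ b = η * m := by
    rcases Int.natAbs_eq b with h | h
    · exact ⟨1, Or.inl rfl, by rw [one_mul]; exact h⟩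
    · exact ⟨-1, Or.inr rfl, by rw [neg_one_mul]; exact h⟩
  -- the fibre in the variable `i`, where `d = d₀ + l i`, `Q = d s + b u`, `p = d r + b t`
  set Qf : ℤ → ℤ := fun i => (d₀ + l * i) * s + b * u with hQf
  set pf : ℤ → ℤ := fun i => (d₀ + l * i) * r + b * t with hpf
  set c : ℤ → Prop := fun i => (s < Qf i ∧ Qf i ≤ n) ∧
    (α * Qf i < pf i ∧ (pf i : ℝ) ≤ β * Qf i) with hc
  have hrel : ∀ i, s * pf i - r * Qf i = b := fun i => by
    simp only [hQf, hpf]; linear_combination b * hdet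
  have hrel' : ∀ i, t * Qf i - u * pf i = d₀ + l * i := fun i => by
    simp only [hQf, hpf]; linear_combination (d₀ + l * i) * hdet
  have hconv : ∀ i j k, i ≤ j → j ≤ k → c i → c k → c j := by
    intro i j k hij hjk hi hk
    have hij' : (i : ℝ) ≤ j := by exact_mod_cast hij
    have hjk' : (j : ℝ) ≤ k := by exact_mod_cast hjk
    have hls : (0 : ℤ) < l * s := by positivity
    have e1 : Qf i ≤ Qf j := by
      simp only [hQf]; nlinarith [mul_le_mul_of_nonneg_left hij hls.le]
    have e2 : Qf j ≤ Qf k := by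
      simp only [hQf]; nlinarith [mul_le_mul_of_nonneg_left hjk hls.le]
    refine ⟨⟨hi.1.1.trans_le e1, e2.trans hk.1.2⟩, ?_, ?_⟩
    · have h := affine_pos_of_between (A := (d₀ * r + b * t : ℝ) - α * (d₀ * s + b * u))
        (B := l * r - α * (l * s)) hij' hjk' (by
          have := hi.2.1; simp only [hQf, hpf] at this; push_cast at this; linarith) (by
          have := hk.2.1; simp only [hQf, hpf] at this; push_cast at this; linarith)
      simp only [hQf, hpf]; push_cast; linarith
    · have h := affine_nonneg_of_between (A := β * (d₀ * s + b * u) - (d₀ * r + b * t : ℝ))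
        (B := β * (l * s) - l * r) hij' hjk' (by
          have := hi.2.2; simp only [hQf, hpf] at this; push_cast at this; linarith) (by
          have := hk.2.2; simp only [hQf, hpf] at this; push_cast at this; linarith)
      simp only [hQf, hpf]; push_cast; linarith
  have hspan : ∀ i k, i ≤ k → c i → c k → ((k - i : ℤ) : ℝ) ≤
      (n : ℝ) ^ (7 / 4 : ℝ) * Y ^ (3 / 4 : ℝ) * (m : ℝ) ^ (-(3 / 4) : ℝ) := by
    intro i k hik hi hk
    set Δ : ℝ := ((k - i : ℤ) : ℝ) with hΔ
    have hΔ0 : 0 ≤ Δ := by rw [hΔ]; exact_mod_cast sub_nonneg.2 hik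
    have hl1 : (1 : ℤ) ≤ l := by exact_mod_cast hl
    have h1 : Δ ≤ n := by
      have : k - i ≤ n := by
        have e : Qf k - Qf i = (l * s) * (k - i) := by simp only [hQf]; ring
        have h2 : Qf k - Qf i ≤ n := by have := hi.1.1; have := hk.1.2; omega
        have h3 : 1 ≤ (l : ℤ) * s := by nlinarith
        nlinarith [mul_le_mul_of_nonneg_right h3 (sub_nonneg.2 hik)]
      rw [hΔ]; exact_mod_cast this
    have h2 : Δ ≤ Y * n ^ 2 / m := by
      have hs0 : s ≠ 0 := by omega
      have e : pf k * Qf i - pf i * Qf k = -(b * (l * (k - i))) := by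
        apply mul_left_cancel₀ hs0
        have e1 := hrel i
        have e2 := hrel k
        have e3 : Qf k - Qf i = (l * s) * (k - i) := by simp only [hQf]; ring
        linear_combination Qf i * e2 - Qf k * e1 - b * e3
      have eR : (pf k : ℝ) * Qf i - pf i * Qf k = -(b * (l * Δ)) := by
        rw [hΔ]; exact_mod_cast e
      have qi0 : (0 : ℝ) < Qf i := by exact_mod_cast (by omega : 0 < s).trans hi.1.1
      have qk0 : (0 : ℝ) < Qf k := by exact_mod_cast (by omega : 0 < s).trans hk.1.1
      have qin : (Qf i : ℝ) ≤ n := by exact_mod_cast hi.1.2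
      have qkn : (Qf k : ℝ) ≤ n := by exact_mod_cast hk.1.2
      have habs : |(pf k : ℝ) * Qf i - pf i * Qf k| ≤ Y * (Qf i * Qf k) := by
        have a1 := mul_le_mul_of_nonneg_right hi.2.1.le qk0.le
        have a2 := mul_le_mul_of_nonneg_right hi.2.2 qk0.le
        have a3 := mul_le_mul_of_nonneg_right hk.2.1.le qi0.le
        have a4 := mul_le_mul_of_nonneg_right hk.2.2 qi0.le
        have a5 := mul_le_mul_of_nonneg_right hY (mul_pos qi0 qk0).le
        rw [abs_le]
        constructor <;> nlinarith
      rw [eR, abs_neg, abs_mul, abs_mul, abs_of_pos hlR, abs_of_nonneg hΔ0] at habs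
      have hbm : |(b : ℝ)| = m := by rw [hm, Nat.cast_natAbs]; push_cast; rfl
      rw [hbm] at habs
      have hlR1 : (1 : ℝ) ≤ l := by exact_mod_cast hl
      rw [le_div_iff₀ hm0']
      have h5 : (Qf i : ℝ) * Qf k ≤ n ^ 2 := by
        rw [sq]; exact mul_le_mul qin qkn qk0.le (by positivity)
      have h6 : Δ * m ≤ m * (l * Δ) := by nlinarith [mul_nonneg hΔ0 hm0'.le]
      exact h6.trans (habs.trans (mul_le_mul_of_nonneg_left h5 hY0))
    have hn0 : (0 : ℝ) ≤ n := by positivity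
    calc Δ = Δ ^ (1 / 4 : ℝ) * Δ ^ (3 / 4 : ℝ) := by
          rw [← Real.rpow_add' hΔ0 (by norm_num)]; norm_num
      _ ≤ (n : ℝ) ^ (1 / 4 : ℝ) * (Y * n ^ 2 / m) ^ (3 / 4 : ℝ) := by gcongr
      _ = _ := by
          rw [Real.div_rpow (by positivity) hm0'.le, Real.mul_rpow hY0 (by positivity),
            Real.rpow_neg hm0'.le, ← Real.rpow_natCast (n : ℝ) 2, ← Real.rpow_mul hn0]
          have : (n : ℝ) ^ (7 / 4 : ℝ) = (n : ℝ) ^ (1 / 4 : ℝ) * (n : ℝ) ^ (((2 : ℕ) : ℝ) * (3 / 4))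
            := by rw [← Real.rpow_add' hn0 (by norm_num)]; norm_num
          rw [this]; ring
  obtain ⟨m₁, m₂, hmem, hcard⟩ := exists_Ico_of_convex c hconv _ (by positivity) hspan
  set D : ℝ := (n : ℝ) ^ (7 / 4 : ℝ) * Y ^ (3 / 4 : ℝ) * (m : ℝ) ^ (-(3 / 4) : ℝ) with hD
  set A : ℝ := 2 * l * (m.divisors.card : ℝ) ^ 2 * (1 + Real.log m) ^ 2 *
    (m : ℝ) ^ (3 / 4 : ℝ) with hA
  have hA0 : 0 ≤ A := mul_nonneg (mul_nonneg (mul_nonneg (by linarith) (sq_nonneg _))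
    (sq_nonneg _)) (Real.rpow_nonneg hm0'.le _)
  have hD0 : 0 ≤ D := by positivity
  by_cases hP : P ((d₀ * s + b * u : ℤ) : ZMod l) ((d₀ * r + b * t : ℤ) : ZMod l)
  swap
  · have hemp : ((primSet l P α β n).filter fun v =>
        s < v.1 ∧ s * v.2 - r * v.1 = b ∧ (t * v.1 - u * v.2) % l = d₀) = ∅ := by
      rw [Finset.filter_eq_empty_iff]
      rintro ⟨Q, p⟩ hv ⟨_, h2, h3⟩
      rw [mem_primSet] at hv
      simp only at hv h2 h3
      apply hP
      have hdiv : (l : ℤ) ∣ (t * Q - u * p) - d₀ := by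
        rw [← h3]; exact Int.dvd_self_sub_emod
      obtain ⟨i, hi⟩ := hdiv
      have eQ : (Q : ℤ) = d₀ * s + b * u + l * (i * s) := by
        linear_combination (-(Q : ℤ)) * hdet + s * hi + u * h2
      have ep : p = d₀ * r + b * t + l * (i * r) := by
        linear_combination (-p) * hdet + r * hi + t * h2
      have eQ' : ((Q : ℕ) : ZMod l) = ((d₀ * s + b * u : ℤ) : ZMod l) := by
        have : (((Q : ℕ) : ℤ) : ZMod l) = ((d₀ * s + b * u + l * (i * s) : ℤ) : ZMod l) := by
          rw [eQ]
        simpa using this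
      have ep' : (p : ZMod l) = ((d₀ * r + b * t : ℤ) : ZMod l) := by
        rw [ep]; simp
      rw [← eQ', ← ep']
      exact hv.2.2.1
    rw [hemp, Finset.card_empty, Nat.cast_zero, mul_zero]
    have : 0 ≤ (A + 3) * ((D + 1) / m + 1) := mul_nonneg (by linarith)
      (add_nonneg (div_nonneg (by linarith) hm0'.le) zero_le_one)
    have h2 : (0 : ℝ) ≤ (((compSet l P α β σ x y n).filter fun v =>
        s < v.1 ∧ s * v.2.1 - r * v.1 = b ∧ (t * v.1 - u * v.2.1) % l = d₀).card : ℝ) :=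
      Nat.cast_nonneg _
    linarith
  -- the residue class `κ` and the range of `j`
  obtain ⟨κ, hκ⟩ : ∃ κ : (ZMod m)ˣ, (κ : ZMod m) = ((-(η * σ) : ℤ) : ZMod m) := by
    rcases hη with rfl | rfl <;> rcases hσ with rfl | rfl
    · exact ⟨-1, by simp⟩
    · exact ⟨1, by simp⟩
    · exact ⟨1, by simp⟩
    · exact ⟨-1, by simp⟩
  set r₁ : ℤ := ⌈x * m⌉ + 1 with hr₁
  set r₂ : ℤ := ⌊y * m⌋ with hr₂
  have heq := abs_card_mul_eq_sub_le (b := m) l hl d₀ κ m₁ m₂ r₁ r₂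
  rw [← hA] at heq
  set X : ℝ := ((((Finset.Ico m₁ m₂) ×ˢ (Finset.Ico r₁ r₂)).filter fun p : ℤ × ℤ =>
        (p.2 : ZMod m) * ((d₀ + l * p.1 : ℤ) : ZMod m) = κ).card : ℝ) with hX
  set U : ℝ := (((Finset.Ico m₁ m₂).filter fun i : ℤ =>
    IsUnit ((d₀ + l * i : ℤ) : ZMod m)).card : ℝ) with hU
  have hUN : U ≤ (Finset.Ico m₁ m₂).card := by
    rw [hU]; exact_mod_cast Finset.card_filter_le _ _
  have hR : (y - x) * m - 3 ≤ ((Finset.Ico r₁ r₂).card : ℝ) := by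
    rw [Int.card_Ico]
    have h1 : r₂ - r₁ ≤ ((r₂ - r₁).toNat : ℤ) := Int.self_le_toNat _
    have h1' : (r₂ : ℝ) - r₁ ≤ ((r₂ - r₁).toNat : ℝ) := by exact_mod_cast h1
    have h2 : y * m - 1 < r₂ := by rw [hr₂]; exact Int.sub_one_lt_floor _
    have h3 : (r₁ : ℝ) < x * m + 1 + 1 := by
      rw [hr₁]; push_cast; linarith [Int.ceil_lt_add_one (x * (m : ℝ))]
    nlinarith
  have hprim : (((primSet l P α β n).filter fun v =>
        s < v.1 ∧ s * v.2 - r * v.1 = b ∧ (t * v.1 - u * v.2) % l = d₀).card : ℝ) ≤ U := by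
    rw [hU]
    norm_cast
    refine Finset.card_le_card_of_injOn (fun v => (t * v.1 - u * v.2 - d₀) / l) ?_ ?_
    · rintro ⟨Q, p⟩ hv
      simp only [Finset.coe_filter, Set.mem_ofPred_eq, mem_primSet] at hv
      obtain ⟨⟨⟨h1, h2⟩, ⟨h3, h4⟩, -, h5⟩, h6, h7, h8⟩ := hv
      have hdiv : (l : ℤ) ∣ (t * Q - u * p) - d₀ := by
        rw [← h8]; exact Int.dvd_self_sub_emod
      obtain ⟨i, hi⟩ := hdiv
      have hl0 : (l : ℤ) ≠ 0 := by positivity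
      have hquot : (t * (Q : ℤ) - u * p - d₀) / l = i := by
        rw [hi]; exact Int.mul_ediv_cancel_left _ hl0
      have eQ : Qf i = Q := by
        simp only [hQf]; linear_combination (Q : ℤ) * hdet - s * hi - u * h7
      have ep : pf i = p := by
        simp only [hpf]; linear_combination p * hdet - r * hi - t * h7
      simp only [Finset.coe_filter, Set.mem_ofPred_eq]
      rw [hquot, hmem]
      refine ⟨⟨⟨by rw [eQ]; exact h6, by rw [eQ]; exact_mod_cast h2⟩, ?_, ?_⟩, ?_⟩
      · rw [eQ, ep]; exact_mod_cast h3
      · rw [eQ, ep]; exact_mod_cast h4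
      · have hco : IsCoprime (d₀ + l * i) b := by
          rw [← hrel' i, ← hrel i, eQ, ep]
          obtain ⟨a, a', haa⟩ := h5
          refine ⟨a * s + a' * r, a * u + a' * t, ?_⟩
          linear_combination haa + (a * Q + a' * p) * hdet
        have hco' : IsCoprime (d₀ + l * i) (m : ℤ) := by
          rw [hbη] at hco
          exact hco.of_isCoprime_of_dvd_right (dvd_mul_left _ _)
        exact (ZMod.coe_int_isUnit_iff_isCoprime _ _).2 hco'.symm
    · rintro ⟨Q, p⟩ hv ⟨Q', p'⟩ hv' hvv
      simp only [Finset.coe_filter, Set.mem_ofPred_eq, mem_primSet] at hv hv'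
      obtain ⟨-, -, h7, h8⟩ := hv
      obtain ⟨-, -, h7', h8'⟩ := hv'
      simp only at hvv
      have e1 : t * (Q : ℤ) - u * p - d₀ = t * (Q' : ℤ) - u * p' - d₀ := by
        have a1 : (l : ℤ) ∣ (t * Q - u * p) - d₀ := by
          rw [← h8]; exact Int.dvd_self_sub_emod
        have a2 : (l : ℤ) ∣ (t * Q' - u * p') - d₀ := by
          rw [← h8']; exact Int.dvd_self_sub_emod
        rw [← Int.ediv_mul_cancel a1, ← Int.ediv_mul_cancel a2, hvv]
      have eQ : (Q : ℤ) = Q' := by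
        linear_combination (-(Q : ℤ) + Q') * hdet + s * e1 + u * (h7 - h7')
      have ep : p = p' := by
        linear_combination (-p + p') * hdet + r * e1 + t * (h7 - h7')
      have eQ' : Q = Q' := by exact_mod_cast eQ
      subst eQ'; subst ep; rfl
  have hquot' : ∀ i j d' : ℤ, (j : ZMod m) * ((d₀ + l * i : ℤ) : ZMod m) = κ →
      (η * σ + j * (d₀ + l * i)) / m = d' → d' * m = η * σ + j * (d₀ + l * i) := by
    intro i j d' h1 h2
    have hdvd : (m : ℤ) ∣ η * σ + j * (d₀ + l * i) := by
      rw [← ZMod.intCast_zmod_eq_zero_iff_dvd, Int.cast_add, Int.cast_mul j, h1, hκ, Int.cast_neg]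
      exact add_neg_cancel _
    rw [← h2]; exact Int.ediv_mul_cancel hdvd
  have hquot : ∀ i j : ℤ, (j : ZMod m) * ((d₀ + l * i : ℤ) : ZMod m) = κ →
      ∃ d' : ℤ, (η * σ + j * (d₀ + l * i)) / m = d' ∧
        (m : ℤ) * (d' * s + η * j * u) = η * σ * s + j * Qf i := by
    intro i j h1
    refine ⟨_, rfl, ?_⟩
    have := hquot' i j _ h1 rfl
    simp only [hQf]
    linear_combination s * this - j * u * hbη
  have hcomp : X ≤ (((compSet l P α β σ x y n).filter fun v =>
        s < v.1 ∧ s * v.2.1 - r * v.1 = b ∧ (t * v.1 - u * v.2.1) % l = d₀).card : ℝ) := by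
    rw [hX, Nat.cast_le]
    refine Finset.card_le_card_of_injOn (fun w => ⟨(Qf w.1).toNat, pf w.1,
      (η * σ + w.2 * (d₀ + l * w.1)) / m * s + η * w.2 * u⟩) ?_ ?_
    · rintro ⟨i, j⟩ hij
      simp only [Finset.coe_filter, Set.mem_ofPred_eq, Finset.mem_product] at hij
      obtain ⟨⟨hi, hj⟩, hκ'⟩ := hij
      rw [hmem] at hi
      obtain ⟨d', hd', hQ'⟩ := hquot i j hκ'
      have hQ0 : 0 < Qf i := by have := hi.1.1; omega
      have hQn : ((Qf i).toNat : ℤ) = Qf i := Int.toNat_of_nonneg hQ0.le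
      have hQnR : ((Qf i).toNat : ℝ) = (Qf i : ℝ) := by exact_mod_cast hQn
      have hQnZ : (((Qf i).toNat : ℕ) : ZMod l) = ((Qf i : ℤ) : ZMod l) := by
        rw [← hQn]; simp
      have hQ0R : (0 : ℝ) < Qf i := by exact_mod_cast hQ0
      rw [Finset.mem_Ico] at hj
      have hQs : |((η * σ * s : ℤ) : ℝ)| < Qf i := by
        have : |η * σ * s| < Qf i := by
          have hs' := hi.1.1
          rw [abs_lt]
          rcases hη with rfl | rfl <;> rcases hσ with rfl | rfl <;> constructor <;> omega
        exact_mod_cast this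
      rw [abs_lt] at hQs
      have hQ'R : (m : ℝ) * ((d' * s + η * j * u : ℤ) : ℝ) =
          ((η * σ * s : ℤ) : ℝ) + j * Qf i := by exact_mod_cast hQ'
      set q' : ℤ := d' * s + η * j * u with hq'
      have hj1 : x * m + 1 ≤ (j : ℝ) := by
        have : (r₁ : ℝ) ≤ j := by exact_mod_cast hj.1
        rw [hr₁] at this; push_cast at this
        linarith [Int.le_ceil (x * (m : ℝ))]
      have hj2 : (j : ℝ) + 1 ≤ y * m := by
        have : ((j + 1 : ℤ) : ℝ) ≤ r₂ := by exact_mod_cast hj.2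
        push_cast at this
        exact this.trans (Int.floor_le _)
      have hlow : x * Qf i < q' := by
        have h5 := mul_le_mul_of_nonneg_right hj1 hQ0R.le
        refine lt_of_mul_lt_mul_left ?_ hm0'.le
        have h6 : (m : ℝ) * (x * Qf i) = (x * m + 1) * Qf i - Qf i := by ring
        rw [hQ'R, h6]; linarith only [h5, hQs.1]
      have hupp : (q' : ℝ) < y * Qf i := by
        have h5 := mul_le_mul_of_nonneg_right hj2 hQ0R.le
        refine lt_of_mul_lt_mul_left ?_ hm0'.le
        have h6 : (m : ℝ) * (y * Qf i) = y * m * Qf i := by ring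
        rw [hQ'R, h6]; linarith only [h5, hQs.2]
      simp only [Finset.coe_filter, Set.mem_ofPred_eq, mem_compSet]
      rw [hd', ← hq', hQn, hQnR, hQnZ]
      refine ⟨⟨⟨?_, ?_⟩, ⟨hi.2, ?_, ?_⟩, ?_, ?_, hlow, hupp⟩, hi.1.1, hrel i, ?_⟩
      · omega
      · have := hi.1.2; omega
      · have : (0 : ℝ) < q' := lt_of_le_of_lt (mul_nonneg hx hQ0R.le) hlow
        exact_mod_cast this.le
      · have : (q' : ℝ) < Qf i := hupp.trans_le (mul_le_of_le_one_left hQ0R.le hy)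
        exact_mod_cast this
      · have e1 : ((Qf i : ℤ) : ZMod l) = ((d₀ * s + b * u : ℤ) : ZMod l) := by
          have : Qf i = d₀ * s + b * u + l * (i * s) := by simp only [hQf]; ring
          rw [this, Int.cast_add, Int.cast_mul]; simp
        have e2 : ((pf i : ℤ) : ZMod l) = ((d₀ * r + b * t : ℤ) : ZMod l) := by
          have : pf i = d₀ * r + b * t + l * (i * r) := by simp only [hpf]; ring
          rw [this, Int.cast_add, Int.cast_mul]; simp
        rw [e1, e2]; exact hP
      · refine ⟨d' * r + η * j * t, ?_⟩
        have hdm := hquot' i j d' hκ' hd'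
        have hηη : η * η = 1 := by rcases hη with rfl | rfl <;> norm_num
        simp only [hq', hQf, hpf]
        rw [hbη]
        linear_combination (η * (m : ℤ) * d' - η * j * (d₀ + l * i)) * hdet + η * hdm + σ * hηη
      · rw [hrel' i, Int.add_mul_emod_self_left]
        exact Int.emod_eq_of_lt hd₀.1 hd₀.2
    · rintro ⟨i, j⟩ hij ⟨i', j'⟩ hij' hE
      simp only [Finset.coe_filter, Set.mem_ofPred_eq, Finset.mem_product] at hij hij'
      obtain ⟨⟨hi, hj⟩, hκ'⟩ := hij
      obtain ⟨⟨hi', hj'⟩, hκ''⟩ := hij'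
      rw [hmem] at hi hi'
      have hQ0 : 0 < Qf i := by have := hi.1.1; omega
      have hQ0' : 0 < Qf i' := by have := hi'.1.1; omega
      obtain ⟨d', hd', hQ'⟩ := hquot i j hκ'
      obtain ⟨d'', hd'', hQ''⟩ := hquot i' j' hκ''
      simp only [hd', hd''] at hE
      rw [Sigma.mk.injEq] at hE
      obtain ⟨hE1, hE2⟩ := hE
      have hE2' := Prod.mk.inj (eq_of_heq hE2)
      have hQQ : Qf i = Qf i' := by omega
      have hii : i = i' := by
        have h1 := hrel' i
        have h2 := hrel' i'
        rw [hQQ, hE2'.1, h2] at h1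
        have hl0 : (l : ℤ) ≠ 0 := by exact_mod_cast hl.ne'
        apply mul_left_cancel₀ hl0
        linarith
      subst hii
      have hjj : j = j' := by
        rw [hE2'.2, hQ''] at hQ'
        apply mul_right_cancel₀ hQ0.ne'
        linarith
      rw [hjj]
  have hyx : y - x ≤ 1 := by linarith
  have hU0 : 0 ≤ U := by rw [hU]; exact Nat.cast_nonneg _
  have h1 := (abs_le.1 heq).1
  have h2 : (y - x) * U - 3 * ((D + 1) / m) ≤ ((Finset.Ico r₁ r₂).card : ℝ) / m * U := by
    have h3 : (y - x) - 3 / m ≤ ((Finset.Ico r₁ r₂).card : ℝ) / m := by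
      rw [le_div_iff₀ hm0', sub_mul, div_mul_cancel₀ _ hm0'.ne']; exact hR
    have h4 := mul_le_mul_of_nonneg_right h3 hU0
    have h5 : 3 / m * U ≤ 3 * ((D + 1) / m) := by
      rw [div_mul_eq_mul_div, mul_div_assoc]
      exact mul_le_mul_of_nonneg_left (div_le_div_of_nonneg_right (hUN.trans hcard) hm0'.le)
        (by norm_num)
    nlinarith
  have h6 : A * (((Finset.Ico m₁ m₂).card : ℝ) / m + 1) ≤ A * ((D + 1) / m + 1) :=
    mul_le_mul_of_nonneg_left (by gcongr) hA0
  have h7 := mul_le_mul_of_nonneg_left hprim (sub_nonneg.2 hxy)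
  refine le_trans ?_ hcomp
  linarith

end Discrepancy

section Discrepancy

lemma divisor_log_factor_le {l : ℕ} {δ : ℝ} (hδ : 0 < δ) :
    ∃ C : ℝ, 1 ≤ C ∧ ∀ m : ℕ, 0 < m → 2 * l * (m.divisors.card : ℝ) ^ 2 * (1 + Real.log m) ^ 2 *
      (m : ℝ) ^ (3 / 4 : ℝ) + 3 ≤ C * (m : ℝ) ^ δ * (m : ℝ) ^ (3 / 4 : ℝ) := by
  obtain ⟨C, hC, h⟩ := card_divisors_le_rpow (δ / 4) (by positivity)
  refine ⟨2 * l * C ^ 2 * (1 + 4 / δ) ^ 2 + 3, ?_, ?_⟩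
  · have : 0 ≤ 2 * l * C ^ 2 * (1 + 4 / δ) ^ 2 := by positivity
    linarith
  intro m hm
  have hm1 : (1 : ℝ) ≤ m := by exact_mod_cast hm
  have hm0 : (0 : ℝ) < m := by linarith
  have hτ := h m hm
  set τ : ℝ := (m.divisors.card : ℝ)
  have hτ0 : 0 ≤ τ := Nat.cast_nonneg _
  set X : ℝ := (m : ℝ) ^ (δ / 4) with hX
  have hX1 : 1 ≤ X := Real.one_le_rpow hm1 (by positivity)
  have hlog : 1 + Real.log m ≤ (1 + 4 / δ) * X := by
    have h1 := Real.log_le_rpow_div hm0.le (show 0 < δ / 4 by positivity)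
    have h2 : (m : ℝ) ^ (δ / 4) / (δ / 4) = 4 / δ * X := by rw [hX]; field_simp
    rw [h2] at h1; linarith
  have hlog0 : 0 ≤ 1 + Real.log m := by linarith [Real.log_nonneg hm1]
  have hX4 : (m : ℝ) ^ δ = X ^ 2 * X ^ 2 := by
    rw [hX, ← pow_add, ← Real.rpow_natCast, ← Real.rpow_mul hm0.le]; congr 1; push_cast; ring
  set Z : ℝ := (m : ℝ) ^ (3 / 4 : ℝ)
  have hZ1 : 1 ≤ Z := Real.one_le_rpow hm1 (by norm_num)
  rw [hX4]
  have a1 : τ ^ 2 ≤ (C * X) ^ 2 := pow_le_pow_left₀ hτ0 hτ 2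
  have a2 : (1 + Real.log m) ^ 2 ≤ ((1 + 4 / δ) * X) ^ 2 := pow_le_pow_left₀ hlog0 hlog 2
  have a3 : τ ^ 2 * (1 + Real.log m) ^ 2 ≤ (C * X) ^ 2 * ((1 + 4 / δ) * X) ^ 2 :=
    mul_le_mul a1 a2 (sq_nonneg _) (sq_nonneg _)
  have a4 : 1 ≤ X ^ 2 * X ^ 2 * Z := by
    have := one_le_pow₀ (n := 2) hX1
    nlinarith [mul_le_mul this this zero_le_one (by positivity)]
  have a5 := mul_le_mul_of_nonneg_left a3 (show (0 : ℝ) ≤ 2 * l * Z by positivity)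
  nlinarith

lemma sum_erase_zero_natAbs_le (M : ℕ) (F : ℕ → ℝ) :
    ∑ b ∈ (Finset.Icc (-(M : ℤ)) M).erase 0, F b.natAbs = 2 * ∑ m ∈ Finset.Icc 1 M, F m := by
  classical
  have h : (Finset.Icc (-(M : ℤ)) M).erase 0 =
      (Finset.Icc 1 M).image (fun m : ℕ => (m : ℤ)) ∪
        (Finset.Icc 1 M).image (fun m : ℕ => -(m : ℤ)) := by
    ext b
    simp only [Finset.mem_erase, Finset.mem_Icc, Finset.mem_union, Finset.mem_image]
    constructor
    · rintro ⟨h0, h1, h2⟩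
      rcases lt_or_gt_of_ne h0 with h | h
      · exact Or.inr ⟨b.natAbs, by omega, by omega⟩
      · exact Or.inl ⟨b.natAbs, by omega, by omega⟩
    · rintro (⟨m, hm, rfl⟩ | ⟨m, hm, rfl⟩) <;> omega
  rw [h, Finset.sum_union, Finset.sum_image, Finset.sum_image]
  · simp; ring
  · intro a _ b _ h; simpa using h
  · intro a _ b _ h; simpa using h
  · rw [Finset.disjoint_left]
    intro b hb hb'
    simp only [Finset.mem_image, Finset.mem_Icc] at hb hb'
    obtain ⟨m, hm, rfl⟩ := hb
    obtain ⟨m', hm', h⟩ := hb'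
    omega

lemma fibre_error_sum_le {l : ℕ} {δ : ℝ} (hδ : 0 < δ) :
    ∃ C : ℝ, 0 < C ∧ ∀ (n M : ℕ) (Y : ℝ), 1 ≤ n → 0 < Y → Y ≤ 1 → (M : ℝ) ≤ 3 * n * √Y →
      ∑ m ∈ Finset.Icc 1 M, (2 * l * (m.divisors.card : ℝ) ^ 2 * (1 + Real.log m) ^ 2 *
        (m : ℝ) ^ (3 / 4 : ℝ) + 3) *
        (((n : ℝ) ^ (7 / 4 : ℝ) * Y ^ (3 / 4 : ℝ) * (m : ℝ) ^ (-(3 / 4) : ℝ) + 1) / m + 1) ≤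
      C * ((n : ℝ) ^ (7 / 4 + δ) * Y ^ (3 / 4 : ℝ)) := by
  obtain ⟨C, hC, h⟩ := divisor_log_factor_le (l := l) (δ := δ / 2) (by positivity)
  refine ⟨C * 3 ^ (δ / 2) * (1 + 2 / δ * 3 ^ (δ / 2) + 18), by positivity, ?_⟩
  intro n M Y hn hY0 hY1 hM
  have hn1 : (1 : ℝ) ≤ n := by exact_mod_cast hn
  have hn0 : (0 : ℝ) < n := by linarith
  have hsq1 : √Y ≤ 1 := (Real.sqrt_le_sqrt hY1).trans_eq Real.sqrt_one
  have hM3 : (M : ℝ) ≤ 3 * n := hM.trans (by nlinarith)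
  set E : ℝ := (n : ℝ) ^ (7 / 4 : ℝ) * Y ^ (3 / 4 : ℝ) with hE
  have hE0 : 0 < E := by positivity
  have hterm : ∀ m ∈ Finset.Icc 1 M, (2 * l * (m.divisors.card : ℝ) ^ 2 * (1 + Real.log m) ^ 2 *
        (m : ℝ) ^ (3 / 4 : ℝ) + 3) * ((E * (m : ℝ) ^ (-(3 / 4) : ℝ) + 1) / m + 1) ≤
        C * (3 * n) ^ (δ / 2) * (E * (1 / m) + 2 * M ^ (3 / 4 : ℝ)) := by
    intro m hm
    rw [Finset.mem_Icc] at hm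
    have hm1 : (1 : ℝ) ≤ m := by exact_mod_cast hm.1
    have hm0 : (0 : ℝ) < m := by linarith
    have hmM : (m : ℝ) ≤ M := by exact_mod_cast hm.2
    have h1 := h m hm.1
    have h2 : (m : ℝ) ^ (δ / 2) ≤ (3 * n) ^ (δ / 2) :=
      Real.rpow_le_rpow hm0.le (hmM.trans hM3) (by positivity)
    have h3 : (m : ℝ) ^ (3 / 4 : ℝ) ≤ M ^ (3 / 4 : ℝ) := Real.rpow_le_rpow hm0.le hmM (by norm_num)
    have h0 : 0 ≤ (E * (m : ℝ) ^ (-(3 / 4) : ℝ) + 1) / m + 1 := by positivity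
    refine (mul_le_mul_of_nonneg_right h1 h0).trans ?_
    have h4 : (m : ℝ) ^ (3 / 4 : ℝ) * ((E * (m : ℝ) ^ (-(3 / 4) : ℝ) + 1) / m + 1) ≤
        E * (1 / m) + 2 * M ^ (3 / 4 : ℝ) := by
      have e : (m : ℝ) ^ (3 / 4 : ℝ) * (m : ℝ) ^ (-(3 / 4) : ℝ) = 1 := by
        rw [← Real.rpow_add hm0]; norm_num
      have e2 : (m : ℝ) ^ (3 / 4 : ℝ) * ((E * (m : ℝ) ^ (-(3 / 4) : ℝ) + 1) / m + 1) =
          E * (1 / m) * ((m : ℝ) ^ (3 / 4 : ℝ) * (m : ℝ) ^ (-(3 / 4) : ℝ)) +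
            (m : ℝ) ^ (3 / 4 : ℝ) * (1 / m) + (m : ℝ) ^ (3 / 4 : ℝ) := by field_simp
      rw [e2, e]
      have : (m : ℝ) ^ (3 / 4 : ℝ) * (1 / m) ≤ (m : ℝ) ^ (3 / 4 : ℝ) :=
        mul_le_of_le_one_right (by positivity) (by rw [div_le_one hm0]; exact hm1)
      linarith
    calc _ = C * (m : ℝ) ^ (δ / 2) * ((m : ℝ) ^ (3 / 4 : ℝ) *
          ((E * (m : ℝ) ^ (-(3 / 4) : ℝ) + 1) / m + 1)) := by ring
      _ ≤ _ := by
        refine mul_le_mul (mul_le_mul_of_nonneg_left h2 (by linarith)) h4 (by positivity)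
          (by positivity)
  refine (Finset.sum_le_sum hterm).trans ?_
  rw [← Finset.mul_sum, Finset.sum_add_distrib, ← Finset.mul_sum, Finset.sum_const, Nat.card_Icc,
    nsmul_eq_mul]
  have hX : (n : ℝ) ^ (7 / 4 + δ) * Y ^ (3 / 4 : ℝ) = E * ((n : ℝ) ^ (δ / 2) * (n : ℝ) ^ (δ / 2)) := by
    rw [hE, ← Real.rpow_add hn0, add_halves, Real.rpow_add hn0]; ring
  have hN1 : 1 ≤ (n : ℝ) ^ (δ / 2) := Real.one_le_rpow hn1 (by positivity)
  have h3n : (3 * (n : ℝ)) ^ (δ / 2) = 3 ^ (δ / 2) * (n : ℝ) ^ (δ / 2) :=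
    Real.mul_rpow (by norm_num) hn0.le
  rw [hX, h3n]
  have hsum : ∑ m ∈ Finset.Icc 1 M, (1 / (m : ℝ)) ≤
      (1 + 2 / δ * 3 ^ (δ / 2)) * (n : ℝ) ^ (δ / 2) := by
    rcases Nat.eq_zero_or_pos M with h0 | h0
    · subst h0; simp; positivity
    · have hM0 : (0 : ℝ) < M := by exact_mod_cast h0
      have h1 : ∑ m ∈ Finset.Icc 1 M, (1 / (m : ℝ)) ≤ 1 + Real.log M := by
        have := harmonic_le_one_add_log M
        rw [harmonic_eq_sum_Icc] at this
        push_cast at this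
        simpa using this
      have h2 := Real.log_le_log hM0 hM3
      have h3 := Real.log_le_rpow_div (show (0 : ℝ) ≤ 3 * n by positivity)
        (show 0 < δ / 2 by positivity)
      rw [h3n] at h3
      have h4 : 3 ^ (δ / 2) * (n : ℝ) ^ (δ / 2) / (δ / 2) =
        2 / δ * 3 ^ (δ / 2) * (n : ℝ) ^ (δ / 2) := by field_simp
      rw [h4] at h3
      nlinarith
  have hM74 : (M : ℝ) * (2 * (M : ℝ) ^ (3 / 4 : ℝ)) ≤ 18 * E := by
    have h1 : (M : ℝ) * (M : ℝ) ^ (3 / 4 : ℝ) = (M : ℝ) ^ (7 / 4 : ℝ) := by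
      nth_rewrite 1 [← Real.rpow_one (M : ℝ)]
      rw [← Real.rpow_add' (Nat.cast_nonneg _) (by norm_num)]; norm_num
    have h2 : (M : ℝ) ^ (7 / 4 : ℝ) ≤ (3 * n * √Y) ^ (7 / 4 : ℝ) :=
      Real.rpow_le_rpow (Nat.cast_nonneg _) hM (by norm_num)
    have h3 : (3 * n * √Y) ^ (7 / 4 : ℝ) =
        3 ^ (7 / 4 : ℝ) * (n : ℝ) ^ (7 / 4 : ℝ) * Y ^ (7 / 8 : ℝ) := by
      rw [Real.mul_rpow (by positivity) (Real.sqrt_nonneg _), Real.mul_rpow (by norm_num) hn0.le,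
        Real.sqrt_eq_rpow, ← Real.rpow_mul hY0.le]; norm_num
    have h4 : (3 : ℝ) ^ (7 / 4 : ℝ) ≤ 9 := by
      have : (3 : ℝ) ^ (7 / 4 : ℝ) ≤ 3 ^ (2 : ℝ) :=
        Real.rpow_le_rpow_of_exponent_le (by norm_num) (by norm_num)
      refine this.trans (by norm_num)
    have h5 : Y ^ (7 / 8 : ℝ) ≤ Y ^ (3 / 4 : ℝ) :=
      Real.rpow_le_rpow_of_exponent_ge hY0 hY1 (by norm_num)
    have h6 : (3 : ℝ) ^ (7 / 4 : ℝ) * (n : ℝ) ^ (7 / 4 : ℝ) * Y ^ (7 / 8 : ℝ) ≤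
        9 * (n : ℝ) ^ (7 / 4 : ℝ) * Y ^ (3 / 4 : ℝ) := by gcongr
    rw [hE]; linarith
  have hcast : ((M + 1 - 1 : ℕ) : ℝ) = M := by simp
  rw [hcast]
  calc C * (3 ^ (δ / 2) * (n : ℝ) ^ (δ / 2)) * (E * ∑ m ∈ Finset.Icc 1 M, (1 / (m : ℝ)) +
        M * (2 * (M : ℝ) ^ (3 / 4 : ℝ)))
      ≤ C * (3 ^ (δ / 2) * (n : ℝ) ^ (δ / 2)) *
        (E * ((1 + 2 / δ * 3 ^ (δ / 2)) * (n : ℝ) ^ (δ / 2)) + 18 * E * (n : ℝ) ^ (δ / 2)) := by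
        refine mul_le_mul_of_nonneg_left (add_le_add ?_ ?_) (by positivity)
        · exact mul_le_mul_of_nonneg_left hsum hE0.le
        · refine hM74.trans (le_mul_of_one_le_right (by positivity) hN1)
    _ = _ := by ring

end Discrepancy

section Discrepancy

lemma card_Ioc_floor_le (α β Y : ℝ) (hY : β - α ≤ Y) (hY0 : 0 ≤ Y) (Q : ℕ) :
    ((Finset.Ioc ⌊α * Q⌋ ⌊β * Q⌋).card : ℝ) ≤ Y * Q + 1 := by
  rw [Int.card_Ioc]
  have hQ : (0 : ℝ) ≤ Q := Nat.cast_nonneg _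
  rcases le_total (⌊β * Q⌋ - ⌊α * Q⌋) 0 with h | h
  · rw [Int.toNat_of_nonpos h]; push_cast; positivity
  · have h1 : (((⌊β * Q⌋ - ⌊α * Q⌋).toNat : ℕ) : ℝ) = ((⌊β * Q⌋ - ⌊α * Q⌋ : ℤ) : ℝ) := by
      exact_mod_cast Int.toNat_of_nonneg h
    rw [h1]; push_cast
    have := Int.floor_le (β * (Q : ℝ))
    have := Int.lt_floor_add_one (α * (Q : ℝ))
    nlinarith

lemma card_primSet_small_le (l : ℕ) (P : ZMod l → ZMod l → Prop) {α β Y : ℝ} (hY : β - α ≤ Y)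
    (hY0 : 0 ≤ Y) (n : ℕ) (s : ℤ) (S : ℕ) (hsS : s ≤ S) :
    (((primSet l P α β n).filter fun v => ¬ s < v.1).card : ℝ) ≤ S * (Y * S + 1) := by
  classical
  have hsub : (primSet l P α β n).filter (fun v => ¬ s < v.1) ⊆
      (Finset.Icc 1 S).sigma fun Q => Finset.Ioc ⌊α * Q⌋ ⌊β * Q⌋ := by
    rintro ⟨Q, p⟩ hv
    rw [Finset.mem_filter, mem_primSet] at hv
    obtain ⟨⟨h1, h2, h3⟩, h4⟩ := hv
    simp only [Finset.mem_sigma, Finset.mem_Icc, Finset.mem_Ioc, Int.floor_lt, Int.le_floor]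
    simp only at h1 h2 h4
    refine ⟨⟨h1.1, ?_⟩, h2⟩
    omega
  have h1 := Finset.card_le_card hsub
  rw [Finset.card_sigma] at h1
  have h2 : (((primSet l P α β n).filter fun v => ¬ s < v.1).card : ℝ) ≤
      ∑ Q ∈ Finset.Icc 1 S, ((Finset.Ioc ⌊α * Q⌋ ⌊β * Q⌋).card : ℝ) := by exact_mod_cast h1
  refine h2.trans ((Finset.sum_le_card_nsmul _ _ (Y * S + 1) ?_).trans ?_)
  · intro Q hQ
    rw [Finset.mem_Icc] at hQ
    have : (Q : ℝ) ≤ S := by exact_mod_cast hQ.2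
    refine (card_Ioc_floor_le α β Y hY hY0 Q).trans ?_
    gcongr
  · rw [Nat.card_Icc, nsmul_eq_mul]; simp

set_option maxHeartbeats 1600000 in
lemma card_compSet_ge {l : ℕ} (hl : 0 < l) {δ : ℝ} (hδ : 0 < δ) :
    ∃ C : ℝ, 0 < C ∧ ∀ (P : ZMod l → ZMod l → Prop) (α β Y : ℝ) (n : ℕ) (σ : ℤ) (x y : ℝ),
      β - α ≤ Y → 0 < Y → Y ≤ 1 → 1 ≤ n → (σ = 1 ∨ σ = -1) → 0 ≤ x → x ≤ y → y ≤ 1 →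
      (y - x) * ((primSet l P α β n).card : ℝ) -
        C * ((n : ℝ) ^ (7 / 4 + δ) * Y ^ (3 / 4 : ℝ) + 1 / √Y) ≤
        ((compSet l P α β σ x y n).card : ℝ) := by
  classical
  obtain ⟨C, hC, hsum⟩ := fibre_error_sum_le (l := l) hδ
  refine ⟨2 * l * C + 6, by positivity, ?_⟩
  intro P α β Y n σ x y hY hY0 hY1 hn hσ hx hxy hy
  have hsq0 : 0 < √Y := Real.sqrt_pos.2 hY0
  have hsq1 : √Y ≤ 1 := (Real.sqrt_le_sqrt hY1).trans_eq Real.sqrt_one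
  have hsqY : √Y * √Y = Y := Real.mul_self_sqrt hY0.le
  set S : ℕ := ⌈1 / √Y⌉₊ with hS
  have hS0 : 0 < S := Nat.ceil_pos.2 (by positivity)
  have hS1 : 1 / √Y ≤ S := Nat.le_ceil _
  have hS2 : (S : ℝ) ≤ 1 / √Y + 1 := (Nat.ceil_lt_add_one (by positivity)).le
  have hone : 1 ≤ 1 / √Y := by rw [le_div_iff₀ hsq0]; linarith
  obtain ⟨q, hq1, hq2⟩ := Real.exists_rat_abs_sub_le_and_den_le β hS0
  set r : ℤ := q.num with hr
  set s : ℤ := (q.den : ℤ) with hs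
  have hs1 : 1 ≤ s := by have := q.pos; omega
  have hsS : s ≤ S := by rw [hs]; exact Int.ofNat_le.2 hq2
  have hsR : (s : ℝ) = (q.den : ℝ) := by rw [hs]; push_cast; rfl
  have hs0R : (0 : ℝ) < s := by exact_mod_cast hs1
  have hcop : IsCoprime s r := by
    have := q.isCoprime_num_den
    exact this.symm
  obtain ⟨t, u', hdet'⟩ := hcop
  obtain ⟨u, rfl⟩ : ∃ u, u' = -u := ⟨-u', by ring⟩
  have hdet : s * t - r * u = 1 := by linear_combination hdet'
  have hβ : |s * β - r| ≤ √Y := by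
    have hqr : (q : ℝ) = r / s := by
      rw [hsR, hr]; exact_mod_cast (Rat.num_div_den q).symm
    have e : (s : ℝ) * β - r = s * (β - q) := by rw [hqr]; field_simp
    rw [e, abs_mul, abs_of_pos hs0R]
    calc (s : ℝ) * |β - q| ≤ s * (1 / ((S + 1) * s)) := by
          rw [hsR]; exact mul_le_mul_of_nonneg_left hq1 (by positivity)
      _ = 1 / (S + 1) := by field_simp
      _ ≤ √Y := by
          rw [div_le_iff₀ (by positivity)]
          have : 1 ≤ √Y * S := by
            rw [div_le_iff₀ hsq0] at hS1; linarith
          nlinarith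
  set M : ℕ := ⌊3 * n * √Y⌋₊ with hM
  have hMle : (M : ℝ) ≤ 3 * n * √Y := Nat.floor_le (by positivity)
  set T : Finset (ℤ × ℤ) := ((Finset.Icc (-(M : ℤ)) M).erase 0) ×ˢ (Finset.Ico (0 : ℤ) l) with hT
  set f : (Σ _ : ℕ, ℤ) → ℤ × ℤ := fun v => (s * v.2 - r * v.1, (t * v.1 - u * v.2) % l) with hf
  set g : (Σ _ : ℕ, ℤ × ℤ) → ℤ × ℤ :=
    fun v => (s * v.2.1 - r * v.1, (t * v.1 - u * v.2.1) % l) with hg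
  set A := (primSet l P α β n).filter fun v => s < v.1 with hA
  set B := (compSet l P α β σ x y n).filter fun v => s < v.1 with hB
  have hl0 : (0 : ℤ) < l := by exact_mod_cast hl
  have hAT : ∀ v ∈ A, f v ∈ T := by
    rintro ⟨Q, p⟩ hv
    rw [hA, Finset.mem_filter, mem_primSet] at hv
    obtain ⟨⟨⟨h1, h2⟩, ⟨h3, h4⟩, -, h5⟩, h6⟩ := hv
    simp only at h1 h2 h3 h4 h5 h6
    simp only [hT, hf, Finset.mem_product, Finset.mem_erase, Finset.mem_Icc, Finset.mem_Ico]
    refine ⟨⟨?_, ?_⟩, Int.emod_nonneg _ hl0.ne', Int.emod_lt_of_pos _ hl0⟩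
    · intro h0
      have : (Q : ℤ) ∣ s * p := ⟨r, by linarith⟩
      have := Int.le_of_dvd (by omega) (h5.dvd_of_dvd_mul_right this)
      omega
    · have hQ0 : (0 : ℝ) < Q := by exact_mod_cast h1
      have hQn : (Q : ℝ) ≤ n := by exact_mod_cast h2
      have hbR : |((s * p - r * Q : ℤ) : ℝ)| ≤ 3 * n * √Y := by
        have e : ((s * p - r * Q : ℤ) : ℝ) = s * (p - β * Q) + Q * (s * β - r) := by
          push_cast; ring
        rw [e]
        have a1 : |(p : ℝ) - β * Q| ≤ Y * Q := by
          rw [abs_le]; constructor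
          · nlinarith [mul_le_mul_of_nonneg_right hY hQ0.le]
          · nlinarith
        have a2 : (s : ℝ) ≤ 1 / √Y + 1 := by
          refine le_trans ?_ hS2; exact_mod_cast hsS
        have a3 : (s : ℝ) * Y ≤ 2 * √Y := by
          calc (s : ℝ) * Y ≤ (1 / √Y + 1) * Y := mul_le_mul_of_nonneg_right a2 hY0.le
            _ = √Y + Y := by
              rw [add_mul]; nth_rewrite 2 [← hsqY]; field_simp
            _ ≤ _ := by nlinarith
        calc _ ≤ |(s : ℝ) * (p - β * Q)| + |Q * (s * β - r)| := abs_add_le _ _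
          _ = s * |(p : ℝ) - β * Q| + Q * |s * β - r| := by
            rw [abs_mul, abs_mul, abs_of_pos hs0R, abs_of_pos hQ0]
          _ ≤ s * (Y * Q) + Q * √Y := by gcongr
          _ = (s * Y) * Q + Q * √Y := by ring
          _ ≤ 2 * √Y * Q + Q * √Y := by gcongr
          _ = 3 * Q * √Y := by ring
          _ ≤ _ := by gcongr
      have h7 : ((s * p - r * Q : ℤ)).natAbs ≤ M := by
        rw [hM]; apply Nat.le_floor
        rw [Nat.cast_natAbs]; push_cast at hbR ⊢; exact hbR
      omega
  have hAcard := Finset.card_eq_sum_card_fiberwise (f := f) (s := A) (t := T) hAT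
  have hBcard : ∑ w ∈ T, (B.filter fun v => g v = w).card ≤ B.card := by
    rw [Finset.sum_card_fiberwise_eq_card_filter]
    exact Finset.card_filter_le _ _
  set Err : ℕ → ℝ := fun m => (2 * l * (m.divisors.card : ℝ) ^ 2 * (1 + Real.log m) ^ 2 *
        (m : ℝ) ^ (3 / 4 : ℝ) + 3) *
        (((n : ℝ) ^ (7 / 4 : ℝ) * Y ^ (3 / 4 : ℝ) * (m : ℝ) ^ (-(3 / 4) : ℝ) + 1) / m + 1) with hErr
  have hfib : ∀ w ∈ T, (y - x) * ((A.filter fun v => f v = w).card : ℝ) - Err w.1.natAbs ≤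
      ((B.filter fun v => g v = w).card : ℝ) := by
    rintro ⟨b, d₀⟩ hw
    simp only [hT, Finset.mem_product, Finset.mem_erase, Finset.mem_Ico] at hw
    have := card_compSet_fibre_ge hl P hY hY0.le n (σ := σ) hs1 hw.2 hdet hw.1.1 hσ hx hxy hy
    rw [hA, hB, Finset.filter_filter, Finset.filter_filter]
    simp only [hf, hg, Prod.mk.injEq]
    exact this
  have hErrsum : ∑ w ∈ T, Err w.1.natAbs ≤
      2 * l * (C * ((n : ℝ) ^ (7 / 4 + δ) * Y ^ (3 / 4 : ℝ))) := by
    rw [hT, Finset.sum_product]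
    simp only [Finset.sum_const, Int.card_Ico, sub_zero, Int.toNat_natCast, nsmul_eq_mul]
    rw [← Finset.mul_sum, sum_erase_zero_natAbs_le]
    have := hsum n M Y hn hY0 hY1 hMle
    have := mul_le_mul_of_nonneg_left this (show (0 : ℝ) ≤ 2 * l by positivity)
    refine le_trans (le_of_eq ?_) this
    ring
  have hmain := Finset.sum_le_sum hfib
  rw [Finset.sum_sub_distrib, ← Finset.mul_sum] at hmain
  have hA' : ∑ w ∈ T, ((A.filter fun v => f v = w).card : ℝ) = A.card := by
    rw [hAcard]; push_cast; rfl
  have hB' : ∑ w ∈ T, ((B.filter fun v => g v = w).card : ℝ) ≤ B.card := by exact_mod_cast hBcard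
  have hBle : (B.card : ℝ) ≤ (compSet l P α β σ x y n).card := by
    exact_mod_cast Finset.card_filter_le _ _
  have hsmall := card_primSet_small_le l P hY hY0.le n s S hsS
  have hsplit : ((primSet l P α β n).card : ℝ) = A.card +
      (((primSet l P α β n).filter fun v => ¬ s < v.1).card : ℝ) := by
    rw [hA]; exact_mod_cast (Finset.card_filter_add_card_filter_not _).symm
  have hsm2 : (S : ℝ) * (Y * S + 1) ≤ 6 * (1 / √Y) := by
    have a1 : (S : ℝ) ≤ 2 * (1 / √Y) := by linarith
    have a2 : Y * S ≤ 2 := by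
      calc Y * S ≤ Y * (2 * (1 / √Y)) := mul_le_mul_of_nonneg_left a1 hY0.le
        _ = 2 * √Y := by nth_rewrite 1 [← hsqY]; field_simp
        _ ≤ 2 := by linarith
    calc (S : ℝ) * (Y * S + 1) ≤ (2 * (1 / √Y)) * (2 + 1) := by gcongr
      _ = _ := by ring
  have hyx : (y - x) * (((primSet l P α β n).filter fun v => ¬ s < v.1).card : ℝ) ≤
      6 * (1 / √Y) := by
    refine le_trans ?_ (hsmall.trans hsm2)
    exact mul_le_of_le_one_left (Nat.cast_nonneg _) (by linarith)
  rw [hA'] at hmain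
  rw [hsplit, mul_add]
  have hE1 : 0 ≤ (n : ℝ) ^ (7 / 4 + δ) * Y ^ (3 / 4 : ℝ) := by positivity
  have hE2 : 0 ≤ 2 * l * C * (1 / √Y) := by positivity
  nlinarith

end Discrepancy

section Densities

open ArithmeticFunction in
/-- The function `e ↦ μ(e)/e` restricted to `e` coprime to `l`. -/
noncomputable def moebiusDiv (l : ℕ) : ArithmeticFunction ℝ :=
  ⟨fun e => if e.Coprime l then (moebius e : ℝ) / e else 0, by simp⟩

lemma moebiusDiv_apply (l e : ℕ) :
    moebiusDiv l e = if e.Coprime l then (ArithmeticFunction.moebius e : ℝ) / e else 0 := rfl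

lemma moebiusDiv_isMultiplicative (l : ℕ) : (moebiusDiv l).IsMultiplicative := by
  refine ⟨by simp [moebiusDiv_apply], ?_⟩
  intro m n hmn
  simp only [moebiusDiv_apply, Nat.coprime_mul_iff_left,
    ArithmeticFunction.isMultiplicative_moebius.map_mul_of_coprime hmn]
  by_cases h1 : m.Coprime l
  · by_cases h2 : n.Coprime l
    · rw [if_pos ⟨h1, h2⟩, if_pos h1, if_pos h2]; push_cast; rw [mul_div_mul_comm]
    · rw [if_neg (fun h => h2 h.2), if_neg h2, mul_zero]
  · rw [if_neg (fun h => h1 h.1), if_neg h1, zero_mul]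

lemma abs_moebiusDiv_le (l e : ℕ) : |moebiusDiv l e| ≤ 1 / e := by
  rw [moebiusDiv_apply]
  split_ifs
  · rw [abs_div, Nat.abs_cast]
    have : |(ArithmeticFunction.moebius e : ℝ)| ≤ 1 := by
      exact_mod_cast (ArithmeticFunction.abs_moebius_le_one (n := e))
    gcongr
  · simp

lemma moebiusDiv_mul_zeta (l : ℕ) :
    moebiusDiv l * (ArithmeticFunction.zeta : ArithmeticFunction ℝ) =
      ArithmeticFunction.prodPrimeFactors (fun p => if p ∣ l then 1 else 1 - (p : ℝ)⁻¹) := by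
  rw [ArithmeticFunction.IsMultiplicative.eq_iff_eq_on_prime_powers _
    ((moebiusDiv_isMultiplicative l).mul ArithmeticFunction.isMultiplicative_zeta.natCast) _
    (ArithmeticFunction.IsMultiplicative.prodPrimeFactors _)]
  intro p k hp
  rw [ArithmeticFunction.coe_mul_zeta_apply, ArithmeticFunction.prodPrimeFactors_apply
    (pow_ne_zero _ hp.ne_zero), Nat.sum_divisors_prime_pow hp]
  rcases Nat.eq_zero_or_pos k with rfl | hk
  · simp [moebiusDiv_apply]
  · rw [Nat.primeFactors_prime_pow hk.ne' hp, Finset.prod_singleton, Finset.sum_range_succ',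
      ← Nat.succ_pred_eq_of_pos hk, Nat.succ_eq_add_one, Finset.sum_range_succ']
    rw [Finset.sum_eq_zero]
    · simp only [zero_add, pow_one, pow_zero, moebiusDiv_apply,
        ArithmeticFunction.moebius_apply_prime hp, ArithmeticFunction.moebius_apply_one,
        hp.coprime_iff_not_dvd]
      by_cases h : p ∣ l
      · simp [h]
      · simp [h]; ring
    · intro i _
      have : ArithmeticFunction.moebius (p ^ (i + 1 + 1)) = 0 := by
        rw [ArithmeticFunction.moebius_apply_prime_pow hp (by omega)]; simp
      simp [moebiusDiv_apply, this]

lemma totient_div_eq (n : ℕ) (hn : n ≠ 0) :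
    (n.totient : ℝ) / n = ∏ p ∈ n.primeFactors, (1 - (p : ℝ)⁻¹) := by
  have h := Nat.totient_eq_mul_prod_factors n
  have h' : (n.totient : ℝ) = n * ∏ p ∈ n.primeFactors, (1 - (p : ℝ)⁻¹) := by
    have := congrArg (Rat.cast : ℚ → ℝ) h
    push_cast at this
    exact this
  rw [h']; field_simp

lemma totient_mul_div_eq {l q : ℕ} (hl : l ≠ 0) (hq : q ≠ 0) :
    ((l * q).totient : ℝ) / (l * q : ℕ) = l.totient / l *
      (moebiusDiv l * (ArithmeticFunction.zeta : ArithmeticFunction ℝ)) q := by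
  rw [totient_div_eq _ (mul_ne_zero hl hq), totient_div_eq _ hl, moebiusDiv_mul_zeta,
    ArithmeticFunction.prodPrimeFactors_apply hq, Nat.primeFactors_mul hl hq,
    ← Finset.union_sdiff_self_eq_union, Finset.prod_union Finset.disjoint_sdiff]
  congr 1
  rw [Finset.sdiff_eq_filter, Finset.prod_filter]
  refine Finset.prod_congr rfl fun p hp => ?_
  have hp' := Nat.prime_of_mem_primeFactors hp
  by_cases h : p ∣ l <;> simp [h, hp', hl]

lemma sum_moebius_div_eq {N : ℕ} (hN : N ≠ 0) :
    ∑ d ∈ N.divisors, (ArithmeticFunction.moebius d : ℝ) / d = N.totient / N := by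
  have h := totient_mul_div_eq one_ne_zero hN
  rw [ArithmeticFunction.coe_mul_zeta_apply] at h
  simpa [moebiusDiv_apply] using h.symm

lemma sum_moebius_filter_dvd {N : ℕ} (hN : N ≠ 0) (p : ℤ) :
    (∑ d ∈ N.divisors, if (d : ℤ) ∣ p then (ArithmeticFunction.moebius d : ℤ) else 0) =
      if IsCoprime (N : ℤ) p then 1 else 0 := by
  rw [← Finset.sum_filter]
  have h : N.divisors.filter (fun d : ℕ => (d : ℤ) ∣ p) = (Nat.gcd N p.natAbs).divisors := by
    ext d
    simp only [Finset.mem_filter, Nat.mem_divisors, Nat.dvd_gcd_iff, Int.natCast_dvd]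
    have : N.gcd p.natAbs ≠ 0 := Nat.gcd_ne_zero_left hN
    tauto
  rw [h, ← ArithmeticFunction.coe_mul_zeta_apply, ArithmeticFunction.moebius_mul_coe_zeta,
    ArithmeticFunction.one_apply]
  simp only [Int.isCoprime_iff_gcd_eq_one, Int.gcd, Int.natAbs_natCast]

lemma abs_card_dvd_sub_le {a b : ℝ} (hab : a ≤ b) {d : ℕ} (hd : 0 < d) :
    |(((Finset.Ioc ⌊a⌋ ⌊b⌋).filter fun p => (d : ℤ) ∣ p).card : ℝ) - (b - a) / d| ≤ 1 := by
  have hd' : (0 : ℤ) < d := by exact_mod_cast hd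
  have hdR : (0 : ℝ) < d := by exact_mod_cast hd
  have h := Int.Ioc_filter_dvd_card ⌊a⌋ ⌊b⌋ hd'
  have e : ∀ z : ℝ, ⌊((⌊z⌋ : ℤ) : ℚ) / ((d : ℤ) : ℚ)⌋ = ⌊z / d⌋ := by
    intro z
    rw [Int.cast_natCast, Rat.floor_intCast_div_natCast, Int.floor_div_natCast]
  rw [e, e, max_eq_left (sub_nonneg.2 (Int.floor_le_floor (by gcongr)))] at h
  have h' : (((Finset.Ioc ⌊a⌋ ⌊b⌋).filter fun p => (d : ℤ) ∣ p).card : ℝ) =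
      ⌊b / d⌋ - ⌊a / d⌋ := by exact_mod_cast h
  rw [h', sub_div, abs_le]
  have := Int.floor_le (a / d)
  have := Int.floor_le (b / d)
  have := Int.lt_floor_add_one (a / d)
  have := Int.lt_floor_add_one (b / d)
  constructor <;> linarith

open Classical in
lemma abs_card_coprime_sub_le {a b : ℝ} (hab : a ≤ b) {N : ℕ} (hN : N ≠ 0) :
    |(((Finset.Ioc ⌊a⌋ ⌊b⌋).filter fun p => IsCoprime (N : ℤ) p).card : ℝ) -
      (b - a) * (N.totient / N)| ≤ N.divisors.card := by
  have h1 : (((Finset.Ioc ⌊a⌋ ⌊b⌋).filter fun p => IsCoprime (N : ℤ) p).card : ℝ) =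
      ∑ d ∈ N.divisors, (ArithmeticFunction.moebius d : ℝ) *
        (((Finset.Ioc ⌊a⌋ ⌊b⌋).filter fun p => (d : ℤ) ∣ p).card : ℝ) := by
    have : (((Finset.Ioc ⌊a⌋ ⌊b⌋).filter fun p => IsCoprime (N : ℤ) p).card : ℤ) =
      ∑ d ∈ N.divisors, (ArithmeticFunction.moebius d : ℤ) *
        (((Finset.Ioc ⌊a⌋ ⌊b⌋).filter fun p => (d : ℤ) ∣ p).card : ℤ) := by
      rw [Finset.card_filter]
      push_cast
      simp_rw [← sum_moebius_filter_dvd hN]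
      rw [Finset.sum_comm]
      refine Finset.sum_congr rfl fun d _ => ?_
      rw [← Finset.sum_filter, Finset.sum_const, nsmul_eq_mul, mul_comm]
    exact_mod_cast this
  rw [h1, ← sum_moebius_div_eq hN, Finset.mul_sum, ← Finset.sum_sub_distrib]
  refine (Finset.abs_sum_le_sum_abs _ _).trans ?_
  rw [Finset.card_eq_sum_ones]
  push_cast
  refine Finset.sum_le_sum fun d hd => ?_
  have hd0 : 0 < d := Nat.pos_of_mem_divisors hd
  have e : (ArithmeticFunction.moebius d : ℝ) *
        (((Finset.Ioc ⌊a⌋ ⌊b⌋).filter fun p => (d : ℤ) ∣ p).card : ℝ) -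
      (b - a) * ((ArithmeticFunction.moebius d : ℝ) / d) = (ArithmeticFunction.moebius d : ℝ) *
        ((((Finset.Ioc ⌊a⌋ ⌊b⌋).filter fun p => (d : ℤ) ∣ p).card : ℝ) - (b - a) / d) := by ring
  rw [e, abs_mul]
  have : |(ArithmeticFunction.moebius d : ℝ)| ≤ 1 := by
    exact_mod_cast (ArithmeticFunction.abs_moebius_le_one (n := d))
  exact mul_le_one₀ this (abs_nonneg _) (abs_card_dvd_sub_le hab hd0)

lemma hasProd_moebiusDiv (l : ℕ) :
    HasProd (fun p : {p : ℕ // p.Prime ∧ ¬ p ∣ l} => (1 - 1 / (p.1 : ℝ) ^ 2))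
      (∑' e : ℕ, moebiusDiv l e / e) := by
  set f : ArithmeticFunction ℝ := ⟨fun e => moebiusDiv l e / e, by simp⟩ with hf
  have hfa : ∀ e, f e = moebiusDiv l e / e := fun e => rfl
  have hmul : f.IsMultiplicative := by
    refine ⟨by simp [hfa, moebiusDiv_apply], ?_⟩
    intro m n hmn
    rw [hfa, hfa, hfa, (moebiusDiv_isMultiplicative l).map_mul_of_coprime hmn, Nat.cast_mul,
      mul_div_mul_comm]
  have hsum : Summable (fun e => ‖f e‖) := by
    refine Summable.of_nonneg_of_le (fun _ => norm_nonneg _) (fun e => ?_)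
      (hasSum_zeta_two.summable)
    rw [hfa, norm_div, Real.norm_eq_abs, Real.norm_natCast, sq, ← div_div]
    gcongr
    exact abs_moebiusDiv_le l e
  have h := hmul.eulerProduct_hasProd hsum
  have hfac : ∀ p : Nat.Primes, ∑' e : ℕ, f (p ^ e) =
      if (p : ℕ) ∣ l then 1 else 1 - 1 / ((p : ℕ) : ℝ) ^ 2 := by
    rintro ⟨p, hp⟩
    rw [tsum_eq_sum (s := Finset.range 2)]
    · rw [Finset.sum_range_succ, Finset.sum_range_one, hfa, hfa]
      simp only [pow_zero, pow_one, moebiusDiv_apply, ArithmeticFunction.moebius_apply_prime hp,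
        ArithmeticFunction.moebius_apply_one, hp.coprime_iff_not_dvd]
      by_cases h : p ∣ l
      · simp [h]
      · simp [h, div_div]; ring
    · intro e he
      simp only [Finset.mem_range, not_lt] at he
      have : ArithmeticFunction.moebius (p ^ e) = 0 := by
        rw [ArithmeticFunction.moebius_apply_prime_pow hp (by omega), if_neg (by omega)]
      simp [hfa, moebiusDiv_apply, this]
  simp_rw [hfac] at h
  have hval : ∑' e : ℕ, f e = ∑' e : ℕ, moebiusDiv l e / e := rfl
  rw [← hval]
  set F : ℕ → ℝ := fun p => if p.Prime ∧ ¬ p ∣ l then 1 - 1 / (p : ℝ) ^ 2 else 1 with hF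
  have h1 : HasProd (F ∘ ((↑) : {p : ℕ | p.Prime} → ℕ)) (∑' e : ℕ, f e) := by
    convert! h using 1
    funext p
    have hp : Nat.Prime p.1 := p.2
    by_cases hd : (p : ℕ) ∣ l <;> simp [hF, hp, hd]
  have hs1 : Function.mulSupport F ⊆ {p : ℕ | p.Prime} := by
    intro p hp
    by_contra h2
    exact hp (if_neg fun h3 => h2 h3.1)
  have hs2 : Function.mulSupport F ⊆ {p : ℕ | p.Prime ∧ ¬ p ∣ l} := by
    intro p hp
    by_contra h2
    exact hp (if_neg h2)
  rw [hasProd_subtype_iff_of_mulSupport_subset hs1,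
    ← hasProd_subtype_iff_of_mulSupport_subset hs2] at h1
  convert! h1 using 1
  funext p
  exact (if_pos p.2).symm

lemma Cconst_eq (l : ℕ) :
    Cconst l = ((Nat.totient l : ℝ) / l) * ∑' e : ℕ, moebiusDiv l e / e := by
  rw [Cconst, (hasProd_moebiusDiv l).tprod_eq]

lemma Cconst_one : Cconst 1 = 1 / zeta2 := by
  have hs : Summable fun n : ℕ => ‖(1 : ℝ) / (n : ℝ) ^ 2‖ := hasSum_zeta_two.summable.norm
  let f : ℕ →*₀ ℝ :=
    { toFun := fun n => 1 / (n : ℝ) ^ 2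
      map_zero' := by simp
      map_one' := by simp
      map_mul' := fun a b => by push_cast; field_simp }
  have h1 := EulerProduct.eulerProduct_completely_multiplicative_hasProd (f := f) hs
  have h2 : ∑' n, f n = zeta2 := hasSum_zeta_two.tsum_eq
  rw [h2] at h1
  have h3 := hasProd_moebiusDiv 1
  have e1 : Cconst 1 = ∏' p : {p : ℕ // p.Prime ∧ ¬ p ∣ 1}, (1 - 1 / (p.1 : ℝ) ^ 2) := by
    simp [Cconst]
  have hz : zeta2 ≠ 0 := by rw [zeta2]; positivity
  have h4 := h1.inv₀ hz
  let g : Nat.Primes ≃ {p : ℕ // p.Prime ∧ ¬ p ∣ 1} :=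
    Equiv.subtypeEquivRight fun p =>
      ⟨fun hp => ⟨hp, fun h => hp.one_lt.ne' (Nat.dvd_one.1 h)⟩, fun hp => hp.1⟩
  rw [e1, ← g.tprod_eq, one_div, ← h4.tprod_eq]
  congr 1
  funext p
  rw [inv_inv]
  rfl

lemma summable_moebiusDiv_div (l : ℕ) : Summable (fun e => moebiusDiv l e / e) := by
  refine Summable.of_norm_bounded hasSum_zeta_two.summable fun e => ?_
  rw [norm_div, Real.norm_eq_abs, Real.norm_natCast, sq, ← div_div]
  gcongr
  exact abs_moebiusDiv_le l e

lemma tsum_one_div_sq_tail_le (n : ℕ) (hn : 0 < n) :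
    ∑' e : ℕ, (1 : ℝ) / ((e + (n + 1) : ℕ) : ℝ) ^ 2 ≤ 1 / n := by
  have hs : ∀ N, ∑ e ∈ Finset.range N, (1 : ℝ) / ((e + (n + 1) : ℕ) : ℝ) ^ 2 ≤
      1 / n - 1 / (n + N : ℕ) := by
    intro N
    induction N with
    | zero => simp
    | succ N ih =>
      rw [Finset.sum_range_succ]
      have h0 : (0 : ℝ) < n := by exact_mod_cast hn
      have : (1 : ℝ) / ((N + (n + 1) : ℕ) : ℝ) ^ 2 ≤ 1 / (n + N : ℕ) - 1 / (n + (N + 1) : ℕ) := by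
        push_cast
        rw [div_sub_div _ _ (by positivity) (by positivity), div_le_div_iff₀ (by positivity)
          (by positivity)]
        nlinarith [(Nat.cast_nonneg N : (0 : ℝ) ≤ N)]
      linarith
  refine Real.tsum_le_of_sum_range_le (fun e => by positivity) fun N => (hs N).trans ?_
  have : (0 : ℝ) ≤ 1 / (n + N : ℕ) := by positivity
  linarith

lemma abs_sum_moebiusDiv_div_sub_le (l n : ℕ) (hn : 0 < n) :
    |∑ e ∈ Finset.Ioc 0 n, moebiusDiv l e / e - ∑' e : ℕ, moebiusDiv l e / e| ≤ 1 / n := by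
  have hs := summable_moebiusDiv_div l
  have h1 := hs.sum_add_tsum_nat_add (n + 1)
  have h2 : ∑ e ∈ Finset.range (n + 1), moebiusDiv l e / e =
      ∑ e ∈ Finset.Ioc 0 n, moebiusDiv l e / e := by
    rw [Finset.range_eq_Ico, Finset.sum_eq_sum_Ico_succ_bot (by omega)]
    simp only [Nat.cast_zero, div_zero, zero_add]
    rfl
  rw [← h1, h2, sub_add_cancel_left, abs_neg]
  refine le_trans ?_ (tsum_one_div_sq_tail_le n hn)
  have hs2 : Summable fun e : ℕ => (1 : ℝ) / ((e + (n + 1) : ℕ) : ℝ) ^ 2 :=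
    (summable_nat_add_iff (f := fun e : ℕ => (1 : ℝ) / (e : ℝ) ^ 2) (n + 1)).2
      hasSum_zeta_two.summable
  rw [← Real.norm_eq_abs]
  refine tsum_of_norm_bounded hs2.hasSum fun e => ?_
  rw [norm_div, Real.norm_eq_abs, Real.norm_natCast, sq, ← div_div]
  gcongr
  exact abs_moebiusDiv_le l _

lemma sum_one_div_Ioc_le (n : ℕ) : ∑ e ∈ Finset.Ioc 0 n, (1 : ℝ) / e ≤ 1 + Real.log n := by
  have := harmonic_le_one_add_log n
  rw [harmonic_eq_sum_Icc] at this
  push_cast at this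
  have h : Finset.Ioc 0 n = Finset.Icc 1 n := by ext; simp; omega
  rw [h]
  simpa using this

lemma abs_sum_convolution_sub_le (l : ℕ) (w : ArithmeticFunction ℝ) (ρ K : ℝ) (hρ : |ρ| ≤ 1)
    (hw : ∀ k : ℕ, |∑ f ∈ Finset.Ioc 0 k, w f - ρ * k| ≤ K) (n : ℕ) (hn : 0 < n) :
    |∑ q ∈ Finset.Ioc 0 n, (moebiusDiv l * w) q - ρ * (∑' e : ℕ, moebiusDiv l e / e) * n| ≤
      (K + 2) * (1 + Real.log n) := by
  have hn0 : (0 : ℝ) < n := by exact_mod_cast hn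
  have hK : 0 ≤ K := (abs_nonneg _).trans (hw 0)
  rw [ArithmeticFunction.sum_Ioc_mul_eq_sum_sum]
  set M := ∑' e : ℕ, moebiusDiv l e / e with hM
  have e1 : ∑ e ∈ Finset.Ioc 0 n, moebiusDiv l e * ∑ m ∈ Finset.Ioc 0 (n / e), w m - ρ * M * n =
      ∑ e ∈ Finset.Ioc 0 n, moebiusDiv l e * (∑ m ∈ Finset.Ioc 0 (n / e), w m - ρ * (n / e)) +
      ρ * n * (∑ e ∈ Finset.Ioc 0 n, moebiusDiv l e / e - M) := by
    rw [mul_sub, Finset.mul_sum, ← add_sub_assoc, ← Finset.sum_add_distrib]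
    congr 1
    · refine Finset.sum_congr rfl fun e _ => by ring
    · ring
  rw [e1]
  have h1 : |∑ e ∈ Finset.Ioc 0 n, moebiusDiv l e *
      (∑ m ∈ Finset.Ioc 0 (n / e), w m - ρ * (n / e))| ≤ (K + 1) * (1 + Real.log n) := by
    refine (Finset.abs_sum_le_sum_abs _ _).trans ?_
    have h2 : ∀ e ∈ Finset.Ioc 0 n, |moebiusDiv l e *
        (∑ m ∈ Finset.Ioc 0 (n / e), w m - ρ * (n / e))| ≤ (K + 1) * (1 / e) := by
      intro e he
      rw [Finset.mem_Ioc] at he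
      have he0 : (0 : ℝ) < e := by exact_mod_cast he.1
      have h3 : |((n / e : ℕ) : ℝ) - n / e| ≤ 1 := by
        have a1 : ((n / e : ℕ) : ℝ) ≤ n / e := Nat.cast_div_le
        have a2 : (n : ℝ) / e < ((n / e : ℕ) : ℝ) + 1 := by
          rw [div_lt_iff₀ he0]; rw [mul_comm]; exact_mod_cast Nat.lt_mul_div_succ n he.1
        rw [abs_le]; constructor <;> linarith
      have h4 : |∑ m ∈ Finset.Ioc 0 (n / e), w m - ρ * (n / e)| ≤ K + 1 := by
        have e2 : ∑ m ∈ Finset.Ioc 0 (n / e), w m - ρ * (n / e) =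
          (∑ m ∈ Finset.Ioc 0 (n / e), w m - ρ * ((n / e : ℕ) : ℝ)) +
            ρ * (((n / e : ℕ) : ℝ) - n / e) := by ring
        rw [e2]
        refine (abs_add_le _ _).trans (add_le_add (hw _) ?_)
        rw [abs_mul]; exact mul_le_one₀ hρ (abs_nonneg _) h3
      rw [abs_mul, mul_comm]
      exact mul_le_mul h4 (abs_moebiusDiv_le l e) (abs_nonneg _) (by linarith)
    refine (Finset.sum_le_sum h2).trans ?_
    rw [← Finset.mul_sum]
    exact mul_le_mul_of_nonneg_left (sum_one_div_Ioc_le n) (by linarith)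
  have h2 : |ρ * n * (∑ e ∈ Finset.Ioc 0 n, moebiusDiv l e / e - M)| ≤ 1 := by
    rw [abs_mul, abs_mul, Nat.abs_cast, mul_assoc]
    refine mul_le_one₀ hρ (by positivity) ?_
    calc _ ≤ (n : ℝ) * (1 / n) := by
          gcongr; exact abs_sum_moebiusDiv_div_sub_le l n hn
      _ = 1 := by field_simp
  have hlog : 0 ≤ Real.log n := Real.log_natCast_nonneg n
  refine (abs_add_le _ _).trans ?_
  nlinarith

end Densities

section DensitySums

lemma abs_sum_totient_mul_div_sub_le {l : ℕ} (hl : 0 < l) {n : ℕ} (hn : 0 < n) :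
    |∑ q ∈ Finset.Ioc 0 n, (Nat.totient (l * q) : ℝ) / (l * q : ℕ) - Cconst l * n| ≤
      2 * (1 + Real.log n) := by
  have h := abs_sum_convolution_sub_le l (ArithmeticFunction.zeta : ArithmeticFunction ℝ) 1 0
    (by simp) (fun k => by
      rw [Finset.sum_congr rfl (g := fun _ => (1 : ℝ))]
      · simp
      · intro f hf
        rw [Finset.mem_Ioc] at hf
        have hf0 : ¬ f = 0 := by omega
        simp [ArithmeticFunction.natCoe_apply, ArithmeticFunction.zeta_apply, hf0])
    n hn
  have hr : |(Nat.totient l : ℝ) / l| ≤ 1 := by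
    rw [abs_of_nonneg (by positivity)]
    exact div_le_one_of_le₀ (by exact_mod_cast Nat.totient_le l) (by positivity)
  have e : ∑ q ∈ Finset.Ioc 0 n, (Nat.totient (l * q) : ℝ) / (l * q : ℕ) - Cconst l * n =
      ((Nat.totient l : ℝ) / l) * (∑ q ∈ Finset.Ioc 0 n,
        (moebiusDiv l * (ArithmeticFunction.zeta : ArithmeticFunction ℝ)) q -
          1 * (∑' e : ℕ, moebiusDiv l e / e) * n) := by
    rw [Cconst_eq, mul_sub, Finset.mul_sum, one_mul, mul_assoc]
    congr 1
    refine Finset.sum_congr rfl fun q hq => ?_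
    rw [Finset.mem_Ioc] at hq
    exact totient_mul_div_eq hl.ne' (by omega)
  rw [e, abs_mul]
  calc _ ≤ 1 * ((0 + 2) * (1 + Real.log n)) := by gcongr
    _ = _ := by ring

/-- The indicator function of the positive integers coprime to `l`. -/
noncomputable def coprimeIndicator (l : ℕ) : ArithmeticFunction ℝ :=
  ⟨fun f => if f.Coprime l ∧ f ≠ 0 then 1 else 0, by simp⟩

lemma coprimeIndicator_apply (l f : ℕ) :
    coprimeIndicator l f = if f.Coprime l ∧ f ≠ 0 then 1 else 0 := rfl

lemma moebiusDiv_mul_coprimeIndicator (l : ℕ) {q : ℕ} (hq : q ≠ 0) :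
    (moebiusDiv l * coprimeIndicator l) q =
      if q.Coprime l then (Nat.totient q : ℝ) / q else 0 := by
  rw [ArithmeticFunction.mul_apply]
  split_ifs with h
  · rw [← sum_moebius_div_eq hq, Nat.sum_divisorsAntidiagonal
      (f := fun e f => moebiusDiv l e * coprimeIndicator l f)]
    refine Finset.sum_congr rfl fun e he => ?_
    have hd := (Nat.mem_divisors.1 he).1
    have h1 : e.Coprime l := Nat.Coprime.of_dvd_left hd h
    have h2 : (q / e).Coprime l := Nat.Coprime.of_dvd_left (Nat.div_dvd_of_dvd hd) h
    have h3 : q / e ≠ 0 := (Nat.div_pos (Nat.le_of_dvd (by omega) hd)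
      (Nat.pos_of_mem_divisors he)).ne'
    rw [moebiusDiv_apply, coprimeIndicator_apply, if_pos h1, if_pos ⟨h2, h3⟩, mul_one]
  · refine Finset.sum_eq_zero fun v hv => ?_
    rw [Nat.mem_divisorsAntidiagonal] at hv
    rw [moebiusDiv_apply, coprimeIndicator_apply]
    by_cases h1 : v.1.Coprime l
    · have : ¬ v.2.Coprime l := fun h2 => h (by rw [← hv.1]; exact Nat.Coprime.mul_left h1 h2)
      simp [this]
    · simp [h1]

lemma abs_sum_coprimeIndicator_sub_le {l : ℕ} (hl : 0 < l) (k : ℕ) :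
    |∑ f ∈ Finset.Ioc 0 k, coprimeIndicator l f - (Nat.totient l : ℝ) / l * k| ≤
      l.divisors.card := by
  classical
  have h := abs_card_coprime_sub_le (a := 0) (b := k) (by positivity) hl.ne'
  have e : ∑ f ∈ Finset.Ioc 0 k, coprimeIndicator l f =
      (((Finset.Ioc ⌊(0 : ℝ)⌋ ⌊(k : ℝ)⌋).filter fun p => IsCoprime (l : ℤ) p).card : ℝ) := by
    simp_rw [coprimeIndicator_apply]
    rw [← Finset.sum_filter, Finset.sum_const, nsmul_eq_mul, mul_one]
    congr 1
    refine Finset.card_bij (fun f _ => (f : ℤ)) ?_ ?_ ?_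
    · intro f hf
      simp only [Finset.mem_filter, Finset.mem_Ioc, Int.floor_zero, Int.floor_natCast] at hf ⊢
      refine ⟨by omega, ?_⟩
      exact (Nat.isCoprime_iff_coprime.2 hf.2.1).symm
    · intro a _ b _ hab
      exact_mod_cast hab
    · intro p hp
      simp only [Finset.mem_filter, Finset.mem_Ioc, Int.floor_zero, Int.floor_natCast] at hp
      refine ⟨p.toNat, ?_, by omega⟩
      simp only [Finset.mem_filter, Finset.mem_Ioc]
      refine ⟨by omega, ?_, by omega⟩
      have h1 : ((p.toNat : ℕ) : ℤ) = p := by omega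
      rw [← Nat.isCoprime_iff_coprime, h1]
      exact hp.2.symm
  rw [e]
  convert! h using 2
  ring

lemma abs_sum_coprime_totient_div_sub_le {l : ℕ} (hl : 0 < l) {n : ℕ} (hn : 0 < n) :
    |∑ q ∈ Finset.Ioc 0 n, (if q.Coprime l then (Nat.totient q : ℝ) / q else 0) - Cconst l * n| ≤
      ((l.divisors.card : ℝ) + 2) * (1 + Real.log n) := by
  have hr : |(Nat.totient l : ℝ) / l| ≤ 1 := by
    rw [abs_of_nonneg (by positivity)]
    exact div_le_one_of_le₀ (by exact_mod_cast Nat.totient_le l) (by positivity)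
  have h := abs_sum_convolution_sub_le l (coprimeIndicator l) _ _ hr
    (abs_sum_coprimeIndicator_sub_le hl) n hn
  rw [← Cconst_eq] at h
  convert! h using 3
  refine Finset.sum_congr rfl fun q hq => ?_
  rw [Finset.mem_Ioc] at hq
  exact (moebiusDiv_mul_coprimeIndicator l (by omega)).symm

lemma abs_sum_totient_div_sub_le {n : ℕ} (hn : 0 < n) :
    |∑ q ∈ Finset.Ioc 0 n, (Nat.totient q : ℝ) / q - 1 / zeta2 * n| ≤ 2 * (1 + Real.log n) := by
  have h := abs_sum_totient_mul_div_sub_le (l := 1) one_pos hn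
  rw [Cconst_one] at h
  simpa using h

end DensitySums

section Discrepancy

lemma card_compSet_add_le (l : ℕ) (P : ZMod l → ZMod l → Prop) (α β : ℝ) (n : ℕ) {σ : ℤ}
    (hσ : σ = 1 ∨ σ = -1) {x y : ℝ} (hxy : x ≤ y) :
    ((compSet l P α β σ 0 x n).card + (compSet l P α β σ x y n).card +
      (compSet l P α β σ y 1 n).card : ℝ) ≤ (primSet l P α β n).card := by
  classical
  have hd1 : Disjoint (compSet l P α β σ 0 x n) (compSet l P α β σ x y n) := by
    rw [Finset.disjoint_left]
    intro v h1 h2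
    rw [mem_compSet] at h1 h2
    linarith [h1.2.2.2.2.2, h2.2.2.2.2.1]
  have hd2 : Disjoint (compSet l P α β σ 0 x n ∪ compSet l P α β σ x y n)
      (compSet l P α β σ y 1 n) := by
    rw [Finset.disjoint_left]
    intro v h1 h2
    rw [Finset.mem_union, mem_compSet, mem_compSet] at h1
    rw [mem_compSet] at h2
    rcases h1 with h1 | h1
    · have : (0 : ℝ) ≤ v.1 := Nat.cast_nonneg _
      nlinarith [h1.2.2.2.2.2, h2.2.2.2.2.1]
    · linarith [h1.2.2.2.2.2, h2.2.2.2.2.1]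
  rw [← Nat.cast_add, ← Nat.cast_add, ← Finset.card_union_of_disjoint hd1,
    ← Finset.card_union_of_disjoint hd2, Nat.cast_le]
  set U := compSet l P α β σ 0 x n ∪ compSet l P α β σ x y n ∪ compSet l P α β σ y 1 n with hU
  have key : ∀ v ∈ U, (1 ≤ v.1 ∧ v.1 ≤ n) ∧
      ((α * v.1 < v.2.1 ∧ (v.2.1 : ℝ) ≤ β * v.1) ∧ 0 ≤ v.2.2 ∧ v.2.2 < v.1) ∧
      P v.1 v.2.1 ∧ (v.1 : ℤ) ∣ v.2.2 * v.2.1 - σ := by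
    intro v hv
    simp only [hU, Finset.mem_union, mem_compSet] at hv
    rcases hv with (hv | hv) | hv <;> exact ⟨hv.1, hv.2.1, hv.2.2.1, hv.2.2.2.1⟩
  have hcop : ∀ v ∈ U, IsCoprime (v.1 : ℤ) v.2.1 := by
    intro v hv
    obtain ⟨k, hk⟩ := (key v hv).2.2.2
    rcases hσ with rfl | rfl
    · exact ⟨-k, v.2.2, by linear_combination hk⟩
    · exact ⟨k, -v.2.2, by linear_combination -hk⟩
  refine Finset.card_le_card_of_injOn (fun v => ⟨v.1, v.2.1⟩) ?_ ?_
  · intro v hv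
    have h := key v hv
    simp only [Finset.mem_coe, mem_primSet]
    exact ⟨h.1, h.2.1.1, h.2.2.1, hcop v hv⟩
  · rintro ⟨Q, p, q⟩ hv ⟨Q', p', q'⟩ hv' hvv
    simp only [Sigma.mk.injEq, heq_eq_eq] at hvv
    obtain ⟨rfl, rfl⟩ := hvv
    have h := key _ hv
    have h' := key _ hv'
    have hc := hcop _ hv
    simp only at h h' hc
    have h3 : (Q : ℤ) ∣ (q - q') * p := by
      have := dvd_sub h.2.2.2 h'.2.2.2
      convert! this using 1; ring
    have h4 : (Q : ℤ) ∣ q - q' := hc.dvd_of_dvd_mul_right h3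
    have h5 : q - q' = 0 := Int.eq_zero_of_abs_lt_dvd h4 (by rw [abs_lt]; omega)
    have : q = q' := by omega
    rw [this]

lemma abs_card_compSet_sub_le {l : ℕ} (hl : 0 < l) {δ : ℝ} (hδ : 0 < δ) :
    ∃ C : ℝ, 0 < C ∧ ∀ (P : ZMod l → ZMod l → Prop) (α β Y : ℝ) (n : ℕ) (σ : ℤ) (x y : ℝ),
      β - α ≤ Y → 0 < Y → Y ≤ 1 → 1 ≤ n → (σ = 1 ∨ σ = -1) → 0 ≤ x → x ≤ y → y ≤ 1 →
      |((compSet l P α β σ x y n).card : ℝ) - (y - x) * ((primSet l P α β n).card : ℝ)| ≤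
        C * ((n : ℝ) ^ (7 / 4 + δ) * Y ^ (3 / 4 : ℝ) + 1 / √Y) := by
  obtain ⟨C, hC, h⟩ := card_compSet_ge hl hδ
  refine ⟨2 * C, by positivity, ?_⟩
  intro P α β Y n σ x y hY hY0 hY1 hn hσ hx hxy hy
  have h1 := h P α β Y n σ 0 x hY hY0 hY1 hn hσ le_rfl hx (hxy.trans hy)
  have h2 := h P α β Y n σ x y hY hY0 hY1 hn hσ hx hxy hy
  have h3 := h P α β Y n σ y 1 hY hY0 hY1 hn hσ (hx.trans hxy) hy le_rfl
  have h4 := card_compSet_add_le l P α β n hσ hxy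
  have h5 : 0 ≤ C * ((n : ℝ) ^ (7 / 4 + δ) * Y ^ (3 / 4 : ℝ) + 1 / √Y) := by positivity
  rw [abs_le]
  constructor <;> linarith

lemma sum_one_div_fst_eq {β : Type*} (S : ℕ → Finset (Σ _ : ℕ, β)) (R : (Σ _ : ℕ, β) → Prop)
    (hS : ∀ n v, v ∈ S n ↔ (1 ≤ v.1 ∧ v.1 ≤ n) ∧ R v) (n : ℕ) (hn : 1 ≤ n) :
    ∑ v ∈ S n, (1 : ℝ) / v.1 = (S n).card / n +
      ∑ k ∈ Finset.Ico 1 n, ((S k).card : ℝ) / (k * (k + 1)) := by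
  classical
  have hstep : ∀ n, ∑ v ∈ S (n + 1), (1 : ℝ) / v.1 = ∑ v ∈ S n, (1 : ℝ) / v.1 +
      (((S (n + 1)).card : ℝ) - (S n).card) / (n + 1) := by
    intro n
    have hsub : S n ⊆ S (n + 1) := by
      intro v hv
      rw [hS] at hv ⊢
      exact ⟨⟨hv.1.1, by omega⟩, hv.2⟩
    rw [← Finset.sum_sdiff hsub, add_comm]
    congr 1
    rw [Finset.sum_congr rfl (g := fun _ => (1 : ℝ) / (n + 1))]
    · rw [Finset.sum_const, nsmul_eq_mul, Finset.card_sdiff_of_subset hsub,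
        Nat.cast_sub (Finset.card_le_card hsub)]
      ring
    · intro v hv
      rw [Finset.mem_sdiff, hS, hS] at hv
      have : v.1 = n + 1 := by
        have := hv.1.1
        by_contra h
        exact hv.2 ⟨⟨this.1, by omega⟩, hv.1.2⟩
      rw [this]; push_cast; rfl
  induction n, hn using Nat.le_induction with
  | base =>
    have h0 : S 0 = ∅ := by
      ext v; rw [hS]; constructor
      · rintro ⟨⟨h1, h2⟩, -⟩; omega
      · intro h; simp at h
    have := hstep 0
    rw [h0] at this
    simpa using this
  | succ n hn ih =>
    rw [hstep n, ih, Finset.sum_Ico_succ_top hn]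
    have : (0 : ℝ) < n := by exact_mod_cast hn
    push_cast
    field_simp
    ring

lemma abs_sum_one_div_fst_sub_le {β γ : Type*} (S : ℕ → Finset (Σ _ : ℕ, β))
    (R : (Σ _ : ℕ, β) → Prop) (hS : ∀ n v, v ∈ S n ↔ (1 ≤ v.1 ∧ v.1 ≤ n) ∧ R v)
    (S' : ℕ → Finset (Σ _ : ℕ, γ))
    (R' : (Σ _ : ℕ, γ) → Prop) (hS' : ∀ n v, v ∈ S' n ↔ (1 ≤ v.1 ∧ v.1 ≤ n) ∧ R' v)
    (t W : ℝ) (n : ℕ) (hn : 1 ≤ n)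
    (h : ∀ k, 1 ≤ k → k ≤ n → |((S k).card : ℝ) - t * (S' k).card| ≤ W * k) :
    |∑ v ∈ S n, (1 : ℝ) / v.1 - t * ∑ v ∈ S' n, (1 : ℝ) / v.1| ≤ W * (2 + Real.log n) := by
  have hn0 : (0 : ℝ) < n := by exact_mod_cast hn
  have hW : 0 ≤ W := by
    have := (abs_nonneg _).trans (h n hn le_rfl)
    exact nonneg_of_mul_nonneg_left this hn0
  rw [sum_one_div_fst_eq S R hS n hn, sum_one_div_fst_eq S' R' hS' n hn]
  have e : ((S n).card : ℝ) / n + ∑ k ∈ Finset.Ico 1 n, ((S k).card : ℝ) / (k * (k + 1)) -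
      t * (((S' n).card : ℝ) / n + ∑ k ∈ Finset.Ico 1 n, ((S' k).card : ℝ) / (k * (k + 1))) =
      (((S n).card : ℝ) - t * (S' n).card) / n + ∑ k ∈ Finset.Ico 1 n,
        (((S k).card : ℝ) - t * (S' k).card) / (k * (k + 1)) := by
    rw [mul_add, Finset.mul_sum, add_sub_add_comm, ← Finset.sum_sub_distrib]
    congr 1
    · ring
    · refine Finset.sum_congr rfl fun k _ => by ring
  rw [e]
  have h1 : |(((S n).card : ℝ) - t * (S' n).card) / n| ≤ W := by
    rw [abs_div, Nat.abs_cast, div_le_iff₀ hn0]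
    exact h n hn le_rfl
  have h2 : |∑ k ∈ Finset.Ico 1 n, (((S k).card : ℝ) - t * (S' k).card) / (k * (k + 1))| ≤
      W * (1 + Real.log n) := by
    refine (Finset.abs_sum_le_sum_abs _ _).trans ?_
    refine le_trans ?_ (mul_le_mul_of_nonneg_left (sum_one_div_Ioc_le n) hW)
    rw [Finset.mul_sum]
    refine le_trans (Finset.sum_le_sum (g := fun k : ℕ => W * (1 / (k : ℝ))) fun k hk => ?_) ?_
    · rw [Finset.mem_Ico] at hk
      have hk0 : (0 : ℝ) < k := by exact_mod_cast hk.1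
      rw [abs_div, abs_of_pos (by positivity : (0 : ℝ) < k * (k + 1)), div_le_iff₀ (by positivity)]
      have e2 : W * (1 / (k : ℝ)) * (k * (k + 1)) = W * k + W := by field_simp
      rw [e2]
      linarith [h k hk.1 hk.2.le]
    · refine Finset.sum_le_sum_of_subset_of_nonneg ?_ (fun k _ _ => by positivity)
      intro k hk
      rw [Finset.mem_Ico] at hk; rw [Finset.mem_Ioc]; omega
  refine (abs_add_le _ _).trans ?_
  linarith

lemma abs_sum_compSet_sub_le {l : ℕ} (hl : 0 < l) {δ : ℝ} (hδ : 0 < δ) :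
    ∃ C : ℝ, 0 < C ∧ ∀ (P : ZMod l → ZMod l → Prop) (α β Y : ℝ) (n : ℕ) (σ : ℤ) (x y : ℝ),
      β - α ≤ Y → 0 < Y → Y ≤ 1 → 1 ≤ n → (σ = 1 ∨ σ = -1) → 0 ≤ x → x ≤ y → y ≤ 1 →
      |∑ v ∈ compSet l P α β σ x y n, (1 : ℝ) / v.1 -
        (y - x) * ∑ v ∈ primSet l P α β n, (1 : ℝ) / v.1| ≤
        C * ((n : ℝ) ^ (3 / 4 + δ) * Y ^ (3 / 4 : ℝ) + 1 / √Y) * (2 + Real.log n) := by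
  obtain ⟨C, hC, h⟩ := abs_card_compSet_sub_le hl hδ
  refine ⟨C, hC, ?_⟩
  intro P α β Y n σ x y hY hY0 hY1 hn hσ hx hxy hy
  refine abs_sum_one_div_fst_sub_le (fun n => compSet l P α β σ x y n) _
    (fun n v => mem_compSet) (fun n => primSet l P α β n) _ (fun n v => mem_primSet) _ _ n hn ?_
  intro k hk hkn
  refine (h P α β Y k σ x y hY hY0 hY1 hk hσ hx hxy hy).trans ?_
  have hk0 : (0 : ℝ) < k := by exact_mod_cast hk
  have hk1 : (1 : ℝ) ≤ k := by exact_mod_cast hk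
  have e1 : (k : ℝ) ^ (7 / 4 + δ) = (k : ℝ) ^ (3 / 4 + δ) * k := by
    rw [← Real.rpow_add_one hk0.ne']; congr 1; ring
  have e2 : (k : ℝ) ^ (3 / 4 + δ) ≤ (n : ℝ) ^ (3 / 4 + δ) := by gcongr
  have e3 : 1 / √Y ≤ 1 / √Y * k := le_mul_of_one_le_right (by positivity) hk1
  rw [e1, mul_assoc C]
  refine mul_le_mul_of_nonneg_left ?_ hC.le
  rw [add_mul]
  refine add_le_add ?_ e3
  have : (0 : ℝ) ≤ Y ^ (3 / 4 : ℝ) * k := by positivity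
  nlinarith
end Discrepancy

section MainTerms

lemma card_filter_congr_of_iff {ι : Type*} {s : Finset ι} {P Q : ι → Prop} (i : DecidablePred P)
    (j : DecidablePred Q) (h : ∀ p ∈ s, P p ↔ Q p) :
    (@Finset.filter ι P i s).card = (@Finset.filter ι Q j s).card := by
  congr 1
  ext p
  simp only [Finset.mem_filter]
  exact and_congr_right (h p)

lemma sum_card_divisors_mul_div_le {l : ℕ} (hl : 0 < l) {δ : ℝ} (hδ : 0 < δ) :
    ∃ C : ℝ, 0 < C ∧ ∀ n : ℕ, 1 ≤ n →
      ∑ q ∈ Finset.Ioc 0 n, ((l * q).divisors.card : ℝ) / q ≤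
        C * (n : ℝ) ^ δ * (1 + Real.log n) := by
  obtain ⟨C, hC, h⟩ := card_divisors_le_rpow δ hδ
  refine ⟨C * (l : ℝ) ^ δ, by positivity, fun n hn => ?_⟩
  refine le_trans (Finset.sum_le_sum
    (g := fun q : ℕ => C * (l : ℝ) ^ δ * (n : ℝ) ^ δ * (1 / (q : ℝ))) fun q hq => ?_) ?_
  · rw [Finset.mem_Ioc] at hq
    have hq0 : (0 : ℝ) < q := by exact_mod_cast hq.1
    rw [div_eq_mul_one_div]
    refine mul_le_mul_of_nonneg_right ((h (l * q) (Nat.mul_pos hl hq.1)).trans ?_) (by positivity)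
    push_cast
    rw [Real.mul_rpow (by positivity) (by positivity), ← mul_assoc]
    have : (q : ℝ) ≤ n := by exact_mod_cast hq.2
    gcongr
  · rw [← Finset.mul_sum]
    exact mul_le_mul_of_nonneg_left (sum_one_div_Ioc_le n) (by positivity)

open Classical in
lemma card_dvd_coprime_eq {l : ℕ} (hl : 0 < l) {q : ℕ} (a b : ℝ) :
    ((Finset.Ioc ⌊a⌋ ⌊b⌋).filter fun p => (l : ℤ) ∣ p ∧ IsCoprime (q : ℤ) p).card =
      if q.Coprime l then
        ((Finset.Ioc ⌊a / l⌋ ⌊b / l⌋).filter fun p => IsCoprime (q : ℤ) p).card else 0 := by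
  have hl0 : (0 : ℝ) < l := by exact_mod_cast hl
  split_ifs with h
  · symm
    refine Finset.card_bij (fun p _ => (l : ℤ) * p) ?_ ?_ ?_
    · intro p hp
      simp only [Finset.mem_filter, Finset.mem_Ioc, Int.floor_lt, Int.le_floor, div_lt_iff₀ hl0,
        le_div_iff₀ hl0] at hp ⊢
      push_cast
      refine ⟨⟨by linarith [hp.1.1], by linarith [hp.1.2]⟩, dvd_mul_right _ _, ?_⟩
      exact IsCoprime.mul_right (Nat.isCoprime_iff_coprime.2 h) hp.2
    · intro p _ p' _ hpp
      have : (l : ℤ) ≠ 0 := by exact_mod_cast hl.ne'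
      exact mul_left_cancel₀ this hpp
    · intro p hp
      simp only [Finset.mem_filter, Finset.mem_Ioc, Int.floor_lt, Int.le_floor] at hp
      obtain ⟨⟨h1, h2⟩, ⟨k, rfl⟩, h3⟩ := hp
      refine ⟨k, ?_, rfl⟩
      simp only [Finset.mem_filter, Finset.mem_Ioc, Int.floor_lt, Int.le_floor, div_lt_iff₀ hl0,
        le_div_iff₀ hl0]
      push_cast at h1 h2
      exact ⟨⟨by linarith, by linarith⟩, h3.of_mul_right_right⟩
  · rw [Finset.card_eq_zero, Finset.filter_eq_empty_iff]
    rintro p - ⟨⟨k, rfl⟩, h2⟩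
    exact h (Nat.isCoprime_iff_coprime.1 h2.of_mul_right_left)

open Classical in
lemma abs_card_not_dvd_coprime_sub_le {l : ℕ} (hl : 0 < l) {q : ℕ} (hq : q ≠ 0) {a b : ℝ}
    (hab : a ≤ b) :
    |(((Finset.Ioc ⌊a⌋ ⌊b⌋).filter fun p => ¬ (l : ℤ) ∣ p ∧ IsCoprime (q : ℤ) p).card : ℝ) -
      (b - a) * (q.totient / q - (if q.Coprime l then (q.totient : ℝ) / q else 0) / l)| ≤
        2 * q.divisors.card := by
  have hl0 : (0 : ℝ) < l := by exact_mod_cast hl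
  have h1 := abs_card_coprime_sub_le hab hq
  have h2 := abs_card_coprime_sub_le (div_le_div_of_nonneg_right hab hl0.le) hq
  have h3 := card_dvd_coprime_eq hl (q := q) a b
  have h4 : ((Finset.Ioc ⌊a⌋ ⌊b⌋).filter fun p => IsCoprime (q : ℤ) p).card =
      ((Finset.Ioc ⌊a⌋ ⌊b⌋).filter fun p => (l : ℤ) ∣ p ∧ IsCoprime (q : ℤ) p).card +
      ((Finset.Ioc ⌊a⌋ ⌊b⌋).filter fun p => ¬ (l : ℤ) ∣ p ∧ IsCoprime (q : ℤ) p).card := by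
    rw [← Finset.card_filter_add_card_filter_not (s := (Finset.Ioc ⌊a⌋ ⌊b⌋).filter
      fun p => IsCoprime (q : ℤ) p) (fun p => (l : ℤ) ∣ p), Finset.filter_filter,
      Finset.filter_filter]
    simp only [and_comm]
  have h5 : (((Finset.Ioc ⌊a⌋ ⌊b⌋).filter fun p => ¬ (l : ℤ) ∣ p ∧ IsCoprime (q : ℤ) p).card : ℝ) =
      (((Finset.Ioc ⌊a⌋ ⌊b⌋).filter fun p => IsCoprime (q : ℤ) p).card : ℝ) -
      (if q.Coprime l then
        (((Finset.Ioc ⌊a / l⌋ ⌊b / l⌋).filter fun p => IsCoprime (q : ℤ) p).card : ℝ) else 0) := by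
    rw [h4, h3]; push_cast; split_ifs <;> ring
  rw [h5]
  rw [abs_le] at h1 h2 ⊢
  have h0 : (0 : ℝ) ≤ q.divisors.card := Nat.cast_nonneg _
  split_ifs
  · have e : (b / l - a / l) * ((q.totient : ℝ) / q) = (b - a) * ((q.totient : ℝ) / q / l) := by
      field_simp
    rw [e] at h2
    constructor <;> linarith [h1.1, h1.2, h2.1, h2.2]
  · rw [zero_div, sub_zero, sub_zero]
    constructor <;> linarith [h1.1, h1.2]

lemma sum_primSet_eq (l : ℕ) (P : ZMod l → ZMod l → Prop) (α β : ℝ) (n : ℕ) :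
    ∑ v ∈ primSet l P α β n, (1 : ℝ) / v.1 = open Classical in
      ∑ q ∈ Finset.Ioc 0 n, (((Finset.Ioc ⌊α * q⌋ ⌊β * q⌋).filter fun p : ℤ =>
        P q p ∧ IsCoprime (q : ℤ) p).card : ℝ) / q := by
  classical
  rw [primSet, Finset.sum_sigma]
  have : Finset.Icc 1 n = Finset.Ioc 0 n := by ext; simp; omega
  rw [this]
  refine Finset.sum_congr rfl fun q _ => ?_
  simp only [Finset.sum_const, nsmul_eq_mul]
  rw [mul_one_div]

lemma abs_sum_primSet_ne_sub_le {l : ℕ} (hl : 0 < l) {δ : ℝ} (hδ : 0 < δ) :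
    ∃ C : ℝ, 0 < C ∧ ∀ (α β : ℝ) (n : ℕ), α ≤ β → β - α ≤ 1 → 1 ≤ n →
      |∑ v ∈ primSet l (fun _ p => p ≠ 0) α β n, (1 : ℝ) / v.1 -
        (1 / zeta2 - Cconst l / l) * (β - α) * n| ≤ C * (n : ℝ) ^ δ * (1 + Real.log n) := by
  classical
  obtain ⟨C, hC, hτ⟩ := sum_card_divisors_mul_div_le (l := 1) one_pos hδ
  refine ⟨2 * C + (l.divisors.card + 4), by positivity, fun α β n hαβ hβα hn => ?_⟩
  have hl1 : (1 : ℝ) ≤ l := by exact_mod_cast hl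
  set ψ : ℕ → ℝ := fun q => (q.totient : ℝ) / q -
    (if q.Coprime l then (q.totient : ℝ) / q else 0) / l with hψ
  have hA : |∑ v ∈ primSet l (fun _ p => p ≠ 0) α β n, (1 : ℝ) / v.1 -
      (β - α) * ∑ q ∈ Finset.Ioc 0 n, ψ q| ≤ 2 * (C * (n : ℝ) ^ δ * (1 + Real.log n)) := by
    rw [sum_primSet_eq, Finset.mul_sum, ← Finset.sum_sub_distrib]
    refine (Finset.abs_sum_le_sum_abs _ _).trans ?_
    refine le_trans ?_ (mul_le_mul_of_nonneg_left (hτ n hn) two_pos.le)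
    rw [Finset.mul_sum]
    refine Finset.sum_le_sum fun q hq => ?_
    rw [Finset.mem_Ioc] at hq
    have hq0 : (0 : ℝ) < q := by exact_mod_cast hq.1
    have h := abs_card_not_dvd_coprime_sub_le hl (q := q) (by omega)
      (mul_le_mul_of_nonneg_right hαβ hq0.le)
    have e : ∀ p ∈ Finset.Ioc ⌊α * q⌋ ⌊β * q⌋, ((p : ZMod l) ≠ 0 ∧ IsCoprime (q : ℤ) p) ↔
        (¬ (l : ℤ) ∣ p ∧ IsCoprime (q : ℤ) p) := by
      intro p _
      rw [Ne, ZMod.intCast_zmod_eq_zero_iff_dvd]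
    rw [one_mul, ← mul_div_assoc, le_div_iff₀ hq0, ← abs_of_pos hq0, ← abs_mul, abs_of_pos hq0]
    refine le_trans (le_of_eq ?_) h
    rw [card_filter_congr_of_iff _ (fun _ => instDecidableAnd) e]
    congr 1
    rw [sub_mul, div_mul_cancel₀ _ hq0.ne']
    simp only [hψ]
    split_ifs <;> ring
  have hB : |∑ q ∈ Finset.Ioc 0 n, ψ q - (1 / zeta2 - Cconst l / l) * n| ≤
      (l.divisors.card + 4) * (1 + Real.log n) := by
    have h1 := abs_sum_totient_div_sub_le (n := n) (by omega)
    have h2 := abs_sum_coprime_totient_div_sub_le hl (n := n) (by omega)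
    have e : ∑ q ∈ Finset.Ioc 0 n, ψ q - (1 / zeta2 - Cconst l / l) * n =
        (∑ q ∈ Finset.Ioc 0 n, (Nat.totient q : ℝ) / q - 1 / zeta2 * n) -
        (∑ q ∈ Finset.Ioc 0 n, (if q.Coprime l then (Nat.totient q : ℝ) / q else 0)
          - Cconst l * n) / l := by
      rw [hψ, Finset.sum_sub_distrib, ← Finset.sum_div]; ring
    rw [e]
    refine (abs_sub _ _).trans ?_
    rw [abs_div, Nat.abs_cast]
    have h3 := (div_le_self (abs_nonneg _) hl1).trans h2
    refine (add_le_add h1 h3).trans (le_of_eq ?_)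
    ring
  have hn1 : 1 ≤ (n : ℝ) ^ δ := Real.one_le_rpow (by exact_mod_cast hn) hδ.le
  have hlog : 0 ≤ Real.log n := Real.log_natCast_nonneg n
  have hB' : |(β - α) * (∑ q ∈ Finset.Ioc 0 n, ψ q - (1 / zeta2 - Cconst l / l) * n)| ≤
      (l.divisors.card + 4) * (n : ℝ) ^ δ * (1 + Real.log n) := by
    rw [abs_mul, abs_of_nonneg (sub_nonneg.2 hαβ)]
    refine (mul_le_of_le_one_left (abs_nonneg _) hβα).trans (hB.trans ?_)
    gcongr
    exact le_mul_of_one_le_right (add_nonneg (Nat.cast_nonneg _) (by norm_num)) hn1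
  have := abs_add_le (∑ v ∈ primSet l (fun _ p => p ≠ 0) α β n, (1 : ℝ) / v.1 -
      (β - α) * ∑ q ∈ Finset.Ioc 0 n, ψ q)
      ((β - α) * (∑ q ∈ Finset.Ioc 0 n, ψ q - (1 / zeta2 - Cconst l / l) * n))
  refine le_trans (le_of_eq ?_) (this.trans ((add_le_add hA hB').trans (le_of_eq ?_)))
  · congr 1; ring
  · ring

lemma sum_Ioc_mul_eq_of_dvd {l : ℕ} (hl : 0 < l) (n : ℕ) (f : ℕ → ℝ)
    (hf : ∀ q, ¬ l ∣ q → f q = 0) :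
    ∑ q ∈ Finset.Ioc 0 (l * n), f q = ∑ q ∈ Finset.Ioc 0 n, f (l * q) := by
  classical
  have hinj : Set.InjOn (fun q => l * q) (Finset.Ioc 0 n : Finset ℕ) :=
    fun a _ b _ h => Nat.eq_of_mul_eq_mul_left hl h
  rw [← Finset.sum_image (f := f) hinj]
  symm
  refine Finset.sum_subset ?_ ?_
  · intro q hq
    simp only [Finset.mem_image, Finset.mem_Ioc] at hq ⊢
    obtain ⟨a, ha, rfl⟩ := hq
    exact ⟨Nat.mul_pos hl ha.1, Nat.mul_le_mul_left l ha.2⟩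
  · intro q hq hq'
    refine hf q ?_
    rintro ⟨a, rfl⟩
    refine hq' ?_
    simp only [Finset.mem_image, Finset.mem_Ioc] at hq ⊢
    exact ⟨a, ⟨Nat.pos_of_mul_pos_left hq.1, Nat.le_of_mul_le_mul_left hq.2 hl⟩, rfl⟩

lemma abs_sum_primSet_eq_zero_sub_le {l : ℕ} (hl : 0 < l) {δ : ℝ} (hδ : 0 < δ) :
    ∃ C : ℝ, 0 < C ∧ ∀ (α β : ℝ) (n : ℕ), α ≤ β → β - α ≤ 1 → 1 ≤ n →
      |l * ∑ v ∈ primSet l (fun Q _ => Q = 0) (α / l) (β / l) (l * n), (1 : ℝ) / v.1 -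
        Cconst l * (β - α) * n| ≤ C * (n : ℝ) ^ δ * (1 + Real.log n) := by
  classical
  obtain ⟨C, hC, hτ⟩ := sum_card_divisors_mul_div_le hl hδ
  refine ⟨C + 2, by positivity, fun α β n hαβ hβα hn => ?_⟩
  have hl1 : (1 : ℝ) ≤ l := by exact_mod_cast hl
  have hl0 : (0 : ℝ) < l := by exact_mod_cast hl
  set ψ : ℕ → ℝ := fun q => (Nat.totient (l * q) : ℝ) / (l * q : ℕ) with hψ
  have hA : |l * ∑ v ∈ primSet l (fun Q _ => Q = 0) (α / l) (β / l) (l * n), (1 : ℝ) / v.1 -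
      (β - α) * ∑ q ∈ Finset.Ioc 0 n, ψ q| ≤ C * (n : ℝ) ^ δ * (1 + Real.log n) := by
    rw [sum_primSet_eq, sum_Ioc_mul_eq_of_dvd hl, Finset.mul_sum, Finset.mul_sum,
      ← Finset.sum_sub_distrib]
    · refine (Finset.abs_sum_le_sum_abs _ _).trans ?_
      refine le_trans ?_ (hτ n hn)
      refine Finset.sum_le_sum fun q hq => ?_
      rw [Finset.mem_Ioc] at hq
      have hq0 : (0 : ℝ) < q := by exact_mod_cast hq.1
      have h := abs_card_coprime_sub_le (mul_le_mul_of_nonneg_right hαβ hq0.le)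
        (N := l * q) (Nat.mul_pos hl hq.1).ne'
      have e1 : α / l * ((l * q : ℕ) : ℝ) = α * q := by push_cast; field_simp
      have e2 : β / l * ((l * q : ℕ) : ℝ) = β * q := by push_cast; field_simp
      have e : ∀ p ∈ Finset.Ioc ⌊α * q⌋ ⌊β * q⌋, (((l * q : ℕ) : ZMod l) = 0 ∧
          IsCoprime ((l * q : ℕ) : ℤ) p) ↔ IsCoprime ((l * q : ℕ) : ℤ) p := by
        intro p _
        simp
      rw [e1, e2, card_filter_congr_of_iff _ (fun _ => Classical.propDecidable _) e,
        le_div_iff₀ hq0, ← abs_of_pos hq0, ← abs_mul, abs_of_pos hq0]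
      refine le_trans (le_of_eq ?_) h
      congr 1
      rw [sub_mul]
      simp only [hψ]
      push_cast
      field_simp
    · intro q hq
      have : ¬ ((q : ℕ) : ZMod l) = 0 := by rwa [ZMod.natCast_eq_zero_iff]
      simp [this]
  have hB := abs_sum_totient_mul_div_sub_le hl (n := n) (by omega)
  have hn1 : 1 ≤ (n : ℝ) ^ δ := Real.one_le_rpow (by exact_mod_cast hn) hδ.le
  have hlog : 0 ≤ Real.log n := Real.log_natCast_nonneg n
  have hB' : |(β - α) * (∑ q ∈ Finset.Ioc 0 n, ψ q - Cconst l * n)| ≤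
      2 * (n : ℝ) ^ δ * (1 + Real.log n) := by
    rw [abs_mul, abs_of_nonneg (sub_nonneg.2 hαβ)]
    refine (mul_le_of_le_one_left (abs_nonneg _) hβα).trans (hB.trans ?_)
    gcongr
    exact le_mul_of_one_le_right (by norm_num) hn1
  have := abs_add_le (l * ∑ v ∈ primSet l (fun Q _ => Q = 0) (α / l) (β / l) (l * n), (1 : ℝ) / v.1 -
      (β - α) * ∑ q ∈ Finset.Ioc 0 n, ψ q)
      ((β - α) * (∑ q ∈ Finset.Ioc 0 n, ψ q - Cconst l * n))
  refine le_trans (le_of_eq ?_) (this.trans ((add_le_add hA hB').trans (le_of_eq ?_)))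
  · congr 1; ring
  · ring

end MainTerms

section Companions

/-- The error term in the weighted equidistribution of companions. -/
noncomputable def equidistError (δ Y : ℝ) (n : ℕ) : ℝ :=
  ((n : ℝ) ^ (3 / 4 + δ) * Y ^ (3 / 4 : ℝ) + (n : ℝ) ^ δ / √Y) * (2 + Real.log n)

lemma equidistError_nonneg (δ : ℝ) {Y : ℝ} (hY : 0 ≤ Y) (n : ℕ) : 0 ≤ equidistError δ Y n := by
  have := Real.log_natCast_nonneg n
  rw [equidistError]
  positivity

lemma equidistError_mono {δ : ℝ} (hδ : 0 < δ) {Y : ℝ} (hY : 0 ≤ Y) {m n : ℕ} (hm : 1 ≤ m)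
    (hmn : m ≤ n) : equidistError δ Y m ≤ equidistError δ Y n := by
  have := Real.log_natCast_nonneg m
  have h0 : (0 : ℝ) < m := by exact_mod_cast hm
  have h1 : (m : ℝ) ≤ n := by exact_mod_cast hmn
  rw [equidistError, equidistError]
  gcongr

lemma rpow_mul_log_le_equidistError {δ : ℝ} {Y : ℝ} (hY : 0 < Y) (hY1 : Y ≤ 1)
    (n : ℕ) : (n : ℝ) ^ δ * (1 + Real.log n) ≤ equidistError δ Y n := by
  have := Real.log_natCast_nonneg n
  rw [equidistError]
  have h1 : (n : ℝ) ^ δ ≤ (n : ℝ) ^ δ / √Y :=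
    le_div_self (by positivity) (by positivity) (Real.sqrt_le_one.2 hY1)
  have h2 : 0 ≤ (n : ℝ) ^ (3 / 4 + δ) * Y ^ (3 / 4 : ℝ) := by positivity
  have h3 : 0 ≤ (n : ℝ) ^ δ := by positivity
  gcongr <;> linarith

lemma mul_log_le_equidistError {δ : ℝ} (hδ : 0 < δ) {Y : ℝ} (hY : 0 < Y) {n : ℕ}
    (hn : 1 ≤ n) : ((n : ℝ) ^ (3 / 4 + δ) * Y ^ (3 / 4 : ℝ) + 1 / √Y) * (2 + Real.log n) ≤
      equidistError δ Y n := by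
  have := Real.log_natCast_nonneg n
  rw [equidistError]
  have hn1 : 1 ≤ (n : ℝ) ^ δ := Real.one_le_rpow (by exact_mod_cast hn) hδ.le
  gcongr

lemma equidistError_mul_le {l : ℕ} (hl : 0 < l) {δ : ℝ} {Y : ℝ} (hY : 0 < Y) {n : ℕ}
    (hn : 1 ≤ n) : equidistError δ Y (l * n) ≤
      (l : ℝ) ^ (3 / 4 + δ) * (2 + Real.log l) * equidistError δ Y n := by
  have h1 := Real.log_natCast_nonneg n
  have h2 := Real.log_natCast_nonneg l
  have hl1 : (1 : ℝ) ≤ l := by exact_mod_cast hl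
  have hl0 : (0 : ℝ) < l := by exact_mod_cast hl
  have hn0 : (0 : ℝ) < n := by exact_mod_cast hn
  have h3 : (l : ℝ) ^ δ ≤ (l : ℝ) ^ (3 / 4 + δ) := Real.rpow_le_rpow_of_exponent_le hl1 (by linarith)
  rw [equidistError, equidistError]
  push_cast
  rw [Real.mul_rpow hl0.le hn0.le, Real.mul_rpow hl0.le hn0.le, Real.log_mul hl0.ne' hn0.ne']
  calc _ ≤ ((l : ℝ) ^ (3 / 4 + δ) * (n : ℝ) ^ (3 / 4 + δ) * Y ^ (3 / 4 : ℝ) +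
        (l : ℝ) ^ (3 / 4 + δ) * (n : ℝ) ^ δ / √Y) * ((2 + Real.log l) * (2 + Real.log n)) := by
        gcongr
        nlinarith
    _ = _ := by ring

lemma abs_sum_compSet_ne_sub_le {l : ℕ} (hl : 0 < l) {δ : ℝ} (hδ : 0 < δ) :
    ∃ C : ℝ, 0 < C ∧ ∀ (α β Y : ℝ) (n : ℕ) (σ : ℤ) (x y : ℝ),
      α ≤ β → β - α ≤ Y → 0 < Y → Y ≤ 1 → 1 ≤ n → (σ = 1 ∨ σ = -1) → 0 ≤ x → x ≤ y → y ≤ 1 →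
      |∑ v ∈ compSet l (fun _ p => p ≠ 0) α β σ x y n, (1 : ℝ) / v.1 -
        (y - x) * ((1 / zeta2 - Cconst l / l) * (β - α)) * n| ≤ C * equidistError δ Y n := by
  obtain ⟨C₁, hC₁, h₁⟩ := abs_sum_compSet_sub_le hl hδ
  obtain ⟨C₂, hC₂, h₂⟩ := abs_sum_primSet_ne_sub_le hl hδ
  refine ⟨C₁ + C₂, by positivity, ?_⟩
  intro α β Y n σ x y hαβ hY hY0 hY1 hn hσ hx hxy hy
  have a1 := h₁ (fun _ p => p ≠ 0) α β Y n σ x y hY hY0 hY1 hn hσ hx hxy hy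
  have a2 := h₂ α β n hαβ (hY.trans hY1) hn
  have e1 := mul_log_le_equidistError hδ hY0 hn
  have e2 := rpow_mul_log_le_equidistError (δ := δ) hY0 hY1 n
  rw [mul_assoc] at a1 a2
  have a3 := a1.trans (mul_le_mul_of_nonneg_left e1 hC₁.le)
  rw [mul_assoc C₂] at a2
  have a4 := a2.trans (mul_le_mul_of_nonneg_left e2 hC₂.le)
  have a5 : |(y - x) * (∑ v ∈ primSet l (fun _ p => p ≠ 0) α β n, (1 : ℝ) / v.1 -
      (1 / zeta2 - Cconst l / l) * ((β - α) * n))| ≤ C₂ * equidistError δ Y n := by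
    rw [abs_mul, abs_of_nonneg (sub_nonneg.2 hxy)]
    exact (mul_le_of_le_one_left (abs_nonneg _) (by linarith)).trans a4
  have := abs_add_le _ _ |>.trans (add_le_add a3 a5)
  refine le_trans (le_of_eq ?_) (this.trans (le_of_eq ?_))
  · congr 1; ring
  · ring

lemma abs_sum_compSet_eq_zero_sub_le {l : ℕ} (hl : 0 < l) {δ : ℝ} (hδ : 0 < δ) :
    ∃ C : ℝ, 0 < C ∧ ∀ (α β Y : ℝ) (n : ℕ) (σ : ℤ) (x y : ℝ),
      α ≤ β → β - α ≤ Y → 0 < Y → Y ≤ 1 → 1 ≤ n → (σ = 1 ∨ σ = -1) → 0 ≤ x → x ≤ y → y ≤ 1 →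
      |l * ∑ v ∈ compSet l (fun Q _ => Q = 0) (α / l) (β / l) σ (x / l) (y / l) (l * n),
          (1 : ℝ) / v.1 - (y - x) * (Cconst l / l * (β - α)) * n| ≤ C * equidistError δ Y n := by
  obtain ⟨C₁, hC₁, h₁⟩ := abs_sum_compSet_sub_le hl hδ
  obtain ⟨C₂, hC₂, h₂⟩ := abs_sum_primSet_eq_zero_sub_le hl hδ
  have hl1 : (1 : ℝ) ≤ l := by exact_mod_cast hl
  have hl0 : (0 : ℝ) < l := by exact_mod_cast hl
  have hlog := Real.log_natCast_nonneg l
  refine ⟨l * (C₁ * ((l : ℝ) ^ (3 / 4 + δ) * (2 + Real.log l))) + C₂, by positivity, ?_⟩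
  intro α β Y n σ x y hαβ hY hY0 hY1 hn hσ hx hxy hy
  have a1 := h₁ (fun Q _ => Q = 0) (α / l) (β / l) Y (l * n) σ (x / l) (y / l)
    (by rw [← sub_div]; exact (div_le_self (sub_nonneg.2 hαβ) hl1).trans hY) hY0 hY1
    (Nat.mul_pos hl hn) hσ (by positivity) (by gcongr) ((div_le_self (hx.trans hxy) hl1).trans hy)
  have a2 := h₂ α β n hαβ (hY.trans hY1) hn
  have e1 := mul_log_le_equidistError hδ hY0 (n := l * n) (Nat.mul_pos hl hn)
  have e2 := rpow_mul_log_le_equidistError (δ := δ) hY0 hY1 n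
  have e3 := equidistError_mul_le (δ := δ) hl hY0 hn
  rw [mul_assoc] at a1
  have a3 := mul_le_mul_of_nonneg_left
    (a1.trans (mul_le_mul_of_nonneg_left (e1.trans e3) hC₁.le)) hl0.le
  rw [mul_assoc C₂] at a2
  have a4 := a2.trans (mul_le_mul_of_nonneg_left e2 hC₂.le)
  set S := ∑ v ∈ primSet l (fun Q _ => Q = 0) (α / l) (β / l) (l * n), (1 : ℝ) / v.1
  set S' := ∑ v ∈ compSet l (fun Q _ => Q = 0) (α / l) (β / l) σ (x / l) (y / l) (l * n),
          (1 : ℝ) / v.1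
  have a5 : |(y - x) / l * (l * S - Cconst l * (β - α) * n)| ≤ C₂ * equidistError δ Y n := by
    have h0 : 0 ≤ (y - x) / l := div_nonneg (sub_nonneg.2 hxy) hl0.le
    rw [abs_mul, abs_of_nonneg h0]
    refine (mul_le_of_le_one_left (abs_nonneg _) ?_).trans a4
    exact (div_le_self (sub_nonneg.2 hxy) hl1).trans (by linarith)
  have a6 : l * |S' - (y / l - x / l) * S| = |l * (S' - (y / l - x / l) * S)| := by
    rw [abs_mul, Nat.abs_cast]
  rw [a6] at a3
  have := abs_add_le _ _ |>.trans (add_le_add a3 a5)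
  refine le_trans (le_of_eq ?_) (this.trans (le_of_eq ?_))
  · congr 1; field_simp; ring
  · ring

/-- The companions `(q, p, q')` with `l ∤ p`, `p / q ∈ (α, β]` and `q q' p ≡ σ`. -/
noncomputable def companions (l : ℕ) (α β : ℝ) (σ : ℤ) (N : ℕ) : Finset (Σ _ : ℕ, ℤ × ℤ) :=
  compSet l (fun _ p => p ≠ 0) α β σ 0 1 N

/-- The companions for which `q' p ≡ σ` modulo `l q`. -/
noncomputable def divCompanions (l : ℕ) (α β : ℝ) (σ : ℤ) (N : ℕ) : Finset (Σ _ : ℕ, ℤ × ℤ) :=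
  open Classical in
  (companions l α β σ N).filter fun v => ((l * v.1 : ℕ) : ℤ) ∣ v.2.2 * v.2.1 - σ

open Classical in
lemma filter_companions_eq (l : ℕ) (α β : ℝ) (σ : ℤ) {n N : ℕ} (hn : n ≤ N) {x y : ℝ} (hx : 0 ≤ x)
    (hy : y ≤ 1) :
    ((companions l α β σ N).filter fun v => v.1 ≤ n ∧ x < v.2.2 / v.1 ∧ (v.2.2 : ℝ) / v.1 < y) =
      compSet l (fun _ p => p ≠ 0) α β σ x y n := by
  ext v
  rw [Finset.mem_filter, companions, mem_compSet, mem_compSet]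
  constructor
  · rintro ⟨⟨h1, h2, h3, h4, h5, h6⟩, h7, h8, h9⟩
    have h0 : (0 : ℝ) < v.1 := by exact_mod_cast h1.1
    rw [lt_div_iff₀ h0] at h8
    rw [div_lt_iff₀ h0] at h9
    exact ⟨⟨h1.1, h7⟩, h2, h3, h4, h8, h9⟩
  · rintro ⟨h1, h2, h3, h4, h5, h6⟩
    have h0 : (0 : ℝ) < v.1 := by exact_mod_cast h1.1
    refine ⟨⟨⟨h1.1, h1.2.trans hn⟩, h2, h3, h4, ?_, ?_⟩, h1.2, ?_, ?_⟩
    · nlinarith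
    · nlinarith
    · rwa [lt_div_iff₀ h0]
    · rwa [div_lt_iff₀ h0]

open Classical in
lemma sum_filter_divCompanions_eq {l : ℕ} (hl : 2 ≤ l) (α β : ℝ) {σ : ℤ} (hσ : σ = 1 ∨ σ = -1)
    {n N : ℕ} (hn : n ≤ N) {x y : ℝ} (hx : 0 ≤ x) (hy : y ≤ 1) :
    ∑ v ∈ (divCompanions l α β σ N).filter fun v => v.1 ≤ n ∧ x < v.2.2 / v.1 ∧
        (v.2.2 : ℝ) / v.1 < y, (1 : ℝ) / v.1 =
      l * ∑ v ∈ compSet l (fun Q _ => Q = 0) (α / l) (β / l) σ (x / l) (y / l) (l * n),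
          (1 : ℝ) / v.1 := by
  have hl0 : (0 : ℝ) < l := by positivity
  rw [divCompanions, Finset.filter_comm, filter_companions_eq l α β σ hn hx hy, Finset.mul_sum]
  refine Finset.sum_bij (fun v _ => (⟨l * v.1, v.2⟩ : Σ _ : ℕ, ℤ × ℤ)) ?_ ?_ ?_ ?_
  · intro v hv
    rw [Finset.mem_filter, mem_compSet] at hv
    obtain ⟨⟨h1, h2, h3, h4, h5, h6⟩, h7⟩ := hv
    rw [mem_compSet]
    have h0 : (0 : ℝ) < v.1 := by exact_mod_cast h1.1
    refine ⟨⟨Nat.mul_pos (by omega) h1.1, Nat.mul_le_mul_left l h1.2⟩, ⟨⟨?_, ?_⟩, h2.2.1, ?_⟩, ?_, h7,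
      ?_, ?_⟩
    · push_cast; rw [← mul_assoc, div_mul_cancel₀ _ hl0.ne']; exact h2.1.1
    · push_cast; rw [← mul_assoc, div_mul_cancel₀ _ hl0.ne']; exact h2.1.2
    · push_cast; nlinarith [h2.2.2]
    · simp
    · push_cast; rw [← mul_assoc, div_mul_cancel₀ _ hl0.ne']; exact h5
    · push_cast; rw [← mul_assoc, div_mul_cancel₀ _ hl0.ne']; exact h6
  · rintro ⟨q, w⟩ _ ⟨q', w'⟩ _ h
    simp only [Sigma.mk.injEq, heq_eq_eq] at h
    obtain ⟨h1, rfl⟩ := h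
    have : q = q' := Nat.eq_of_mul_eq_mul_left (by omega) h1
    rw [this]
  · rintro ⟨Q, p, q'⟩ hv
    rw [mem_compSet] at hv
    obtain ⟨h1, h2, h3, h4, h5, h6⟩ := hv
    simp only at h1 h2 h3 h4 h5 h6
    rw [ZMod.natCast_eq_zero_iff] at h3
    obtain ⟨q, rfl⟩ := h3
    have hq : 1 ≤ q := Nat.pos_of_mul_pos_left h1.1
    have hq0 : (0 : ℝ) < q := by exact_mod_cast hq
    push_cast at h2 h5 h6
    rw [← mul_assoc, ← mul_assoc, div_mul_cancel₀ _ hl0.ne', div_mul_cancel₀ _ hl0.ne'] at h2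
    rw [← mul_assoc, div_mul_cancel₀ _ hl0.ne'] at h5 h6
    refine ⟨⟨q, p, q'⟩, ?_, rfl⟩
    rw [Finset.mem_filter, mem_compSet]
    refine ⟨⟨⟨hq, Nat.le_of_mul_le_mul_left h1.2 (by omega)⟩, ⟨h2.1, h2.2.1, ?_⟩, ?_, ?_, h5, h6⟩, h4⟩
    · have : (q' : ℝ) < q := by nlinarith
      exact_mod_cast this
    · intro hp
      rw [ZMod.intCast_zmod_eq_zero_iff_dvd] at hp
      have hd : (l : ℤ) ∣ q' * p - σ := dvd_trans ⟨q, by push_cast; ring⟩ h4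
      have : (l : ℤ) ∣ σ := by
        have := dvd_sub (Dvd.dvd.mul_left hp q') hd
        rwa [sub_sub_cancel] at this
      have h9 : (l : ℤ) ∣ 1 := by
        rcases hσ with rfl | rfl
        · exact this
        · exact (dvd_neg.1 this)
      have := Int.le_of_dvd one_pos h9
      omega
    · exact dvd_trans ⟨l, by push_cast; ring⟩ h4
  · intro v hv
    rw [Finset.mem_filter, mem_compSet] at hv
    have h0 : (0 : ℝ) < v.1 := by exact_mod_cast hv.1.1.1
    push_cast
    field_simp

end Companions

section LayerCake

lemma integral_min_one_div_sub {z : ℝ} (hz : 0 < z) (hz1 : z ≤ 1) :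
    IntervalIntegrable (fun m : ℝ => min 1 (1 / m) - z) volume 0 (1 / z) ∧
      ∫ m in (0 : ℝ)..(1 / z), (min 1 (1 / m) - z) = -Real.log z := by
  have h1 : 1 ≤ 1 / z := by rw [le_div_iff₀ hz]; linarith
  have e1 : EqOn (fun m : ℝ => min 1 (1 / m) - z) (fun _ => 1 - z) (uIoc 0 1) := by
    intro m hm
    rw [uIoc_of_le zero_le_one] at hm
    have : 1 ≤ 1 / m := by rw [le_div_iff₀ hm.1]; linarith [hm.2]
    simp only [min_eq_left this]
  have e2 : EqOn (fun m : ℝ => min 1 (1 / m) - z) (fun m => 1 / m - z) (uIcc 1 (1 / z)) := by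
    intro m hm
    rw [uIcc_of_le h1] at hm
    have : 1 / m ≤ 1 := by rw [div_le_iff₀ (by linarith [hm.1])]; linarith [hm.1]
    simp only [min_eq_right this]
  have hc : ContinuousOn (fun m : ℝ => 1 / m) (uIcc 1 (1 / z)) := by
    rw [uIcc_of_le h1]
    exact ContinuousOn.div continuousOn_const continuousOn_id fun m hm => by
      exact (zero_lt_one.trans_le hm.1).ne'
  have i1 : IntervalIntegrable (fun m : ℝ => min 1 (1 / m) - z) volume 0 1 :=
    IntervalIntegrable.congr e1.symm (by simp)
  have i3 : IntervalIntegrable (fun m : ℝ => 1 / m) volume 1 (1 / z) := hc.intervalIntegrable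
  have i2 : IntervalIntegrable (fun m : ℝ => min 1 (1 / m) - z) volume 1 (1 / z) :=
    IntervalIntegrable.congr (e2.symm.mono uIoc_subset_uIcc) (i3.sub (by simp))
  refine ⟨i1.trans i2, ?_⟩
  rw [← intervalIntegral.integral_add_adjacent_intervals i1 i2,
    intervalIntegral.integral_congr_ae (ae_of_all _ e1), intervalIntegral.integral_congr e2,
    intervalIntegral.integral_sub i3 (by simp), integral_one_div_of_pos one_pos (by positivity)]
  simp only [intervalIntegral.integral_const, smul_eq_mul, div_one]
  rw [one_div, Real.log_inv]
  field_simp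
  ring

lemma intervalIntegrable_indicator_Iio (c a b : ℝ) :
    IntervalIntegrable ((Iio c).indicator fun _ => (1 : ℝ)) volume a b := by
  rw [intervalIntegrable_iff]
  exact (integrableOn_const (by simp)).indicator measurableSet_Iio

lemma integral_indicator_Iio {c b : ℝ} (hc : 0 ≤ c) (hcb : c ≤ b) :
    ∫ m in (0 : ℝ)..b, (Iio c).indicator (fun _ => (1 : ℝ)) m = c := by
  have hb : 0 ≤ b := hc.trans hcb
  rw [← intervalIntegral.integral_add_adjacent_intervals (b := c)
    (intervalIntegrable_indicator_Iio c 0 c) (intervalIntegrable_indicator_Iio c c b)]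
  have h2 : ∫ m in c..b, (Iio c).indicator (fun _ => (1 : ℝ)) m = 0 := by
    rw [intervalIntegral.integral_congr (g := fun _ => (0 : ℝ))]
    · simp
    · intro m hm
      rw [uIcc_of_le hcb] at hm
      simp [Set.indicator, not_lt.2 hm.1]
  have h1 : ∫ m in (0 : ℝ)..c, (Iio c).indicator (fun _ => (1 : ℝ)) m = c := by
    rw [intervalIntegral.integral_of_le hc, integral_Ioc_eq_integral_Ioo,
      setIntegral_congr_fun (g := fun _ => (1 : ℝ)) measurableSet_Ioo]
    · simp [hc]
    · intro m hm
      exact Set.indicator_of_mem (show m ∈ Iio c from hm.2) _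
  rw [h1, h2, add_zero]

open Classical in
/-- Equidistribution over intervals, integrated against `1 / t` on `(z, 1)`. -/
lemma abs_sum_div_sub_le {ι : Type*} (T : Finset ι) (a : ι → ℝ) (q : ι → ℕ) (t : ι → ℝ)
    (ht0 : ∀ v ∈ T, 0 < t v) (ht1 : ∀ v ∈ T, t v < 1) (N : ℕ) (M E : ℝ)
    (hE : ∀ n, n ≤ N → ∀ x y, 0 ≤ x → x ≤ y → y ≤ 1 →
      |∑ v ∈ T.filter fun v => q v ≤ n ∧ x < t v ∧ t v < y, a v - (y - x) * M * n| ≤ E)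
    (n : ℕ) (hn : n ≤ N) (z : ℝ) (hz : 0 < z) (hz1 : z ≤ 1) :
    |∑ v ∈ T.filter fun v => q v ≤ n ∧ z < t v, a v / t v - (-Real.log z) * (M * n)| ≤ E / z := by
  obtain ⟨i1, e1⟩ := integral_min_one_div_sub hz hz1
  have h1z : 1 ≤ 1 / z := by rw [le_div_iff₀ hz]; linarith
  have hsum : ∑ v ∈ T.filter fun v => q v ≤ n ∧ z < t v, a v / t v =
      ∫ m in (0 : ℝ)..(1 / z), ∑ v ∈ T.filter fun v => q v ≤ n ∧ z < t v,
        a v * (Iio (1 / t v)).indicator (fun _ => (1 : ℝ)) m := by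
    rw [intervalIntegral.integral_finsetSum]
    · refine Finset.sum_congr rfl fun v hv => ?_
      rw [Finset.mem_filter] at hv
      have h0 := ht0 v hv.1
      rw [intervalIntegral.integral_const_mul, integral_indicator_Iio (by positivity)
        (one_div_le_one_div_of_le hz hv.2.2.le)]
      ring
    · intro v _
      exact (intervalIntegrable_indicator_Iio _ _ _).const_mul _
  have h_int : IntervalIntegrable (fun m => ∑ v ∈ T.filter fun v => q v ≤ n ∧ z < t v,
        a v * (Iio (1 / t v)).indicator (fun _ => (1 : ℝ)) m) volume 0 (1 / z) :=
    by
    simpa only [Finset.sum_fn] using IntervalIntegrable.sum _ fun v _ =>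
      (intervalIntegrable_indicator_Iio (1 / t v) 0 (1 / z)).const_mul (a v)
  rw [hsum, ← e1, ← intervalIntegral.integral_mul_const, ← intervalIntegral.integral_sub h_int
    (i1.mul_const _), ← Real.norm_eq_abs]
  refine (intervalIntegral.norm_integral_le_of_norm_le_const (C := E) ?_).trans (le_of_eq ?_)
  · intro m hm
    rw [uIoc_of_le (by positivity)] at hm
    have hmz : z ≤ 1 / m := by
      rw [le_div_iff₀ hm.1]
      have := hm.2
      rw [le_div_iff₀ hz] at this
      linarith
    rw [Real.norm_eq_abs]
    refine le_trans (le_of_eq ?_) (hE n hn z (min 1 (1 / m)) hz.le (le_min hz1 hmz) (min_le_left _ _))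
    congr 1
    have e2 : ∑ v ∈ T.filter fun v => q v ≤ n ∧ z < t v,
        a v * (Iio (1 / t v)).indicator (fun _ => (1 : ℝ)) m =
        ∑ v ∈ T.filter fun v => q v ≤ n ∧ z < t v ∧ t v < min 1 (1 / m), a v := by
      have : (T.filter fun v => q v ≤ n ∧ z < t v ∧ t v < min 1 (1 / m)) =
          (T.filter fun v => q v ≤ n ∧ z < t v).filter fun v => m < 1 / t v := by
        ext v
        simp only [Finset.mem_filter]
        constructor
        · rintro ⟨h1, h2, h3, h4⟩
          refine ⟨⟨h1, h2, h3⟩, ?_⟩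
          have := h4.trans_le (min_le_right _ _)
          rw [lt_div_iff₀ hm.1] at this
          rw [lt_div_iff₀ (ht0 v h1)]
          linarith
        · rintro ⟨⟨h1, h2, h3⟩, h4⟩
          refine ⟨h1, h2, h3, lt_min (ht1 v h1) ?_⟩
          rw [lt_div_iff₀ (ht0 v h1)] at h4
          rw [lt_div_iff₀ hm.1]
          linarith
      rw [this, Finset.sum_filter (fun v => m < 1 / t v)]
      refine Finset.sum_congr rfl fun v _ => ?_
      by_cases h : m < 1 / t v
      · rw [if_pos h, Set.indicator_of_mem (by exact h), mul_one]
      · rw [if_neg h, Set.indicator_of_notMem (by exact h), mul_zero]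
    rw [e2]
    ring
  · rw [sub_zero, abs_of_pos (by positivity)]
    ring

lemma exists_nat_cutoff {ε lam : ℝ} (hε : 0 < ε) (hlam : 0 < lam) {ξ : ℝ} (hξ : 0 < ξ) :
    ∃ n : ℕ, n ≤ ⌊lam / ε⌋₊ ∧ |ε * n - min lam ξ| ≤ ε ∧
      ∀ k : ℕ, k ≤ ⌊lam / ε⌋₊ → (ε * k < ξ ↔ k ≤ n) := by
  have hc : 0 < ⌈ξ / ε⌉₊ := Nat.ceil_pos.2 (by positivity)
  have hk : ∀ k : ℕ, ε * k < ξ ↔ k ≤ ⌈ξ / ε⌉₊ - 1 := by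
    intro k
    have : ε * k < ξ ↔ (k : ℝ) < ξ / ε := by rw [lt_div_iff₀ hε, mul_comm]
    rw [this, ← Nat.lt_ceil]; omega
  have hN1 : ε * ⌊lam / ε⌋₊ ≤ lam := by
    have := Nat.floor_le (by positivity : 0 ≤ lam / ε)
    rw [le_div_iff₀ hε] at this; linarith
  have hN2 : lam < ε * ⌊lam / ε⌋₊ + ε := by
    have := Nat.lt_floor_add_one (lam / ε)
    rw [div_lt_iff₀ hε] at this; linarith
  have hc1 : ε * (⌈ξ / ε⌉₊ - 1 : ℕ) < ξ := (hk _).2 le_rfl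
  have hc2 : ξ ≤ ε * (⌈ξ / ε⌉₊ - 1 : ℕ) + ε := by
    have := not_lt.1 (mt (hk ⌈ξ / ε⌉₊).1 (by omega))
    rw [Nat.cast_sub (by omega)]; push_cast; linarith
  refine ⟨min ⌊lam / ε⌋₊ (⌈ξ / ε⌉₊ - 1), min_le_left _ _, ?_, fun k hkN => ?_⟩
  · rw [Nat.cast_min, mul_min_of_nonneg _ _ hε.le]
    refine (abs_min_sub_min_le_max _ _ _ _).trans (max_le ?_ ?_) <;> rw [abs_le] <;>
      constructor <;> linarith
  · rw [hk k]; exact ⟨fun h => le_min hkN h, fun h => h.trans (min_le_right _ _)⟩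

/-- The integral over `0 < y < t` of `1 / t` along the superlevel set `x < ξ y`. -/
noncomputable def levelInt (ξ : ℝ → ℝ) (x t : ℝ) : ℝ :=
  ∫ y in (0 : ℝ)..1, {y | x < ξ y ∧ y < t}.indicator (fun _ => 1 / t) y

lemma intervalIntegrable_levelInt {ξ : ℝ → ℝ} (hξ : Measurable ξ) (x t : ℝ) :
    IntervalIntegrable ({y | x < ξ y ∧ y < t}.indicator fun _ => 1 / t) volume 0 1 := by
  rw [intervalIntegrable_iff]
  exact (integrableOn_const (by simp)).indicator
    ((measurableSet_lt measurable_const hξ).inter measurableSet_Iio)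

lemma intervalIntegral_log_max {η : ℝ} (h0 : 0 < η) (h1 : η ≤ 1) :
    IntervalIntegrable (fun y => Real.log (max y η) - Real.log y) volume 0 1 ∧
      ∫ y in (0 : ℝ)..1, (Real.log (max y η) - Real.log y) = η := by
  have e1 : EqOn (fun y => Real.log (max y η) - Real.log y) (fun y => Real.log η - Real.log y)
      (uIoc 0 η) := by
    intro y hy
    rw [uIoc_of_le h0.le] at hy
    simp only [max_eq_right hy.2]
  have e2 : EqOn (fun y => Real.log (max y η) - Real.log y) (fun _ => 0) (uIoc η 1) := by
    intro y hy
    rw [uIoc_of_le h1] at hy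
    simp only [max_eq_left hy.1.le, sub_self]
  have i0 : IntervalIntegrable Real.log volume 0 η := intervalIntegral.intervalIntegrable_log'
  have i1 : IntervalIntegrable (fun y => Real.log (max y η) - Real.log y) volume 0 η :=
    IntervalIntegrable.congr e1.symm (IntervalIntegrable.sub (by simp) i0)
  have i2 : IntervalIntegrable (fun y => Real.log (max y η) - Real.log y) volume η 1 :=
    IntervalIntegrable.congr e2.symm (by simp)
  refine ⟨i1.trans i2, ?_⟩
  rw [← intervalIntegral.integral_add_adjacent_intervals i1 i2,
    intervalIntegral.integral_congr_ae (ae_of_all _ e1),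
    intervalIntegral.integral_congr_ae (ae_of_all _ e2),
    intervalIntegral.integral_sub (by simp) i0, integral_log]
  simp

lemma intervalIntegral_one_div_max {η : ℝ} (h0 : 0 < η) (h1 : η ≤ 1) :
    IntervalIntegrable (fun y => 1 / max y η) volume 0 1 ∧
      ∫ y in (0 : ℝ)..1, 1 / max y η = 1 - Real.log η := by
  have hc : Continuous fun y => 1 / max y η :=
    continuous_const.div (by fun_prop) fun y => (h0.trans_le (le_max_right _ _)).ne'
  refine ⟨hc.intervalIntegrable _ _, ?_⟩
  rw [← intervalIntegral.integral_add_adjacent_intervals (hc.intervalIntegrable 0 η)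
    (hc.intervalIntegrable η 1),
    intervalIntegral.integral_congr (g := fun _ => 1 / η) (a := 0) (b := η),
    intervalIntegral.integral_congr (g := fun y => 1 / y) (a := η) (b := 1),
    integral_one_div_of_pos h0 one_pos]
  · simp [h0.ne', sub_eq_add_neg]
  · intro y hy
    rw [uIcc_of_le h1] at hy
    simp only [max_eq_left hy.1]
  · intro y hy
    rw [uIcc_of_le h0.le] at hy
    simp only [max_eq_right hy.2]

lemma intervalIntegrable_min_mul_log {ξ : ℝ → ℝ} (hξ : Measurable ξ) {lam : ℝ} (hlam : 0 < lam)
    (hpos : ∀ y ∈ Ioo (0 : ℝ) 1, 0 < ξ y) :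
    IntervalIntegrable (fun y => min lam (ξ y) * (-Real.log y)) volume 0 1 := by
  have i0 : IntervalIntegrable Real.log volume 0 1 := intervalIntegral.intervalIntegrable_log'
  refine (i0.neg.const_mul lam).mono_fun
    ((measurable_const.min hξ).mul Real.measurable_log.neg).aestronglyMeasurable ?_
  rw [uIoc_of_le zero_le_one, Measure.restrict_congr_set Ioo_ae_eq_Ioc.symm]
  filter_upwards [ae_restrict_mem measurableSet_Ioo] with y hy
  have := hpos y hy
  rw [norm_mul, norm_mul]
  refine mul_le_mul_of_nonneg_right ?_ (norm_nonneg _)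
  rw [Real.norm_eq_abs, Real.norm_eq_abs, abs_of_pos (lt_min hlam this), abs_of_pos hlam]
  exact min_le_left _ _

open Classical in
/-- Equidistribution of `t v` at every scale `q v ≤ n` gives the asymptotics of a weighted sum
over a region described by the superlevel sets of `ξ`. -/
lemma abs_sum_levelInt_sub_le {ι : Type*} (T : Finset ι) (a : ι → ℝ) (q : ι → ℕ) (t : ι → ℝ)
    {ε lam η : ℝ} (hε : 0 < ε) (hlam : 0 < lam) (hη0 : 0 < η) (hη1 : η ≤ 1)
    (ht0 : ∀ v ∈ T, η < t v) (ht1 : ∀ v ∈ T, t v < 1) (hq : ∀ v ∈ T, q v ≤ ⌊lam / ε⌋₊)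
    (M E : ℝ)
    (hE : ∀ n, n ≤ ⌊lam / ε⌋₊ → ∀ x y, 0 ≤ x → x ≤ y → y ≤ 1 →
      |∑ v ∈ T.filter fun v => q v ≤ n ∧ x < t v ∧ t v < y, a v - (y - x) * M * n| ≤ E)
    {ξ : ℝ → ℝ} (hξ : Measurable ξ) (hpos : ∀ y ∈ Ioo (0 : ℝ) 1, 0 < ξ y) :
    |ε * ∑ v ∈ T, a v * levelInt ξ (ε * q v) (t v) -
      M * ∫ y in (0 : ℝ)..1, min lam (ξ y) * (-Real.log y)| ≤
      ε * E * (1 - Real.log η) + ε * |M| + lam * |M| * η := by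
  obtain ⟨j1, f1⟩ := intervalIntegral_one_div_max hη0 hη1
  obtain ⟨j2, f2⟩ := intervalIntegral_log_max hη0 hη1
  have i0 : IntervalIntegrable Real.log volume 0 1 := intervalIntegral.intervalIntegrable_log'
  have j3 : IntervalIntegrable (fun y => -Real.log y) volume 0 1 := i0.neg
  have f3 : ∫ y in (0 : ℝ)..1, -Real.log y = 1 := by
    rw [intervalIntegral.integral_neg, integral_log]; simp
  have hsum : ε * ∑ v ∈ T, a v * levelInt ξ (ε * q v) (t v) = ∫ y in (0 : ℝ)..1, ε * ∑ v ∈ T,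
      a v * {y | ε * q v < ξ y ∧ y < t v}.indicator (fun _ => 1 / t v) y := by
    rw [intervalIntegral.integral_const_mul, intervalIntegral.integral_finsetSum]
    · simp only [levelInt, intervalIntegral.integral_const_mul]
    · intro v _
      exact (intervalIntegrable_levelInt hξ _ _).const_mul _
  have h_int : IntervalIntegrable (fun y => ε * ∑ v ∈ T,
      a v * {y | ε * q v < ξ y ∧ y < t v}.indicator (fun _ => 1 / t v) y) volume 0 1 := by
    refine IntervalIntegrable.const_mul ?_ _
    simpa only [Finset.sum_fn] using IntervalIntegrable.sum _ fun v _ =>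
      (intervalIntegrable_levelInt hξ (ε * q v) (t v)).const_mul (a v)
  have hR : ε * E * (1 - Real.log η) + ε * |M| + lam * |M| * η = ∫ y in (0 : ℝ)..1,
      (ε * E * (1 / max y η) + ε * |M| * (-Real.log y) +
        lam * |M| * (Real.log (max y η) - Real.log y)) := by
    rw [intervalIntegral.integral_add ((j1.const_mul _).add (j3.const_mul _)) (j2.const_mul _),
      intervalIntegral.integral_add (j1.const_mul _) (j3.const_mul _)]
    simp only [intervalIntegral.integral_const_mul]
    rw [f1, f2, f3, mul_one]
  rw [hsum, hR, ← intervalIntegral.integral_const_mul, ← intervalIntegral.integral_sub h_int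
    ((intervalIntegrable_min_mul_log hξ hlam hpos).const_mul _), ← Real.norm_eq_abs]
  refine intervalIntegral.norm_integral_le_of_norm_le zero_le_one ?_
    (((j1.const_mul _).add (j3.const_mul _)).add (j2.const_mul _))
  have hne : ∀ᵐ y : ℝ, y ≠ 1 := by simp [ae_iff, measure_singleton]
  filter_upwards [hne] with y hy1 hy
  have hy : y ∈ Ioo (0 : ℝ) 1 := ⟨hy.1, lt_of_le_of_ne hy.2 hy1⟩
  obtain ⟨n, hn, hn1, hn2⟩ := exists_nat_cutoff hε hlam (hpos y hy)
  have hz0 : 0 < max y η := lt_max_of_lt_right hη0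
  have hz1 : max y η ≤ 1 := max_le hy.2.le hη1
  have key := abs_sum_div_sub_le T a q t (fun v hv => hη0.trans (ht0 v hv)) ht1 ⌊lam / ε⌋₊ M E hE
    n hn (max y η) hz0 hz1
  have e : ∑ v ∈ T, a v * {y | ε * q v < ξ y ∧ y < t v}.indicator (fun _ => 1 / t v) y =
      ∑ v ∈ T.filter fun v => q v ≤ n ∧ max y η < t v, a v / t v := by
    rw [Finset.sum_filter]
    refine Finset.sum_congr rfl fun v hv => ?_
    have : (q v ≤ n ∧ max y η < t v) ↔ y ∈ {y | ε * q v < ξ y ∧ y < t v} := by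
      rw [← hn2 _ (hq v hv), max_lt_iff]
      simp [ht0 v hv]
    by_cases h : y ∈ {y | ε * q v < ξ y ∧ y < t v}
    · rw [if_pos (this.2 h), Set.indicator_of_mem h, mul_one_div]
    · rw [if_neg (mt this.1 h), Set.indicator_of_notMem h, mul_zero]
  rw [e]
  set S := ∑ v ∈ T.filter fun v => q v ≤ n ∧ max y η < t v, a v / t v
  set z := max y η
  have hlz : Real.log z ≤ 0 := Real.log_nonpos hz0.le hz1
  have hlyz : Real.log y ≤ Real.log z := Real.log_le_log hy.1 (le_max_left _ _)
  set m := min lam (ξ y)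
  have hm0 : 0 < m := lt_min hlam (hpos y hy)
  have hm1 : m ≤ lam := min_le_left _ _
  have a1 : |ε * (S - -Real.log z * (M * n))| ≤ ε * E * (1 / z) := by
    rw [abs_mul, abs_of_pos hε, mul_assoc, mul_one_div]
    exact mul_le_mul_of_nonneg_left key hε.le
  have a2 : |M * (-Real.log z) * (ε * n - m)| ≤ |M| * (-Real.log y) * ε := by
    rw [abs_mul, abs_mul, abs_of_nonneg (by linarith : 0 ≤ -Real.log z)]
    exact mul_le_mul (by gcongr) hn1 (abs_nonneg _) (mul_nonneg (abs_nonneg M) (by linarith))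
  have a3 : |m * M * (Real.log z - Real.log y)| ≤ lam * |M| * (Real.log z - Real.log y) := by
    rw [abs_mul, abs_mul, abs_of_nonneg (sub_nonneg.2 hlyz), abs_of_pos hm0]
    have := sub_nonneg.2 hlyz
    gcongr
  rw [Real.norm_eq_abs]
  rw [abs_le] at a1 a2 a3 ⊢
  constructor <;> nlinarith

end LayerCake

section CompanionSums

lemma one_le_equidistError {δ : ℝ} (hδ : 0 < δ) {Y : ℝ} (hY : 0 < Y) (hY1 : Y ≤ 1) {n : ℕ}
    (hn : 1 ≤ n) : 1 ≤ equidistError δ Y n := by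
  have h1 : 1 ≤ (n : ℝ) ^ δ := Real.one_le_rpow (by exact_mod_cast hn) hδ.le
  have h2 := Real.log_natCast_nonneg n
  refine le_trans ?_ (rpow_mul_log_le_equidistError hY hY1 n)
  exact one_le_mul_of_one_le_of_one_le h1 (by linarith)

open Classical in
lemma abs_sum_filter_companions_sub_le {l : ℕ} (hl : 2 ≤ l) {δ : ℝ} (hδ : 0 < δ) :
    ∃ C : ℝ, 0 < C ∧ ∀ (α β Y : ℝ) (N : ℕ) (σ : ℤ), α ≤ β → β - α ≤ Y → 0 < Y → Y ≤ 1 →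
      (σ = 1 ∨ σ = -1) → ∀ n ≤ N, ∀ x y : ℝ, 0 ≤ x → x ≤ y → y ≤ 1 →
      |∑ v ∈ (companions l α β σ N).filter fun v => v.1 ≤ n ∧ x < v.2.2 / v.1 ∧
        (v.2.2 : ℝ) / v.1 < y, (1 : ℝ) / v.1 -
        (y - x) * ((1 / zeta2 - Cconst l / l) * (β - α)) * n| ≤ C * equidistError δ Y N := by
  obtain ⟨C, hC, h⟩ := abs_sum_compSet_ne_sub_le (l := l) (by omega) hδ
  refine ⟨C, hC, ?_⟩
  intro α β Y N σ hαβ hY hY0 hY1 hσ n hn x y hx hxy hy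
  rcases Nat.eq_zero_or_pos n with rfl | hn0
  · rw [Finset.sum_eq_zero]
    · simpa using mul_nonneg hC.le (equidistError_nonneg δ hY0.le N)
    · intro v hv
      rw [Finset.mem_filter] at hv
      simp [Nat.le_zero.1 hv.2.1]
  · rw [filter_companions_eq l α β σ hn hx hy]
    exact (h α β Y n σ x y hαβ hY hY0 hY1 hn0 hσ hx hxy hy).trans
      (mul_le_mul_of_nonneg_left (equidistError_mono hδ hY0.le hn0 hn) hC.le)

open Classical in
lemma abs_sum_filter_divCompanions_sub_le {l : ℕ} (hl : 2 ≤ l) {δ : ℝ} (hδ : 0 < δ) :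
    ∃ C : ℝ, 0 < C ∧ ∀ (α β Y : ℝ) (N : ℕ) (σ : ℤ), α ≤ β → β - α ≤ Y → 0 < Y → Y ≤ 1 →
      (σ = 1 ∨ σ = -1) → ∀ n ≤ N, ∀ x y : ℝ, 0 ≤ x → x ≤ y → y ≤ 1 →
      |∑ v ∈ (divCompanions l α β σ N).filter fun v => v.1 ≤ n ∧ x < v.2.2 / v.1 ∧
        (v.2.2 : ℝ) / v.1 < y, (1 : ℝ) / v.1 -
        (y - x) * (Cconst l / l * (β - α)) * n| ≤ C * equidistError δ Y N := by
  obtain ⟨C, hC, h⟩ := abs_sum_compSet_eq_zero_sub_le (l := l) (by omega) hδ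
  refine ⟨C, hC, ?_⟩
  intro α β Y N σ hαβ hY hY0 hY1 hσ n hn x y hx hxy hy
  rcases Nat.eq_zero_or_pos n with rfl | hn0
  · rw [Finset.sum_eq_zero]
    · simpa using mul_nonneg hC.le (equidistError_nonneg δ hY0.le N)
    · intro v hv
      rw [Finset.mem_filter] at hv
      simp [Nat.le_zero.1 hv.2.1]
  · rw [sum_filter_divCompanions_eq hl α β hσ hn hx hy]
    exact (h α β Y n σ x y hαβ hY hY0 hY1 hn0 hσ hx hxy hy).trans
      (mul_le_mul_of_nonneg_left (equidistError_mono hδ hY0.le hn0 hn) hC.le)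

lemma div_mem_of_mem_companions {l : ℕ} {α β : ℝ} {σ : ℤ} {N : ℕ} {v : Σ _ : ℕ, ℤ × ℤ}
    (hv : v ∈ companions l α β σ N) :
    1 ≤ v.1 ∧ v.1 ≤ N ∧ (1 : ℝ) / v.1 ≤ v.2.2 / v.1 ∧ (1 : ℝ) / v.1 ≤ 1 - v.2.2 / v.1 := by
  rw [companions, mem_compSet] at hv
  obtain ⟨h1, ⟨_, _, h2⟩, _, _, h3, _⟩ := hv
  have h0 : (0 : ℝ) < v.1 := by exact_mod_cast h1.1
  rw [zero_mul] at h3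
  have h4 : (1 : ℝ) ≤ v.2.2 := by exact_mod_cast (by exact_mod_cast h3 : (0 : ℤ) < v.2.2)
  have h5 : (v.2.2 : ℝ) + 1 ≤ v.1 := by exact_mod_cast h2
  refine ⟨h1.1, h1.2, by gcongr, ?_⟩
  rw [one_sub_div h0.ne']
  gcongr
  linarith

open Classical in
lemma abs_sum_levelInt_sub_le_mul_log (T : Finset (Σ _ : ℕ, ℤ × ℤ)) (t : (Σ _ : ℕ, ℤ × ℤ) → ℝ)
    {ε lam : ℝ} (hε : 0 < ε) (hεl : ε ≤ lam)
    (hT : ∀ v ∈ T, 1 ≤ v.1 ∧ v.1 ≤ ⌊lam / ε⌋₊ ∧ (1 : ℝ) / v.1 ≤ t v ∧ (1 : ℝ) / v.1 ≤ 1 - t v)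
    {M B E : ℝ} (hM : |M| ≤ B) (hE1 : 1 ≤ E)
    (hE : ∀ n, n ≤ ⌊lam / ε⌋₊ → ∀ x y, 0 ≤ x → x ≤ y → y ≤ 1 →
      |∑ v ∈ T.filter fun v => v.1 ≤ n ∧ x < t v ∧ t v < y, (1 : ℝ) / v.1 - (y - x) * M * n| ≤ E)
    {ξ : ℝ → ℝ} (hξ : Measurable ξ) (hpos : ∀ y ∈ Ioo (0 : ℝ) 1, 0 < ξ y) :
    |∑ v ∈ T, ε / v.1 * levelInt ξ (ε * v.1) (t v) -
      M * ∫ y in (0 : ℝ)..1, min lam (ξ y) * (-Real.log y)| ≤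
      (1 + B) * (ε * E * (2 + Real.log ⌊lam / ε⌋₊)) := by
  set N := ⌊lam / ε⌋₊ with hN
  have hlam : 0 < lam := hε.trans_le hεl
  have hN1 : 1 ≤ N := by rw [hN, Nat.one_le_floor_iff, le_div_iff₀ hε]; linarith
  have hN1' : (1 : ℝ) ≤ N := by exact_mod_cast hN1
  have hN2 : lam < ε * N + ε := by
    have := Nat.lt_floor_add_one (lam / ε)
    rw [div_lt_iff₀ hε] at this; linarith
  have hlog := Real.log_natCast_nonneg N
  have key := abs_sum_levelInt_sub_le T (fun v => (1 : ℝ) / v.1) (fun v => v.1) t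
    (η := 1 / (2 * N)) hε hlam (by positivity) (by rw [div_le_one (by positivity)]; linarith)
    ?_ ?_ (fun v hv => (hT v hv).2.1) M E hE hξ hpos
  · rw [Finset.mul_sum] at key
    have e : ∀ v ∈ T, ε * ((1 : ℝ) / v.1 * levelInt ξ (ε * v.1) (t v)) =
        ε / v.1 * levelInt ξ (ε * v.1) (t v) := fun v _ => by ring
    rw [Finset.sum_congr rfl e] at key
    refine key.trans ?_
    have h1 : -Real.log (1 / (2 * N)) ≤ 1 + Real.log N := by
      rw [one_div, Real.log_inv, Real.log_mul two_ne_zero (by positivity)]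
      have := Real.log_two_lt_d9
      linarith
    have h2 : lam * |M| * (1 / (2 * N)) ≤ ε * |M| := by
      have : lam / (2 * N) ≤ ε := by
        rw [div_le_iff₀ (by positivity)]; nlinarith
      calc _ = lam / (2 * N) * |M| := by ring
        _ ≤ _ := by gcongr
    have h3 : ε * E * (1 - Real.log (1 / (2 * N))) ≤ ε * E * (2 + Real.log N) := by
      gcongr; linarith
    have hB : 0 ≤ B := (abs_nonneg M).trans hM
    have h4 : ε * |M| ≤ ε * B := by gcongr
    have h5 : 2 ≤ E * (2 + Real.log N) := by nlinarith
    have h6 : 2 * (ε * B) ≤ (E * (2 + Real.log N)) * (ε * B) := by gcongr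
    linarith
  · intro v hv
    obtain ⟨h1, h2, h3, -⟩ := hT v hv
    have h0 : (0 : ℝ) < v.1 := by exact_mod_cast h1
    have h2' : (v.1 : ℝ) ≤ N := by exact_mod_cast h2
    refine lt_of_lt_of_le ?_ h3
    apply one_div_lt_one_div_of_lt h0; linarith
  · intro v hv
    obtain ⟨h1, _, _, h4⟩ := hT v hv
    have h0 : (0 : ℝ) < v.1 := by exact_mod_cast h1
    have : (0 : ℝ) < 1 / v.1 := by positivity
    linarith

/-- The limiting density `∫₀¹ min(λ, ξ(y)) (-log y) dy`. -/
noncomputable def levelMean (ξ : ℝ → ℝ) (lam : ℝ) : ℝ :=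
  ∫ y in (0 : ℝ)..1, min lam (ξ y) * (-Real.log y)

open Classical in
lemma abs_filter_reflect_le {T : Finset (Σ _ : ℕ, ℤ × ℤ)} {t : (Σ _ : ℕ, ℤ × ℤ) → ℝ}
    {N : ℕ} {M E : ℝ}
    (hE : ∀ n, n ≤ N → ∀ x y, 0 ≤ x → x ≤ y → y ≤ 1 →
      |∑ v ∈ T.filter fun v => v.1 ≤ n ∧ x < t v ∧ t v < y, (1 : ℝ) / v.1 - (y - x) * M * n| ≤ E)
    (n : ℕ) (hn : n ≤ N) (x y : ℝ) (hx : 0 ≤ x) (hxy : x ≤ y) (hy : y ≤ 1) :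
    |∑ v ∈ T.filter fun v => v.1 ≤ n ∧ x < 1 - t v ∧ 1 - t v < y, (1 : ℝ) / v.1 -
      (y - x) * M * n| ≤ E := by
  have h := hE n hn (1 - y) (1 - x) (by linarith) (by linarith) (by linarith)
  have e : (T.filter fun v => v.1 ≤ n ∧ 1 - y < t v ∧ t v < 1 - x) =
      T.filter fun v => v.1 ≤ n ∧ x < 1 - t v ∧ 1 - t v < y := by
    refine Finset.filter_congr fun v _ => ?_
    constructor <;> rintro ⟨h1, h2, h3⟩ <;> exact ⟨h1, by linarith, by linarith⟩
  rw [e] at h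
  convert! h using 3
  ring

/-- The weighted sums over companions that occur in the measure of the free set. -/
lemma abs_sum_companions_levelInt_sub_le {l : ℕ} (hl : 2 ≤ l) {δ : ℝ} (hδ : 0 < δ) :
    ∃ C : ℝ, 0 < C ∧ ∀ (α β Y ε lam : ℝ) (σ : ℤ), α ≤ β → β - α ≤ Y → 0 < Y → Y ≤ 1 →
      (σ = 1 ∨ σ = -1) → 0 < ε → ε ≤ lam → ∀ ξ : ℝ → ℝ, Measurable ξ →
      (∀ y ∈ Ioo (0 : ℝ) 1, 0 < ξ y) →
      |∑ v ∈ companions l α β σ ⌊lam / ε⌋₊, ε / v.1 * levelInt ξ (ε * v.1) (v.2.2 / v.1) -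
        (1 / zeta2 - Cconst l / l) * (β - α) * levelMean ξ lam| ≤
        C * (ε * equidistError δ Y ⌊lam / ε⌋₊ * (2 + Real.log ⌊lam / ε⌋₊)) ∧
      |∑ v ∈ divCompanions l α β σ ⌊lam / ε⌋₊, ε / v.1 * levelInt ξ (ε * v.1) (v.2.2 / v.1) -
        Cconst l / l * (β - α) * levelMean ξ lam| ≤
        C * (ε * equidistError δ Y ⌊lam / ε⌋₊ * (2 + Real.log ⌊lam / ε⌋₊)) ∧
      |∑ v ∈ divCompanions l α β σ ⌊lam / ε⌋₊, ε / v.1 * levelInt ξ (ε * v.1) (1 - v.2.2 / v.1) -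
        Cconst l / l * (β - α) * levelMean ξ lam| ≤
        C * (ε * equidistError δ Y ⌊lam / ε⌋₊ * (2 + Real.log ⌊lam / ε⌋₊)) := by
  classical
  obtain ⟨C₁, hC₁, h₁⟩ := abs_sum_filter_companions_sub_le hl hδ
  obtain ⟨C₂, hC₂, h₂⟩ := abs_sum_filter_divCompanions_sub_le hl hδ
  set B := |1 / zeta2 - Cconst l / l| + |Cconst l / l| with hB
  have hB0 : 0 ≤ B := by positivity
  refine ⟨(1 + B) * (1 + C₁ + C₂), by positivity, ?_⟩
  intro α β Y ε lam σ hαβ hY hY0 hY1 hσ hε hεl ξ hξ hpos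
  set N := ⌊lam / ε⌋₊ with hN
  have hN1 : 1 ≤ N := by rw [hN, Nat.one_le_floor_iff, le_div_iff₀ hε]; linarith
  have e1 := one_le_equidistError hδ hY0 hY1 hN1
  set Q := equidistError δ Y N
  have hE1 : 1 ≤ (1 + C₁ + C₂) * Q := by nlinarith
  have m0 : |β - α| ≤ 1 := by rw [abs_le]; constructor <;> linarith
  have m1 : |(1 / zeta2 - Cconst l / l) * (β - α)| ≤ B := by
    rw [abs_mul]
    exact (mul_le_of_le_one_right (abs_nonneg _) m0).trans (by rw [hB]; simp)
  have m2 : |Cconst l / l * (β - α)| ≤ B := by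
    rw [abs_mul]
    exact (mul_le_of_le_one_right (abs_nonneg _) m0).trans (by rw [hB]; simp)
  have f1 : ∀ n ≤ N, ∀ x y : ℝ, 0 ≤ x → x ≤ y → y ≤ 1 → _ := fun n hn x y hx hxy hy =>
    (h₁ α β Y N σ hαβ hY hY0 hY1 hσ n hn x y hx hxy hy).trans
      (by nlinarith : C₁ * Q ≤ (1 + C₁ + C₂) * Q)
  have f2 : ∀ n ≤ N, ∀ x y : ℝ, 0 ≤ x → x ≤ y → y ≤ 1 → _ := fun n hn x y hx hxy hy =>
    (h₂ α β Y N σ hαβ hY hY0 hY1 hσ n hn x y hx hxy hy).trans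
      (by nlinarith : C₂ * Q ≤ (1 + C₁ + C₂) * Q)
  have e2 : (1 + B) * (1 + C₁ + C₂) * (ε * Q * (2 + Real.log N)) =
      (1 + B) * (ε * ((1 + C₁ + C₂) * Q) * (2 + Real.log N)) := by ring
  have hsub : ∀ v ∈ divCompanions l α β σ N, v ∈ companions l α β σ N := by
    intro v hv
    rw [divCompanions, Finset.mem_filter] at hv
    exact hv.1
  rw [e2]
  refine ⟨?_, ?_, ?_⟩
  · exact abs_sum_levelInt_sub_le_mul_log _ (fun v => v.2.2 / v.1) hε hεl
      (fun v hv => div_mem_of_mem_companions hv) m1 hE1 f1 hξ hpos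
  · exact abs_sum_levelInt_sub_le_mul_log _ (fun v => v.2.2 / v.1) hε hεl
      (fun v hv => div_mem_of_mem_companions (hsub v hv)) m2 hE1 f2 hξ hpos
  · refine abs_sum_levelInt_sub_le_mul_log _ (fun v => 1 - v.2.2 / v.1) hε hεl
      (fun v hv => ?_) m2 hE1 (abs_filter_reflect_le (t := fun v => v.2.2 / v.1) f2) hξ hpos
    obtain ⟨a1, a2, a3, a4⟩ := div_mem_of_mem_companions (hsub v hv)
    exact ⟨a1, a2, a4, by linarith⟩

end CompanionSums

section StripVolume

lemma volume_real_Icc_inter_Ioo (a b c d : ℝ) :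
    volume.real (Icc a b ∩ Ioo c d) = max 0 (min b d - max a c) := by
  have h1 : Ioo (max a c) (min b d) ⊆ Icc a b ∩ Ioo c d := fun x hx =>
    ⟨⟨(max_lt_iff.1 hx.1).1.le, (lt_min_iff.1 hx.2).1.le⟩, (max_lt_iff.1 hx.1).2,
      (lt_min_iff.1 hx.2).2⟩
  have h2 : Icc a b ∩ Ioo c d ⊆ Icc (max a c) (min b d) := fun x hx =>
    ⟨max_le hx.1.1 hx.2.1.le, le_min hx.1.2 hx.2.2.le⟩
  have h3 := measure_mono (μ := volume) h1
  have h4 := measure_mono (μ := volume) h2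
  rw [Real.volume_Ioo] at h3
  rw [Real.volume_Icc] at h4
  rw [measureReal_def, le_antisymm h4 h3, ENNReal.toReal_ofReal', max_comm]

lemma levelInt_one_div_one_add {x t : ℝ} (hx : 0 < x) (ht1 : t < 1) (ht : 0 < t) :
    levelInt (fun y => 1 / (1 + y)) x t = min t (max 0 (1 / x - 1)) / t := by
  set c := min t (max 0 (1 / x - 1)) with hc
  have hc0 : 0 ≤ c := le_min ht.le (le_max_left _ _)
  have hc1 : c ≤ 1 := (min_le_left _ _).trans ht1.le
  rw [levelInt, div_eq_mul_one_div c, ← integral_indicator_Iio hc0 hc1,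
    ← intervalIntegral.integral_mul_const]
  refine intervalIntegral.integral_congr_ae (ae_of_all _ fun y hy => ?_)
  rw [uIoc_of_le zero_le_one] at hy
  have : y ∈ {y | x < 1 / (1 + y) ∧ y < t} ↔ y ∈ Iio c := by
    rw [mem_Iio, hc, lt_min_iff, lt_max_iff, Set.mem_ofPred_eq, and_comm,
      lt_one_div hx (by linarith [hy.1])]
    refine and_congr_right fun _ => ⟨fun h => Or.inr (by linarith), ?_⟩
    rintro (h | h)
    · exact absurd hy.1 h.le.not_gt
    · linarith
  by_cases h : y ∈ Iio c
  · rw [Set.indicator_of_mem h, Set.indicator_of_mem (this.2 h), one_mul]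
  · rw [Set.indicator_of_notMem h, Set.indicator_of_notMem (mt this.1 h), zero_mul]

lemma levelInt_one_div_one_sub {x t : ℝ} (hx : 0 < x) (ht : 0 < t) :
    levelInt (fun y => 1 / (1 - y)) x (1 - t) = max 0 (min (1 - t) (1 / x - t)) / (1 - t) := by
  rw [levelInt, intervalIntegral.integral_of_le zero_le_one, integral_Ioc_eq_integral_Ioo,
    setIntegral_congr_fun (g := (Ioo (1 - 1 / x) (1 - t)).indicator fun _ => 1 / (1 - t))
      measurableSet_Ioo, setIntegral_indicator measurableSet_Ioo, setIntegral_const, smul_eq_mul,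
    Set.Ioo_inter_Ioo, measureReal_def, Real.volume_Ioo, ENNReal.toReal_ofReal', mul_one_div,
    max_comm]
  · congr 2
    have h1 : min 1 (1 - t) = 1 - t := min_eq_right (by linarith)
    rw [h1, ← min_sub_sub_left]
    congr 1 <;> ring
  · intro y hy
    have : y ∈ {y | x < 1 / (1 - y) ∧ y < 1 - t} ↔ y ∈ Ioo (1 - 1 / x) (1 - t) := by
      rw [mem_Ioo, Set.mem_ofPred_eq, lt_one_div hx (by linarith [hy.2])]
      constructor <;> rintro ⟨h1, h2⟩ <;> exact ⟨by linarith, h2⟩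
    by_cases h : y ∈ Ioo (1 - 1 / x) (1 - t)
    · rw [Set.indicator_of_mem h, Set.indicator_of_mem (this.2 h)]
    · rw [Set.indicator_of_notMem h, Set.indicator_of_notMem (mt this.1 h)]

lemma min_div_eq {t r : ℝ} (ht : 0 < t) : min t r / t = min 1 (r / t) := by
  rw [← min_div_div_right ht.le, div_self ht.ne']

lemma max_min_add_min_eq {x t : ℝ} (hx : 0 < x) (ht : 0 < t) (ht1 : t < 1) :
    max 0 (min 1 ((1 / x - 1) / t) + min 1 ((1 / x - 1) / (1 - t))) =
      levelInt (fun y => 1 / (1 + y)) x t + levelInt (fun y => 1 / (1 + y)) x (1 - t) := by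
  have ht' : 0 < 1 - t := by linarith
  rw [levelInt_one_div_one_add hx ht1 ht, levelInt_one_div_one_add hx (by linarith) ht',
    min_div_eq ht, min_div_eq ht']
  rcases le_or_gt 0 (1 / x - 1) with h | h
  · rw [max_eq_right h, max_eq_right]
    exact add_nonneg (le_min zero_le_one (by positivity)) (le_min zero_le_one (by positivity))
  · rw [max_eq_left h.le, zero_div, zero_div, min_eq_right zero_le_one, add_zero, max_eq_left]
    exact add_nonpos ((min_le_right _ _).trans (div_nonpos_of_nonpos_of_nonneg h.le ht.le))
      ((min_le_right _ _).trans (div_nonpos_of_nonpos_of_nonneg h.le ht'.le))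

lemma max_min_add_min_eq_of_dvd {x t : ℝ} (hx : 0 < x) (ht : 0 < t) (ht1 : t < 1) :
    max 0 (min 1 (1 / x / t) + min 1 ((1 / x - 1) / (1 - t))) =
      levelInt (fun y => 1 / (1 - y)) x (1 - t) + levelInt (fun y => 1 / (1 + y)) x (1 - t) := by
  have ht' : 0 < 1 - t := by linarith
  rw [levelInt_one_div_one_sub hx ht, levelInt_one_div_one_add hx (by linarith) ht',
    min_div_eq ht']
  have hx' : 0 < 1 / x := by positivity
  rcases le_or_gt 0 (1 / x - 1) with h | h
  · have h1 : 1 ≤ 1 / x / t := by rw [le_div_iff₀ ht]; linarith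
    rw [max_eq_right h, min_eq_left (by linarith : 1 - t ≤ 1 / x - t), max_eq_right ht'.le,
      div_self ht'.ne', min_eq_left h1, max_eq_right]
    exact add_nonneg zero_le_one (le_min zero_le_one (by positivity))
  · rw [max_eq_left h.le, zero_div, min_eq_right zero_le_one, add_zero,
      min_eq_right (by linarith : 1 / x - t ≤ 1 - t),
      min_eq_right (le_trans (div_nonpos_of_nonpos_of_nonneg h.le ht'.le) zero_le_one)]
    have e1 : 1 + (1 / x - 1) / (1 - t) = (1 / x - t) / (1 - t) := by field_simp; ring
    have e2 : 1 / x / t + (1 / x - 1) / (1 - t) = (1 / x - t) / (1 - t) / t := by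
      field_simp; ring
    rw [← min_add_add_right, e1, e2]
    rcases le_or_gt 0 (1 / x - t) with h2 | h2
    · rw [min_eq_left (le_div_self (by positivity) ht ht1.le), max_eq_right h2,
        max_eq_right (by positivity)]
    · rw [max_eq_left h2.le, zero_div, max_eq_left]
      exact (min_le_left _ _).trans (div_nonpos_of_nonpos_of_nonneg h2.le ht'.le)

/-- The set of `x` within `ε / q` of `p / q` lying in the open interval
`((p₁ + c₁) / q₁, (p₂ - c₂) / q₂)`. -/
lemma volume_real_strip {q₁ q₂ p₁ p₂ : ℝ} (h₁ : 0 < q₁) (h₂ : 0 < q₂) (hdet : q₁ * p₂ - p₁ * q₂ = 1)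
    {ε : ℝ} (hε : 0 < ε) (c₁ c₂ : ℝ) :
    volume.real {x : ℝ | |(q₁ + q₂) * x - (p₁ + p₂)| ≤ ε ∧ ε * c₁ < q₁ * x - p₁ ∧
      ε * c₂ < p₂ - q₂ * x} =
    ε / (q₁ + q₂) * max 0 (min 1 ((1 / (ε * (q₁ + q₂)) - c₁) / (q₁ / (q₁ + q₂))) +
      min 1 ((1 / (ε * (q₁ + q₂)) - c₂) / (q₂ / (q₁ + q₂)))) := by
  have hq : 0 < q₁ + q₂ := by positivity
  set p := p₁ + p₂ with hp
  set q := q₁ + q₂ with hqq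
  have hr : 0 < ε / q := by positivity
  set L := (1 / (ε * q) - c₁) / (q₁ / q) with hL
  set R := (1 / (ε * q) - c₂) / (q₂ / q) with hR
  have eL : p / q - ε / q * L = (p₁ + ε * c₁) / q₁ := by
    rw [hL]
    field_simp
    rw [hp, hqq]
    linear_combination hdet
  have eR : p / q + ε / q * R = (p₂ - ε * c₂) / q₂ := by
    rw [hR]
    field_simp
    rw [hp, hqq]
    linear_combination -hdet
  have hS : {x : ℝ | |q * x - p| ≤ ε ∧ ε * c₁ < q₁ * x - p₁ ∧ ε * c₂ < p₂ - q₂ * x} =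
      Icc (p / q - ε / q) (p / q + ε / q) ∩ Ioo (p / q - ε / q * L) (p / q + ε / q * R) := by
    ext x
    rw [mem_inter_iff, mem_Icc, mem_Ioo, Set.mem_ofPred_eq, eL, eR, abs_le, ← sub_div, ← add_div,
      div_le_iff₀ hq, le_div_iff₀ hq, div_lt_iff₀ h₁, lt_div_iff₀ h₂]
    constructor <;> rintro ⟨⟨h1, h2⟩, h3, h4⟩ <;>
      exact ⟨⟨by linarith, by linarith⟩, by linarith, by linarith⟩
  rw [hS, volume_real_Icc_inter_Ioo]
  have e1 : min (p / q + ε / q) (p / q + ε / q * R) = p / q + ε / q * min 1 R := by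
    rw [min_add_add_left, mul_min_of_nonneg _ _ hr.le, mul_one]
  have e2 : max (p / q - ε / q) (p / q - ε / q * L) = p / q - ε / q * min 1 L := by
    rw [max_sub_sub_left, mul_min_of_nonneg _ _ hr.le, mul_one]
  rw [e1, e2, mul_max_of_nonneg _ _ hr.le, mul_zero]
  congr 1
  ring

end StripVolume

section KillSets

/-- The slopes for which `(q, p)` is the first scatterer that is hit. -/
def killSet (l : ℕ) (ε : ℝ) (q : ℕ) (p : ℤ) : Set ℝ :=
  {x | |q * x - p| ≤ ε ∧ ∀ m : ℕ, 0 < m → m < q → ∀ n : ℤ, ¬ (l : ℤ) ∣ n → ε < |m * x - n|}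

open Classical in
/-- `0` on multiples of `l`, `1` elsewhere. -/
noncomputable def ndvdInd (l : ℕ) (p : ℤ) : ℝ := if (l : ℤ) ∣ p then 0 else 1

lemma ndvdInd_of_dvd {l : ℕ} {p : ℤ} (h : (l : ℤ) ∣ p) : ndvdInd l p = 0 := if_pos h

lemma ndvdInd_of_not_dvd {l : ℕ} {p : ℤ} (h : ¬ (l : ℤ) ∣ p) : ndvdInd l p = 1 := if_neg h

lemma killSet_add_subset {l : ℕ} {q₁ q₂ : ℕ} (h₁ : 0 < q₁) (h₂ : 0 < q₂) {p₁ p₂ : ℤ}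
    (hdet : (q₁ : ℤ) * p₂ - p₁ * q₂ = 1) (hp : ¬ (l : ℤ) ∣ p₁ + p₂) {ε : ℝ} {x : ℝ}
    (hx : x ∈ killSet l ε (q₁ + q₂) (p₁ + p₂)) :
    |((q₁ : ℝ) + q₂) * x - (p₁ + p₂)| ≤ ε ∧ ε * ndvdInd l p₁ < q₁ * x - p₁ ∧
      ε * ndvdInd l p₂ < p₂ - q₂ * x := by
  obtain ⟨hs, hk⟩ := hx
  push_cast at hs
  have hdet' : (q₁ : ℝ) * p₂ - p₁ * q₂ = 1 := by exact_mod_cast hdet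
  have r₁ : (0 : ℝ) < q₁ := by exact_mod_cast h₁
  have r₂ : (0 : ℝ) < q₂ := by exact_mod_cast h₂
  have huw : (q₁ : ℝ) * (p₂ - q₂ * x) + q₂ * (q₁ * x - p₁) = 1 := by linear_combination hdet'
  have hs' := abs_le.1 hs
  have k₁ : ¬ (l : ℤ) ∣ p₁ → ε < q₁ * x - p₁ := by
    intro h
    rcases lt_abs.1 (hk q₁ h₁ (by omega) p₁ h) with h' | h'
    · exact h'
    · nlinarith
  have k₂ : ¬ (l : ℤ) ∣ p₂ → ε < p₂ - q₂ * x := by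
    intro h
    rcases lt_abs.1 (hk q₂ h₂ (by omega) p₂ h) with h' | h'
    · nlinarith
    · linarith
  refine ⟨hs, ?_⟩
  by_cases d₁ : (l : ℤ) ∣ p₁
  · have d₂ : ¬ (l : ℤ) ∣ p₂ := fun h => hp (dvd_add d₁ h)
    rw [ndvdInd_of_dvd d₁, ndvdInd_of_not_dvd d₂]
    constructor <;> linarith [k₂ d₂]
  · rw [ndvdInd_of_not_dvd d₁]
    by_cases d₂ : (l : ℤ) ∣ p₂
    · rw [ndvdInd_of_dvd d₂]
      constructor <;> linarith [k₁ d₁]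
    · rw [ndvdInd_of_not_dvd d₂]
      constructor <;> linarith [k₁ d₁, k₂ d₂]

lemma subset_killSet_add {l : ℕ} {q₁ q₂ : ℕ} {p₁ p₂ : ℤ}
    (hdet : (q₁ : ℤ) * p₂ - p₁ * q₂ = 1) (hp : ¬ (l : ℤ) ∣ p₁ + p₂) {ε : ℝ} (hε : 0 < ε) {x : ℝ}
    (hs : |((q₁ : ℝ) + q₂) * x - (p₁ + p₂)| ≤ ε) (hu : ε * ndvdInd l p₁ < q₁ * x - p₁)
    (hw : ε * ndvdInd l p₂ < p₂ - q₂ * x) : x ∈ killSet l ε (q₁ + q₂) (p₁ + p₂) := by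
  refine ⟨by push_cast; exact hs, fun m hm hmq n hn => ?_⟩
  obtain ⟨a, ha⟩ : ∃ a : ℤ, a = m * p₂ - n * q₂ := ⟨_, rfl⟩
  obtain ⟨b, hb⟩ : ∃ b : ℤ, b = q₁ * n - p₁ * m := ⟨_, rfl⟩
  have hm' : (m : ℤ) = a * q₁ + b * q₂ := by rw [ha, hb]; linear_combination -(m : ℤ) * hdet
  have hn' : n = a * p₁ + b * p₂ := by rw [ha, hb]; linear_combination -n * hdet
  have e : (m : ℝ) * x - n = a * (q₁ * x - p₁) - b * (p₂ - q₂ * x) := by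
    have e1 : (m : ℝ) = a * q₁ + b * q₂ := by exact_mod_cast hm'
    have e2 : (n : ℝ) = a * p₁ + b * p₂ := by exact_mod_cast hn'
    rw [e1, e2]; ring
  set u := (q₁ : ℝ) * x - p₁
  set w := (p₂ : ℝ) - q₂ * x
  have hu0 : 0 < u := lt_of_le_of_lt (by rw [ndvdInd]; positivity) hu
  have hw0 : 0 < w := lt_of_le_of_lt (by rw [ndvdInd]; positivity) hw
  have q₁0 : (0 : ℤ) ≤ q₁ := by positivity
  have q₂0 : (0 : ℤ) ≤ q₂ := by positivity
  have hmp : (0 : ℤ) < m := by exact_mod_cast hm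
  have hmq' : (m : ℤ) < q₁ + q₂ := by exact_mod_cast hmq
  have key : (1 ≤ a ∧ b ≤ 0) ∨ (a ≤ 0 ∧ 1 ≤ b) := by
    rcases le_or_gt a 0 with h | h <;> rcases le_or_gt b 0 with h' | h'
    · nlinarith
    · exact Or.inr ⟨h, h'⟩
    · exact Or.inl ⟨h, h'⟩
    · nlinarith
  rw [e, lt_abs]
  have hd : (l : ℤ) ∣ p₁ → ¬ (l : ℤ) ∣ p₂ := fun h h' => hp (dvd_add h h')
  rcases key with ⟨h, h'⟩ | ⟨h, h'⟩
  · left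
    have g : (1 : ℝ) ≤ a := by exact_mod_cast h
    by_cases d : (l : ℤ) ∣ p₁
    · rw [ndvdInd_of_not_dvd (hd d), mul_one] at hw
      have hb0 : b ≠ 0 := by
        rintro rfl
        exact hn (hn' ▸ by simpa using Dvd.dvd.mul_left d a)
      have g' : (b : ℝ) ≤ -1 := by
        have : b ≤ -1 := by omega
        exact_mod_cast this
      nlinarith
    · rw [ndvdInd_of_not_dvd d, mul_one] at hu
      have g' : (b : ℝ) ≤ 0 := by exact_mod_cast h'
      nlinarith
  · right
    have g : (1 : ℝ) ≤ b := by exact_mod_cast h'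
    by_cases d : (l : ℤ) ∣ p₂
    · rw [ndvdInd_of_not_dvd fun h => hd h d, mul_one] at hu
      have ha0 : a ≠ 0 := by
        rintro rfl
        exact hn (hn' ▸ by simpa using Dvd.dvd.mul_left d b)
      have g' : (a : ℝ) ≤ -1 := by
        have : a ≤ -1 := by omega
        exact_mod_cast this
      nlinarith
    · rw [ndvdInd_of_not_dvd d, mul_one] at hw
      have g' : (a : ℝ) ≤ 0 := by exact_mod_cast h
      nlinarith

open Classical in
/-- The contribution of a companion with quotient `t = q' / q`. -/
noncomputable def sideWeight (l : ℕ) (x t : ℝ) (p : ℤ) : ℝ :=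
  if (l : ℤ) ∣ p then levelInt (fun y => 1 / (1 - y)) x (1 - t)
  else levelInt (fun y => 1 / (1 + y)) x t

lemma volume_real_killSet_add {l : ℕ} {q₁ q₂ : ℕ} (h₁ : 0 < q₁) (h₂ : 0 < q₂) {p₁ p₂ : ℤ}
    (hdet : (q₁ : ℤ) * p₂ - p₁ * q₂ = 1) (hp : ¬ (l : ℤ) ∣ p₁ + p₂) {ε : ℝ} (hε : 0 < ε) :
    volume.real (killSet l ε (q₁ + q₂) (p₁ + p₂)) = ε / (q₁ + q₂) *
      (sideWeight l (ε * (q₁ + q₂)) (q₁ / (q₁ + q₂)) p₁ +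
        sideWeight l (ε * (q₁ + q₂)) (q₂ / (q₁ + q₂)) p₂) := by
  have hS : killSet l ε (q₁ + q₂) (p₁ + p₂) =
      {x : ℝ | |((q₁ : ℝ) + q₂) * x - (p₁ + p₂)| ≤ ε ∧ ε * ndvdInd l p₁ < q₁ * x - p₁ ∧
        ε * ndvdInd l p₂ < p₂ - q₂ * x} :=
    Subset.antisymm (fun x hx => killSet_add_subset h₁ h₂ hdet hp hx)
      fun x hx => subset_killSet_add hdet hp hε hx.1 hx.2.1 hx.2.2
  have hdet' : (q₁ : ℝ) * p₂ - p₁ * q₂ = 1 := by exact_mod_cast hdet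
  have r₁ : (0 : ℝ) < q₁ := by exact_mod_cast h₁
  have r₂ : (0 : ℝ) < q₂ := by exact_mod_cast h₂
  rw [hS, volume_real_strip r₁ r₂ hdet' hε]
  congr 1
  have hX : 0 < ε * ((q₁ : ℝ) + q₂) := by positivity
  have ht₂ : (q₂ : ℝ) / (q₁ + q₂) = 1 - q₁ / (q₁ + q₂) := by field_simp; ring
  have ht₁ : (q₁ : ℝ) / (q₁ + q₂) = 1 - q₂ / (q₁ + q₂) := by field_simp; ring
  have a₁ : 0 < (q₁ : ℝ) / (q₁ + q₂) := by positivity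
  have a₂ : 0 < (q₂ : ℝ) / (q₁ + q₂) := by positivity
  by_cases d₁ : (l : ℤ) ∣ p₁
  · have d₂ : ¬ (l : ℤ) ∣ p₂ := fun h => hp (dvd_add d₁ h)
    rw [ndvdInd_of_dvd d₁, ndvdInd_of_not_dvd d₂, sideWeight, sideWeight, if_pos d₁, if_neg d₂, ht₂,
      sub_zero]
    exact max_min_add_min_eq_of_dvd hX a₁ (by linarith)
  · by_cases d₂ : (l : ℤ) ∣ p₂
    · rw [ndvdInd_of_dvd d₂, ndvdInd_of_not_dvd d₁, sideWeight, sideWeight, if_pos d₂, if_neg d₁,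
        ht₁, sub_zero, add_comm, add_comm (levelInt _ _ _)]
      exact max_min_add_min_eq_of_dvd hX a₂ (by linarith)
    · rw [ndvdInd_of_not_dvd d₂, ndvdInd_of_not_dvd d₁, sideWeight, sideWeight, if_neg d₂,
        if_neg d₁, ht₂]
      exact max_min_add_min_eq hX a₁ (by linarith)

end KillSets

section FreeSet

/-- The slopes for which no scatterer `(m, p)` with `m ≤ N` is hit. -/
def freeSet (l : ℕ) (ε : ℝ) (N : ℕ) : Set ℝ :=
  {x | ∀ m : ℕ, 0 < m → m ≤ N → ∀ p : ℤ, ¬ (l : ℤ) ∣ p → ε < |m * x - p|}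

lemma measurableSet_avoid (l : ℕ) (ε : ℝ) (P : ℕ → Prop) :
    MeasurableSet {x : ℝ | ∀ m : ℕ, 0 < m → P m → ∀ n : ℤ, ¬ (l : ℤ) ∣ n → ε < |m * x - n|} := by
  have : {x : ℝ | ∀ m : ℕ, 0 < m → P m → ∀ n : ℤ, ¬ (l : ℤ) ∣ n → ε < |m * x - n|} =
      ⋂ m : ℕ, ⋂ _ : 0 < m, ⋂ _ : P m, ⋂ n : ℤ, ⋂ _ : ¬ (l : ℤ) ∣ n,
        {x : ℝ | ε < |(m : ℝ) * x - n|} := by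
    ext x
    simp only [mem_iInter, Set.mem_ofPred_eq]
  rw [this]
  refine MeasurableSet.iInter fun m => MeasurableSet.iInter fun _ => MeasurableSet.iInter fun _ =>
    MeasurableSet.iInter fun n => MeasurableSet.iInter fun _ => ?_
  exact measurableSet_lt measurable_const (by fun_prop)

lemma measurableSet_freeSet (l : ℕ) (ε : ℝ) (N : ℕ) : MeasurableSet (freeSet l ε N) :=
  measurableSet_avoid l ε fun m => m ≤ N

lemma measurableSet_killSet (l : ℕ) (ε : ℝ) (q : ℕ) (p : ℤ) : MeasurableSet (killSet l ε q p) :=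
  MeasurableSet.inter (s₁ := {x : ℝ | |(q : ℝ) * x - p| ≤ ε})
    (measurableSet_le (by fun_prop) measurable_const) (measurableSet_avoid l ε fun m => m < q)

lemma killSet_subset_Icc {l : ℕ} {ε : ℝ} (hε : 0 ≤ ε) {q : ℕ} (hq : 1 ≤ q) {p : ℤ} :
    killSet l ε q p ⊆ Icc ((p : ℝ) / q - ε) (p / q + ε) := by
  intro x hx
  have h1 := abs_le.1 hx.1
  have hq' : (1 : ℝ) ≤ q := by exact_mod_cast hq
  have h0 : (0 : ℝ) < q := by linarith
  have h2 : ε / q ≤ ε := div_le_self hε hq'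
  have h3 : x = p / q + (q * x - p) / q := by field_simp; ring
  have h4 : (q * x - p) / q ≤ ε / q := by gcongr; exact h1.2
  have h5 : -ε / q ≤ (q * x - p) / q := by gcongr; exact h1.1
  rw [neg_div] at h5
  constructor <;> linarith

lemma volume_real_killSet_le (l : ℕ) {ε : ℝ} (hε : 0 ≤ ε) {q : ℕ} (hq : 1 ≤ q) (p : ℤ) :
    volume.real (killSet l ε q p) ≤ 2 * ε := by
  refine (measureReal_mono (killSet_subset_Icc hε hq) measure_Icc_lt_top.ne).trans ?_
  rw [Real.volume_real_Icc]
  exact max_le (by linarith) (by linarith)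

lemma killSet_disjoint {l : ℕ} {ε : ℝ} (hε : ε < 1 / 2) {q q' : ℕ} {p p' : ℤ} (hq : 0 < q)
    (hq' : 0 < q') (hp : ¬ (l : ℤ) ∣ p) (hp' : ¬ (l : ℤ) ∣ p') (hne : ¬ (q = q' ∧ p = p')) :
    Disjoint (killSet l ε q p) (killSet l ε q' p') := by
  rw [Set.disjoint_left]
  rintro x ⟨h1, h2⟩ ⟨h3, h4⟩
  rcases lt_trichotomy q q' with h | rfl | h
  · exact (h4 q hq h p hp).not_ge h1
  · have h5 : |(p : ℝ) - p'| < 1 := by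
      have := abs_sub_le ((p : ℝ)) (q * x) p'
      rw [abs_sub_comm (p : ℝ) (q * x)] at this
      linarith
    have h6 : |p - p'| < 1 := by exact_mod_cast h5
    rw [Int.abs_lt_one_iff] at h6
    exact hne ⟨rfl, by omega⟩
  · exact (h2 q' hq' h p' hp').not_ge h3

lemma exists_mem_killSet {l : ℕ} {ε : ℝ} {N : ℕ} {x : ℝ} (hx : x ∉ freeSet l ε N) :
    ∃ q : ℕ, 1 ≤ q ∧ q ≤ N ∧ ∃ p : ℤ, ¬ (l : ℤ) ∣ p ∧ IsCoprime (q : ℤ) p ∧ x ∈ killSet l ε q p := by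
  classical
  have hex : ∃ m : ℕ, 0 < m ∧ m ≤ N ∧ ∃ p : ℤ, ¬ (l : ℤ) ∣ p ∧ |m * x - p| ≤ ε := by
    rw [freeSet, Set.mem_ofPred_eq] at hx
    push Not at hx
    exact hx
  obtain ⟨h0, hN, p, hp, hxp⟩ := Nat.find_spec hex
  set q := Nat.find hex with hq
  have hmin : ∀ m : ℕ, 0 < m → m < q → ∀ n : ℤ, ¬ (l : ℤ) ∣ n → ε < |m * x - n| := by
    intro m hm hmq n hn
    by_contra! h
    exact Nat.find_min hex hmq ⟨hm, hmq.le.trans hN, n, hn, h⟩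
  refine ⟨q, h0, hN, p, hp, ?_, hxp, hmin⟩
  rw [Int.isCoprime_iff_gcd_eq_one]
  by_contra hd
  obtain ⟨d, hd'⟩ : ∃ d : ℕ, d = Int.gcd (q : ℤ) p := ⟨_, rfl⟩
  rw [← hd'] at hd
  have hdq : d ∣ q := by
    have := Int.gcd_dvd_left (q : ℤ) p
    rw [← hd'] at this
    exact_mod_cast this
  have hdp : (d : ℤ) ∣ p := by
    have := Int.gcd_dvd_right (q : ℤ) p
    rwa [← hd'] at this
  obtain ⟨m, hm⟩ := hdq
  obtain ⟨n, hn⟩ := hdp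
  have hm0 : 0 < m := Nat.pos_of_ne_zero (by rintro rfl; simp at hm; omega)
  have hd0 : 0 < d := Nat.pos_of_ne_zero (by rintro rfl; simp at hm; omega)
  have hd2 : 2 ≤ d := by omega
  have hmq : m < q := by rw [hm]; nlinarith
  have h1 := hmin m hm0 hmq n fun h => hp (hn ▸ Dvd.dvd.mul_left h _)
  have h2 : |(q : ℝ) * x - p| = d * |m * x - n| := by
    rw [hm, hn]
    push_cast
    rw [mul_assoc, ← mul_sub, abs_mul, Nat.abs_cast]
  rw [h2] at hxp
  have h3 : (1 : ℝ) ≤ d := by exact_mod_cast hd0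
  nlinarith [abs_nonneg ((m : ℝ) * x - n)]

lemma abs_volume_real_diff_freeSet_sub_le (l : ℕ) {ε : ℝ} (hε : 0 < ε) (hε2 : ε < 1 / 2) (N : ℕ)
    (α β : ℝ) :
    |volume.real (Ioc α β \ freeSet l ε N) -
      ∑ v ∈ primSet l (fun _ p => p ≠ 0) α β N, volume.real (killSet l ε v.1 v.2)| ≤ 4 * ε := by
  set U : Set ℝ := ⋃ v ∈ primSet l (fun _ p => p ≠ 0) α β N, killSet l ε v.1 v.2 with hU
  set B : Set ℝ := Icc (α - ε) (α + ε) ∪ Icc (β - ε) (β + ε) with hB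
  have hmem : ∀ q p, (⟨q, p⟩ : Σ _ : ℕ, ℤ) ∈ primSet l (fun _ p => p ≠ 0) α β N ↔
      (1 ≤ q ∧ q ≤ N) ∧ (α < p / q ∧ (p : ℝ) / q ≤ β) ∧ ¬ (l : ℤ) ∣ p ∧ IsCoprime (q : ℤ) p := by
    intro q p
    rw [mem_primSet]
    refine and_congr_right fun h => ?_
    have h0 : (0 : ℝ) < q := by exact_mod_cast h.1
    simp only [ne_eq, ZMod.intCast_zmod_eq_zero_iff_dvd]
    rw [lt_div_iff₀ h0, div_le_iff₀ h0]
  have hsum : volume.real U =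
      ∑ v ∈ primSet l (fun _ p => p ≠ 0) α β N, volume.real (killSet l ε v.1 v.2) := by
    have hfin : ∀ v ∈ primSet l (fun _ p => p ≠ 0) α β N, volume (killSet l ε v.1 v.2) ≠ ∞ := by
      rintro ⟨q, p⟩ hv
      rw [hmem] at hv
      exact ((measure_mono (killSet_subset_Icc hε.le hv.1.1)).trans_lt measure_Icc_lt_top).ne
    rw [hU, measureReal_biUnion_finset ?_ (fun v _ => measurableSet_killSet _ _ _ _) hfin]
    · rintro ⟨q, p⟩ hv ⟨q', p'⟩ hv' hne
      rw [Finset.mem_coe, hmem] at hv hv'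
      exact killSet_disjoint hε2 hv.1.1 hv'.1.1 hv.2.2.1 hv'.2.2.1 fun h => hne (by
        obtain ⟨rfl, rfl⟩ := h; rfl)
  have s1 : Ioc α β \ freeSet l ε N ⊆ U ∪ B := by
    rintro x ⟨hx, hxF⟩
    obtain ⟨q, hq, hqN, p, hp, hco, hk⟩ := exists_mem_killSet hxF
    have hxq := killSet_subset_Icc hε.le hq hk
    by_cases h1 : α < p / q
    · by_cases h2 : (p : ℝ) / q ≤ β
      · left
        rw [hU, mem_iUnion₂]
        exact ⟨⟨q, p⟩, (hmem q p).2 ⟨⟨hq, hqN⟩, ⟨h1, h2⟩, hp, hco⟩, hk⟩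
      · right; right
        exact ⟨by linarith [hxq.1], by linarith [hx.2]⟩
    · right; left
      exact ⟨by linarith [hx.1], by linarith [hxq.2]⟩
  have s2 : U ⊆ (Ioc α β \ freeSet l ε N) ∪ B := by
    intro x hx
    rw [hU, mem_iUnion₂] at hx
    obtain ⟨⟨q, p⟩, hv, hk⟩ := hx
    rw [hmem] at hv
    obtain ⟨⟨hq, hqN⟩, ⟨h1, h2⟩, hp, -⟩ := hv
    have hxq := killSet_subset_Icc hε.le hq hk
    simp only at hxq
    by_cases h3 : α < x
    · by_cases h4 : x ≤ β
      · left
        exact ⟨⟨h3, h4⟩, fun h => (h q hq hqN p hp).not_ge hk.1⟩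
      · right; right
        exact ⟨by linarith, by linarith [hxq.2]⟩
    · right; left
      exact ⟨by linarith [hxq.1], by linarith⟩
  have hBv : volume.real B ≤ 4 * ε := by
    refine (measureReal_union_le _ _).trans ?_
    rw [Real.volume_real_Icc, Real.volume_real_Icc, max_eq_left (by linarith),
      max_eq_left (by linarith)]
    linarith
  have hBt : volume B ≠ ∞ := measure_union_ne_top measure_Icc_lt_top.ne measure_Icc_lt_top.ne
  have hJt : volume (Ioc α β \ freeSet l ε N) ≠ ∞ :=
    ((measure_mono sdiff_subset).trans_lt measure_Ioc_lt_top).ne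
  have hUt : volume U ≠ ∞ := ((measure_mono s2).trans_lt (measure_union_ne_top hJt hBt).lt_top).ne
  have b1 := (measureReal_mono s1 (measure_union_ne_top hUt hBt)).trans (measureReal_union_le _ _)
  have b2 := (measureReal_mono s2 (measure_union_ne_top hJt hBt)).trans (measureReal_union_le _ _)
  rw [← hsum, abs_le]
  constructor <;> linarith

end FreeSet

section KillSums

lemma mem_companions {l : ℕ} {α β : ℝ} {σ : ℤ} {N : ℕ} {v : Σ _ : ℕ, ℤ × ℤ} :
    v ∈ companions l α β σ N ↔ (1 ≤ v.1 ∧ v.1 ≤ N) ∧ (α * v.1 < v.2.1 ∧ (v.2.1 : ℝ) ≤ β * v.1) ∧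
      (0 < v.2.2 ∧ v.2.2 < v.1) ∧ ¬ (l : ℤ) ∣ v.2.1 ∧ (v.1 : ℤ) ∣ v.2.2 * v.2.1 - σ := by
  rw [companions, mem_compSet]
  simp only [ne_eq, ZMod.intCast_zmod_eq_zero_iff_dvd, zero_mul, one_mul]
  have h1 : ((0 : ℝ) < v.2.2) ↔ 0 < v.2.2 := by exact_mod_cast Iff.rfl
  have h2 : ((v.2.2 : ℝ) < v.1) ↔ v.2.2 < v.1 := by exact_mod_cast Iff.rfl
  rw [h1, h2]
  constructor
  · rintro ⟨a, ⟨b, c, d⟩, e, f, g, h⟩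
    exact ⟨a, b, ⟨g, h⟩, e, f⟩
  · rintro ⟨a, b, ⟨g, h⟩, e, f⟩
    exact ⟨a, ⟨b, g.le, h⟩, e, f, g, h⟩

/-- The contribution of the companion `v` to the measure of the complement of the free set. -/
noncomputable def companionWeight (l : ℕ) (ε : ℝ) (σ : ℤ) (v : Σ _ : ℕ, ℤ × ℤ) : ℝ :=
  ε / v.1 * sideWeight l (ε * v.1) (v.2.2 / v.1) ((v.2.2 * v.2.1 - σ) / v.1)

lemma volume_real_killSet_of_mem_companions {l : ℕ} {α β : ℝ} {N : ℕ} {ε : ℝ} (hε : 0 < ε)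
    {v : Σ _ : ℕ, ℤ × ℤ} (hv : v ∈ companions l α β 1 N) :
    volume.real (killSet l ε v.1 v.2.1) = companionWeight l ε 1 v +
      companionWeight l ε (-1) ⟨v.1, v.2.1, v.1 - v.2.2⟩ := by
  obtain ⟨q, p, q'⟩ := v
  rw [mem_companions] at hv
  obtain ⟨⟨hq, -⟩, -, ⟨h0, hlt⟩, hp, p₁, hdiv⟩ := hv
  simp only at hq h0 hlt hp hdiv ⊢
  have hqz : (q : ℤ) ≠ 0 := by positivity
  obtain ⟨q₁, rfl⟩ := Int.eq_ofNat_of_zero_le h0.le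
  obtain ⟨q₂, rfl⟩ : ∃ q₂, q = q₁ + q₂ := ⟨q - q₁, by omega⟩
  obtain ⟨p₂, rfl⟩ : ∃ p₂, p = p₁ + p₂ := ⟨p - p₁, by ring⟩
  have hdet : (q₁ : ℤ) * p₂ - p₁ * q₂ = 1 := by push_cast at hdiv; linear_combination hdiv
  have e1 : ((q₁ : ℤ) * (p₁ + p₂) - 1) / ((q₁ + q₂ : ℕ) : ℤ) = p₁ := by
    rw [hdiv, Int.mul_ediv_cancel_left _ hqz]
  have e2 : ((((q₁ + q₂ : ℕ) : ℤ) - q₁) * (p₁ + p₂) - (-1)) / ((q₁ + q₂ : ℕ) : ℤ) = p₂ := by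
    rw [show (((q₁ + q₂ : ℕ) : ℤ) - q₁) * (p₁ + p₂) - (-1) = ((q₁ + q₂ : ℕ) : ℤ) * p₂ by
      push_cast; linear_combination -hdet, Int.mul_ediv_cancel_left _ hqz]
  have := volume_real_killSet_add (l := l) (by omega) (by omega) hdet hp hε
  simp only [companionWeight, e1, e2]
  rw [this, mul_add]
  push_cast
  rw [add_sub_cancel_left]

lemma sum_companions_reflect (l : ℕ) (α β ε : ℝ) (N : ℕ) :
    ∑ v ∈ companions l α β 1 N, companionWeight l ε (-1) ⟨v.1, v.2.1, v.1 - v.2.2⟩ =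
      ∑ v ∈ companions l α β (-1) N, companionWeight l ε (-1) v := by
  have key : ∀ (σ : ℤ) (v : Σ _ : ℕ, ℤ × ℤ), v ∈ companions l α β σ N →
      (⟨v.1, v.2.1, v.1 - v.2.2⟩ : Σ _ : ℕ, ℤ × ℤ) ∈ companions l α β (-σ) N := by
    rintro σ ⟨q, p, q'⟩ hv
    rw [mem_companions] at hv ⊢
    obtain ⟨h1, h2, h3, h4, h5⟩ := hv
    simp only at h1 h2 h3 h4 h5 ⊢
    refine ⟨h1, h2, ⟨by omega, by omega⟩, h4, ?_⟩
    have e : ((q : ℤ) - q') * p - -σ = q * p - (q' * p - σ) := by ring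
    rw [e]
    exact dvd_sub (dvd_mul_right _ _) h5
  refine Finset.sum_nbij' (fun v => ⟨v.1, v.2.1, v.1 - v.2.2⟩) (fun v => ⟨v.1, v.2.1, v.1 - v.2.2⟩)
    (fun v hv => key 1 v hv) (fun v hv => by simpa using key (-1) v hv) ?_ ?_ ?_
  · rintro ⟨q, p, q'⟩ _; simp
  · rintro ⟨q, p, q'⟩ _; simp
  · rintro ⟨q, p, q'⟩ _; simp

lemma sum_volume_real_killSet_eq (l : ℕ) (α β : ℝ) (N : ℕ) {ε : ℝ} (hε : 0 < ε) :
    ∑ v ∈ (primSet l (fun _ p => p ≠ 0) α β N).filter fun v => v.1 ≠ 1,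
        volume.real (killSet l ε v.1 v.2) =
      ∑ v ∈ companions l α β 1 N, companionWeight l ε 1 v +
        ∑ v ∈ companions l α β (-1) N, companionWeight l ε (-1) v := by
  rw [← sum_companions_reflect, ← Finset.sum_add_distrib]
  rw [← Finset.sum_congr rfl fun v hv => volume_real_killSet_of_mem_companions hε hv]
  symm
  refine Finset.sum_bij (fun v _ => (⟨v.1, v.2.1⟩ : Σ _ : ℕ, ℤ)) ?_ ?_ ?_ (fun _ _ => rfl)
  · rintro ⟨q, p, q'⟩ hv
    rw [mem_companions] at hv
    obtain ⟨h1, h2, h3, h4, k, h5⟩ := hv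
    rw [Finset.mem_filter, mem_primSet]
    refine ⟨⟨h1, h2, ?_, ?_⟩, ?_⟩
    · simpa only [ne_eq, ZMod.intCast_zmod_eq_zero_iff_dvd] using h4
    · exact ⟨-k, q', by simp only at h5 ⊢; linear_combination h5⟩
    · simp only at h3 ⊢; omega
  · rintro ⟨q, p, q'⟩ hv ⟨r, s, r'⟩ hv' h
    simp only [Sigma.mk.injEq, heq_eq_eq] at h
    obtain ⟨rfl, rfl⟩ := h
    rw [mem_companions] at hv hv'
    obtain ⟨h1, -, h3, -, k, h5⟩ := hv
    obtain ⟨-, -, h3', -, h5'⟩ := hv'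
    simp only at h1 h3 h5 h3' h5'
    have hco : IsCoprime (q : ℤ) p := ⟨-k, q', by linear_combination h5⟩
    have hd : (q : ℤ) ∣ (q' - r') * p := by
      have := dvd_sub (Dvd.intro k h5.symm) h5'
      rwa [show q' * p - 1 - (r' * p - 1) = (q' - r') * p by ring] at this
    have hd' := hco.dvd_of_dvd_mul_right hd
    have : q' - r' = 0 := by
      refine Int.eq_zero_of_abs_lt_dvd hd' ?_
      rw [abs_lt]; constructor <;> omega
    have : q' = r' := by omega
    rw [this]
  · rintro ⟨q, p⟩ hv
    rw [Finset.mem_filter, mem_primSet] at hv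
    obtain ⟨⟨h1, h2, h3, a, b, h4⟩, h5⟩ := hv
    simp only [ne_eq, ZMod.intCast_zmod_eq_zero_iff_dvd] at h1 h2 h3 h4 h5
    have hq : (0 : ℤ) < q := by exact_mod_cast h1.1
    have hdvd : (q : ℤ) ∣ b % q * p - 1 := by
      refine ⟨-(a + b / q * p), ?_⟩
      have := Int.emod_add_mul_ediv b q
      linear_combination h4 + p * this
    refine ⟨⟨q, p, b % q⟩, ?_, rfl⟩
    rw [mem_companions]
    refine ⟨h1, h2, ⟨lt_of_le_of_ne (Int.emod_nonneg _ hq.ne') ?_, Int.emod_lt_of_pos _ hq⟩, h3,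
      hdvd⟩
    intro h0
    simp only at h0
    rw [← h0, zero_mul, zero_sub, dvd_neg] at hdvd
    have := Int.le_of_dvd one_pos hdvd
    omega

lemma sum_companionWeight_eq (l : ℕ) (α β ε : ℝ) (σ : ℤ) (N : ℕ) :
    ∑ v ∈ companions l α β σ N, companionWeight l ε σ v =
      ∑ v ∈ companions l α β σ N,
        ε / v.1 * levelInt (fun y => 1 / (1 + y)) (ε * v.1) (v.2.2 / v.1) +
      (∑ v ∈ divCompanions l α β σ N,
        ε / v.1 * levelInt (fun y => 1 / (1 - y)) (ε * v.1) (1 - v.2.2 / v.1) -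
      ∑ v ∈ divCompanions l α β σ N,
        ε / v.1 * levelInt (fun y => 1 / (1 + y)) (ε * v.1) (v.2.2 / v.1)) := by
  rw [← Finset.sum_sub_distrib, divCompanions, Finset.sum_filter, ← Finset.sum_add_distrib]
  refine Finset.sum_congr rfl fun v hv => ?_
  rw [mem_companions] at hv
  have hiff : (l : ℤ) ∣ (v.2.2 * v.2.1 - σ) / v.1 ↔ ((l * v.1 : ℕ) : ℤ) ∣ v.2.2 * v.2.1 - σ := by
    rw [Int.dvd_div_iff_mul_dvd hv.2.2.2.2]
    push_cast
    rw [mul_comm]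
  rw [companionWeight, sideWeight]
  by_cases h : ((l * v.1 : ℕ) : ℤ) ∣ v.2.2 * v.2.1 - σ
  · rw [if_pos (hiff.2 h), if_pos h]; ring
  · rw [if_neg (mt hiff.1 h), if_neg h]; ring

lemma abs_sum_filter_eq_one_le (l : ℕ) {α β : ℝ} (hα : 0 ≤ α) (hβ : β ≤ 1) (N : ℕ) {ε : ℝ}
    (hε : 0 < ε) :
    |∑ v ∈ (primSet l (fun _ p => p ≠ 0) α β N).filter fun v => ¬ v.1 ≠ 1,
        volume.real (killSet l ε v.1 v.2)| ≤ 2 * ε := by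
  rw [abs_of_nonneg (Finset.sum_nonneg fun _ _ => measureReal_nonneg)]
  refine (Finset.sum_le_card_nsmul _ _ (2 * ε) fun v hv => ?_).trans ?_
  · rw [Finset.mem_filter, mem_primSet] at hv
    exact volume_real_killSet_le l hε.le hv.1.1.1 _
  · rw [nsmul_eq_mul]
    refine mul_le_of_le_one_left (by positivity) ?_
    norm_cast
    rw [Finset.card_le_one_iff_subset_singleton]
    refine ⟨⟨1, 1⟩, fun v hv => ?_⟩
    obtain ⟨q, p⟩ := v
    rw [Finset.mem_filter, mem_primSet] at hv
    obtain ⟨⟨-, ⟨h1, h2⟩, -⟩, h3⟩ := hv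
    simp only [not_not] at h1 h2 h3
    subst h3
    rw [Nat.cast_one, mul_one] at h1 h2
    have h4 : (0 : ℝ) < p := by linarith
    have h5 : (p : ℝ) ≤ 1 := by linarith
    have h6 : 0 < p := by exact_mod_cast h4
    have h7 : p ≤ 1 := by exact_mod_cast h5
    rw [Finset.mem_singleton, show p = 1 by omega]

/-- The measure of the free set in `(α, β]`, with the limit density left as an integral. -/
lemma abs_volume_real_freeSet_sub_le {l : ℕ} (hl : 2 ≤ l) {δ : ℝ} (hδ : 0 < δ) :
    ∃ C : ℝ, 0 < C ∧ ∀ (α β Y ε lam : ℝ), 0 ≤ α → α ≤ β → β ≤ 1 → β - α ≤ Y → 0 < Y → Y ≤ 1 →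
      0 < ε → ε < 1 / 2 → ε ≤ lam →
      |volume.real (Ioc α β ∩ freeSet l ε ⌊lam / ε⌋₊) - (β - α) *
        (1 - 2 * Aconst l * levelMean (fun y => 1 / (1 + y)) lam -
          2 * Cconst l / l * levelMean (fun y => 1 / (1 - y)) lam)| ≤
        C * (ε * equidistError δ Y ⌊lam / ε⌋₊ * (2 + Real.log ⌊lam / ε⌋₊)) := by
  obtain ⟨C, hC, h⟩ := abs_sum_companions_levelInt_sub_le hl hδ
  refine ⟨6 * C + 6, by positivity, ?_⟩
  intro α β Y ε lam hα hαβ hβ hY hY0 hY1 hε hε2 hεl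
  set N := ⌊lam / ε⌋₊ with hN
  have hN1 : 1 ≤ N := by rw [hN, Nat.one_le_floor_iff, le_div_iff₀ hε]; linarith
  have h1 := abs_volume_real_diff_freeSet_sub_le l hε hε2 N α β
  have h2 := abs_sum_filter_eq_one_le l hα hβ N hε
  have h3 := sum_volume_real_killSet_eq l α β N hε
  have h4 := Finset.sum_filter_add_sum_filter_not (primSet l (fun _ p => p ≠ 0) α β N)
    (fun v => v.1 ≠ 1) (fun v => volume.real (killSet l ε v.1 v.2))
  have m1 : Measurable fun y : ℝ => 1 / (1 + y) := by fun_prop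
  have m2 : Measurable fun y : ℝ => 1 / (1 - y) := by fun_prop
  have p1 : ∀ y ∈ Ioo (0 : ℝ) 1, 0 < 1 / (1 + y) := fun y hy => by
    have := hy.1; positivity
  have p2 : ∀ y ∈ Ioo (0 : ℝ) 1, 0 < 1 / (1 - y) := fun y hy => by
    have := sub_pos.2 hy.2; positivity
  obtain ⟨a1, a2, -⟩ := h α β Y ε lam 1 hαβ hY hY0 hY1 (Or.inl rfl) hε hεl _ m1 p1
  obtain ⟨-, -, a3⟩ := h α β Y ε lam 1 hαβ hY hY0 hY1 (Or.inl rfl) hε hεl _ m2 p2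
  obtain ⟨b1, b2, -⟩ := h α β Y ε lam (-1) hαβ hY hY0 hY1 (Or.inr rfl) hε hεl _ m1 p1
  obtain ⟨-, -, b3⟩ := h α β Y ε lam (-1) hαβ hY hY0 hY1 (Or.inr rfl) hε hεl _ m2 p2
  rw [sum_companionWeight_eq, sum_companionWeight_eq] at h3
  have h5 : volume.real (Ioc α β ∩ freeSet l ε N) + volume.real (Ioc α β \ freeSet l ε N) =
      β - α := by
    rw [measureReal_inter_add_sdiff (measurableSet_freeSet l ε N) measure_Ioc_lt_top.ne,
      Real.volume_real_Ioc_of_le hαβ]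
  have h6 : ε ≤ ε * equidistError δ Y N * (2 + Real.log N) := by
    have e1 := one_le_equidistError hδ hY0 hY1 hN1
    have e2 := Real.log_natCast_nonneg N
    have e3 : 1 ≤ equidistError δ Y N * (2 + Real.log N) := by nlinarith
    nlinarith
  set R := ε * equidistError δ Y N * (2 + Real.log N)
  set K1 := levelMean (fun y => 1 / (1 + y)) lam
  set K2 := levelMean (fun y => 1 / (1 - y)) lam
  have hA : Aconst l = 1 / zeta2 - 2 * (Cconst l / l) := by rw [Aconst]; ring
  have hC2 : 2 * Cconst l / l = 2 * (Cconst l / l) := by ring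
  rw [hA, hC2]
  rw [abs_le] at h1 h2 a1 a2 a3 b1 b2 b3 ⊢
  constructor <;> linarith

end KillSums

section Dilogarithm

lemma summable_one_div_succ_sq : Summable fun n : ℕ => 1 / ((n : ℝ) + 1) ^ 2 := by
  have := (summable_nat_add_iff 1).2 hasSum_zeta_two.summable
  simpa using this

lemma norm_Li2_term_le {x : ℝ} (hx : |x| ≤ 1) (n : ℕ) :
    ‖x ^ (n + 1) / ((n : ℝ) + 1) ^ 2‖ ≤ 1 / ((n : ℝ) + 1) ^ 2 := by
  rw [norm_div, norm_pow, Real.norm_eq_abs,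
    Real.norm_of_nonneg (by positivity : 0 ≤ ((n : ℝ) + 1) ^ 2)]
  gcongr
  exact pow_le_one₀ (abs_nonneg x) hx

lemma continuousOn_Li2 : ContinuousOn Li2 (Icc 0 1) := by
  unfold Li2
  refine continuousOn_tsum (fun n => by fun_prop) summable_one_div_succ_sq ?_
  intro n x hx
  exact norm_Li2_term_le (abs_le.2 ⟨by linarith [hx.1], hx.2⟩) n

lemma Li2_zero : Li2 0 = 0 := by simp [Li2]

lemma Li2_one : Li2 1 = zeta2 := by
  have h := hasSum_zeta_two
  rw [hasSum_nat_add_iff' 1 |>.symm] at h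
  have := h.tsum_eq
  simpa [Li2, zeta2] using this

lemma hasDerivAt_Li2 {x : ℝ} (h0 : 0 < x) (h1 : x < 1) :
    HasDerivAt Li2 (-Real.log (1 - x) / x) x := by
  obtain ⟨r, hxr, hr1⟩ := exists_between h1
  have hr0 : 0 < r := h0.trans hxr
  have hs : Summable fun n : ℕ => r ^ n := summable_geometric_of_lt_one hr0.le hr1
  have h := hasDerivAt_tsum_of_isPreconnected (𝕜 := ℝ) (t := Ioo 0 r) (y₀ := x) (y := x) hs
    isOpen_Ioo
    isPreconnected_Ioo (g := fun (n : ℕ) y => y ^ (n + 1) / ((n : ℝ) + 1) ^ 2)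
    (g' := fun (n : ℕ) y => y ^ n / ((n : ℝ) + 1)) ?_ ?_ ⟨h0, hxr⟩ ?_ ⟨h0, hxr⟩
  · have e := (hasSum_pow_div_log_of_abs_lt_one (x := x) (abs_lt.2 ⟨by linarith, h1⟩)).div_const x
    have e2 : ∑' n : ℕ, x ^ n / ((n : ℝ) + 1) = -Real.log (1 - x) / x := by
      rw [← e.tsum_eq]
      refine tsum_congr fun n => ?_
      field_simp
      ring
    rw [← e2]
    exact h
  · intro n y _
    have := (hasDerivAt_pow (n + 1) y).div_const (((n : ℝ) + 1) ^ 2)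
    convert! this using 1
    push_cast
    field_simp
  · intro n y hy
    rw [norm_div, norm_pow, Real.norm_of_nonneg hy.1.le,
      Real.norm_of_nonneg (by positivity : 0 ≤ (n : ℝ) + 1)]
    refine (div_le_self (pow_nonneg hy.1.le _) (by linarith [n.cast_nonneg (α := ℝ)])).trans ?_
    exact pow_le_pow_left₀ hy.1.le hy.2.le n
  · exact Summable.of_norm_bounded summable_one_div_succ_sq
      fun n => norm_Li2_term_le (abs_le.2 ⟨by linarith, h1.le⟩) n

lemma abs_log_one_sub_le {x : ℝ} (h0 : 0 ≤ x) (h1 : x ≤ 1 / 2) : |Real.log (1 - x)| ≤ 2 * x := by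
  have h2 : Real.log (1 - x) ≤ 0 := Real.log_nonpos (by linarith) (by linarith)
  have h3 := Real.one_sub_inv_le_log_of_pos (show 0 < 1 - x by linarith)
  rw [abs_of_nonpos h2]
  have h4 : (1 - x)⁻¹ ≤ 1 + 2 * x := by
    rw [inv_le_iff_one_le_mul₀ (by linarith)]
    nlinarith
  linarith

lemma continuousOn_log_mul_log_one_sub :
    ContinuousOn (fun x => Real.log x * Real.log (1 - x)) (Icc 0 (1 / 2)) := by
  intro x hx
  rcases hx.1.eq_or_lt with rfl | h0
  · have hz : Real.log 0 * Real.log (1 - 0) = 0 := by simp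
    rw [ContinuousWithinAt, hz]
    have h2 : Tendsto (fun x : ℝ => 2 * |x * Real.log x|) (nhdsWithin 0 (Icc 0 (1 / 2)))
        (nhds 0) := by
      have : Continuous fun x : ℝ => 2 * |x * Real.log x| :=
        (Real.continuous_mul_log.abs).const_mul 2
      have h := this.tendsto 0
      simp only [Real.log_zero, mul_zero, abs_zero] at h
      exact h.mono_left nhdsWithin_le_nhds
    refine squeeze_zero_norm' ?_ h2
    filter_upwards [self_mem_nhdsWithin] with y hy
    rw [norm_mul, Real.norm_eq_abs, Real.norm_eq_abs, abs_mul, abs_of_nonneg hy.1]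
    have := abs_log_one_sub_le hy.1 hy.2
    nlinarith [abs_nonneg (Real.log y)]
  · refine ContinuousAt.continuousWithinAt ?_
    have h1 : (1 : ℝ) - x ≠ 0 := by linarith [hx.2]
    exact (Real.continuousAt_log h0.ne').mul (ContinuousAt.log (by fun_prop) h1)

lemma Li2_one_half : Li2 (1 / 2) = zeta2 / 2 - Real.log 2 ^ 2 / 2 := by
  have hc : ContinuousOn (fun x => Li2 x + Li2 (1 - x) + Real.log x * Real.log (1 - x))
      (Icc 0 (1 / 2)) := by
    refine ((continuousOn_Li2.mono (Icc_subset_Icc_right (by norm_num))).add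
      (continuousOn_Li2.comp (by fun_prop) ?_)).add continuousOn_log_mul_log_one_sub
    intro x hx
    exact ⟨by linarith [hx.2], by linarith [hx.1]⟩
  have hd : ∀ x ∈ Ioo (0 : ℝ) (1 / 2), HasDerivAt
      (fun x => Li2 x + Li2 (1 - x) + Real.log x * Real.log (1 - x)) 0 x := by
    intro x hx
    have h1 : 0 < 1 - x := by linarith [hx.2]
    have hs : HasDerivAt (fun x : ℝ => 1 - x) (-1) x := by
      simpa using (hasDerivAt_id x).const_sub 1
    have d1 := hasDerivAt_Li2 hx.1 (by linarith [hx.2])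
    have d2 := (hasDerivAt_Li2 h1 (by linarith [hx.1])).comp x hs
    have d3 := (Real.hasDerivAt_log hx.1.ne').mul (hs.log h1.ne')
    convert! (d1.add d2).add d3 using 1
    have := hx.1.ne'
    rw [sub_sub_cancel]
    field_simp
    ring
  have h := intervalIntegral.integral_eq_sub_of_hasDerivAt_of_le (by norm_num) hc hd
    (by simp)
  have e : (1 : ℝ) - 1 / 2 = 1 / 2 := by norm_num
  have e2 : Real.log (1 / 2) = -Real.log 2 := by rw [one_div, Real.log_inv]
  simp only [intervalIntegral.integral_zero, Li2_zero, Li2_one, sub_zero, Real.log_zero, zero_mul,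
    add_zero, zero_add, e, e2] at h
  linarith

end Dilogarithm

section LevelMeanValues

lemma integral_neg_log (a b : ℝ) :
    ∫ y in a..b, -Real.log y = a * Real.log a - a - (b * Real.log b - b) := by
  rw [intervalIntegral.integral_neg, integral_log]
  ring

lemma levelMean_split {ξ f g : ℝ → ℝ} (hξ : Measurable ξ) (hpos : ∀ y ∈ Ioo (0 : ℝ) 1, 0 < ξ y)
    {lam η : ℝ} (hlam : 0 < lam) (h0 : 0 ≤ η) (h1 : η ≤ 1)
    (hf : ∀ y ∈ Ioo 0 η, min lam (ξ y) = f y) (hg : ∀ y ∈ Ioo η 1, min lam (ξ y) = g y) :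
    IntervalIntegrable (fun y => f y * (-Real.log y)) volume 0 η ∧
      IntervalIntegrable (fun y => g y * (-Real.log y)) volume η 1 ∧
      levelMean ξ lam = (∫ y in (0 : ℝ)..η, f y * (-Real.log y)) +
        ∫ y in η..1, g y * (-Real.log y) := by
  have hi := intervalIntegrable_min_mul_log hξ hlam hpos
  have i1 := hi.mono_set (c := 0) (d := η) (by
    rw [uIcc_of_le h0, uIcc_of_le zero_le_one]; exact Icc_subset_Icc_right h1)
  have i2 := hi.mono_set (c := η) (d := 1) (by
    rw [uIcc_of_le h1, uIcc_of_le zero_le_one]; exact Icc_subset_Icc_left h0)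
  have ef : ∀ᵐ y ∂volume, y ∈ Ioc 0 η → min lam (ξ y) * (-Real.log y) = f y * (-Real.log y) := by
    filter_upwards [compl_mem_ae_iff.2 (measure_singleton η)] with y hy hm
    rw [hf y ⟨hm.1, lt_of_le_of_ne hm.2 hy⟩]
  have eg : ∀ᵐ y ∂volume, y ∈ Ioc η 1 → min lam (ξ y) * (-Real.log y) = g y * (-Real.log y) := by
    filter_upwards [compl_mem_ae_iff.2 (measure_singleton (1 : ℝ))] with y hy hm
    rw [hg y ⟨hm.1, lt_of_le_of_ne hm.2 hy⟩]
  rw [← uIoc_of_le h0] at ef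
  rw [← uIoc_of_le h1] at eg
  refine ⟨i1.congr_ae ?_, i2.congr_ae ?_, ?_⟩
  · exact (ae_restrict_iff' measurableSet_uIoc).2 ef
  · exact (ae_restrict_iff' measurableSet_uIoc).2 eg
  · rw [levelMean, ← intervalIntegral.integral_add_adjacent_intervals i1 i2,
      intervalIntegral.integral_congr_ae ef, intervalIntegral.integral_congr_ae eg]

lemma levelMean_eq_of_le {ξ : ℝ → ℝ} {lam : ℝ} (h : ∀ y ∈ Ioo (0 : ℝ) 1, lam ≤ ξ y) :
    levelMean ξ lam = lam := by
  have e : ∀ᵐ y ∂volume, y ∈ uIoc (0 : ℝ) 1 → min lam (ξ y) * (-Real.log y) =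
      lam * (-Real.log y) := by
    filter_upwards [compl_mem_ae_iff.2 (measure_singleton (1 : ℝ))] with y hy hm
    rw [uIoc_of_le zero_le_one] at hm
    rw [min_eq_left (h y ⟨hm.1, lt_of_le_of_ne hm.2 hy⟩)]
  rw [levelMean, intervalIntegral.integral_congr_ae e, intervalIntegral.integral_const_mul,
    integral_neg_log]
  simp

lemma levelMean_one_div_one_sub_of_one_le {lam : ℝ} (h : 1 ≤ lam) :
    levelMean (fun y => 1 / (1 - y)) lam = zeta2 - H3 lam := by
  have h0 : 0 < lam := by linarith
  have hη : 1 / lam ≤ 1 := by rw [div_le_one h0]; exact h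
  have hη0 : 0 < 1 / lam := by positivity
  obtain ⟨i1, -, e⟩ := levelMean_split (ξ := fun y => 1 / (1 - y)) (f := fun y => 1 / (1 - y))
    (g := fun _ => lam) (by fun_prop) (fun y hy => by have := sub_pos.2 hy.2; positivity) h0
    (η := 1 - 1 / lam) (by linarith) (by linarith)
    (fun y hy => by
      refine min_eq_right ?_
      rw [div_le_comm₀ (by linarith [hy.2]) h0]; linarith [hy.2])
    (fun y hy => by
      refine min_eq_left ?_
      rw [le_div_comm₀ h0 (by linarith [hy.2])]; linarith [hy.1])
  have d : ∀ y ∈ Ioo 0 (1 - 1 / lam), HasDerivAt (fun y => -Li2 (1 - y))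
      (1 / (1 - y) * (-Real.log y)) y := by
    intro y hy
    have h1 : 0 < 1 - y := by linarith [hy.2]
    have hs : HasDerivAt (fun x : ℝ => 1 - x) (-1) y := by
      simpa using (hasDerivAt_id y).const_sub 1
    convert! ((hasDerivAt_Li2 h1 (by linarith [hy.1])).comp y hs).neg using 1
    rw [sub_sub_cancel]
    ring
  have hc : ContinuousOn (fun y => -Li2 (1 - y)) (Icc 0 (1 - 1 / lam)) :=
    (continuousOn_Li2.comp (by fun_prop) fun y hy =>
      ⟨by linarith [hy.2], by linarith [hy.1]⟩).neg
  rw [e, intervalIntegral.integral_eq_sub_of_hasDerivAt_of_le (by linarith) hc d i1,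
    intervalIntegral.integral_const_mul, integral_neg_log, sub_sub_cancel, sub_zero, Li2_one, H3]
  simp only [Real.log_one]
  field_simp
  ring

lemma integral_neg_log_div_one_add {η : ℝ} (h0 : 0 ≤ η) (h1 : η ≤ 1)
    (hi : IntervalIntegrable (fun y => 1 / (1 + y) * (-Real.log y)) volume η 1) :
    ∫ y in η..1, 1 / (1 + y) * (-Real.log y) =
      Li2 (1 / (1 + η)) + Real.log (1 + η) ^ 2 / 2 - zeta2 / 2 := by
  have d : ∀ y ∈ Ioo η 1, HasDerivAt (fun y => -Li2 (1 / (1 + y)) - Real.log (1 + y) ^ 2 / 2)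
      (1 / (1 + y) * (-Real.log y)) y := by
    intro y hy
    have hy0 : 0 < y := h0.trans_lt hy.1
    have h1 : 0 < 1 + y := by linarith
    have hs : HasDerivAt (fun x : ℝ => 1 + x) 1 y := by
      simpa using (hasDerivAt_id y).const_add 1
    have hv : HasDerivAt (fun x : ℝ => 1 / (1 + x)) (-1 / (1 + y) ^ 2) y := by
      simp only [one_div]
      exact hs.inv h1.ne'
    have hv1 : 1 / (1 + y) < 1 := by rw [div_lt_one h1]; linarith
    have d1 := ((hasDerivAt_Li2 (show 0 < 1 / (1 + y) by positivity) hv1).comp y hv).neg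
    have d2 := ((hs.log h1.ne').pow 2).div_const 2
    convert! d1.sub d2 using 1
    have e : 1 - 1 / (1 + y) = y / (1 + y) := by field_simp; ring
    rw [e, Real.log_div hy0.ne' h1.ne']
    field_simp
    ring
  have hc : ContinuousOn (fun y => -Li2 (1 / (1 + y)) - Real.log (1 + y) ^ 2 / 2) (Icc η 1) := by
    have hp : ∀ y ∈ Icc η 1, 0 < 1 + y := fun y hy => by linarith [hy.1]
    refine ContinuousOn.sub (ContinuousOn.neg (continuousOn_Li2.comp
      (continuousOn_const.div (by fun_prop) fun y hy => (hp y hy).ne') ?_)) ?_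
    · intro y hy
      have := hp y hy
      refine ⟨by positivity, ?_⟩
      rw [div_le_one this]; linarith [hy.1]
    · exact ((ContinuousOn.log (by fun_prop) fun y hy => (hp y hy).ne').pow 2).div_const 2
  rw [intervalIntegral.integral_eq_sub_of_hasDerivAt_of_le h1 hc d hi]
  rw [one_add_one_eq_two, Li2_one_half]
  ring

lemma levelMean_one_div_one_add_of_one_le {lam : ℝ} (h : 1 ≤ lam) :
    levelMean (fun y => 1 / (1 + y)) lam = zeta2 / 2 := by
  obtain ⟨-, i2, e⟩ := levelMean_split (ξ := fun y => 1 / (1 + y)) (f := fun y => 1 / (1 + y))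
    (g := fun y => 1 / (1 + y)) (by fun_prop) (fun y hy => by have := hy.1; positivity)
    (by linarith) (η := 0) le_rfl zero_le_one (fun y hy => absurd hy (by simp))
    (fun y hy => by
      refine min_eq_right (le_trans ?_ h)
      rw [div_le_one (by linarith [hy.1])]; linarith [hy.1])
  rw [e, integral_neg_log_div_one_add le_rfl zero_le_one i2]
  norm_num [Li2_one]
  ring

lemma levelMean_one_div_one_add_of_mem_Icc {lam : ℝ} (h : 1 / 2 ≤ lam) (h1 : lam ≤ 1) :
    levelMean (fun y => 1 / (1 + y)) lam = (lam - H2 lam) / 2 := by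
  have h0 : 0 < lam := by linarith
  have hη : 1 ≤ 1 / lam := by rw [le_div_iff₀ h0]; linarith
  have hη2 : 1 / lam ≤ 2 := by rw [div_le_iff₀ h0]; linarith
  obtain ⟨-, i2, e⟩ := levelMean_split (ξ := fun y => 1 / (1 + y)) (f := fun _ => lam)
    (g := fun y => 1 / (1 + y)) (by fun_prop) (fun y hy => by have := hy.1; positivity)
    h0 (η := 1 / lam - 1) (by linarith) (by linarith)
    (fun y hy => by
      refine min_eq_left ?_
      rw [le_div_comm₀ h0 (by linarith [hy.1])]; linarith [hy.2])
    (fun y hy => by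
      refine min_eq_right ?_
      rw [div_le_comm₀ (by linarith [hy.1]) h0]; linarith [hy.1])
  rw [e, integral_neg_log_div_one_add (by linarith) (by linarith) i2,
    intervalIntegral.integral_const_mul, integral_neg_log, add_sub_cancel, one_div_one_div, H2,
    one_div, Real.log_inv]
  simp only [Real.log_zero]
  field_simp
  ring

lemma zeta2_pos : 0 < zeta2 := by rw [zeta2]; positivity

theorem Gfun_eq (l : ℕ) (lam : ℝ) :
    1 - 2 * Aconst l * levelMean (fun y => 1 / (1 + y)) lam -
      2 * Cconst l / l * levelMean (fun y => 1 / (1 - y)) lam = Gfun l lam := by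
  have hC : 2 * Cconst l / l = 1 / zeta2 - Aconst l := by rw [Aconst]; ring
  have hz := zeta2_pos
  have k2 : lam ≤ 1 → levelMean (fun y => 1 / (1 - y)) lam = lam := fun h =>
    levelMean_eq_of_le fun y hy => h.trans (by
      rw [le_div_iff₀ (by linarith [hy.2])]; linarith [hy.1])
  rw [Gfun, hC]
  split_ifs with h1 h2
  · rw [k2 (by linarith), levelMean_eq_of_le fun y hy => h1.trans (by
      rw [div_le_div_iff₀ (by norm_num) (by linarith [hy.1])]; linarith [hy.2])]
    ring
  · rw [k2 h2, levelMean_one_div_one_add_of_mem_Icc (not_le.1 h1).le h2]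
    ring
  · have h3 := (not_le.1 h2).le
    rw [levelMean_one_div_one_sub_of_one_le h3, levelMean_one_div_one_add_of_one_le h3]
    field_simp
    ring

end LevelMeanValues

section FreePath

lemma lt_qfree_arctan_iff {l : ℕ} {ε lam : ℝ} (hε : 0 < ε) (hlam : 0 < lam) (u : ℝ) :
    ENNReal.ofReal (lam / ε) < qfree l ε (Real.arctan u) ↔ 1 - u ∈ freeSet l ε ⌊lam / ε⌋₊ := by
  have hN : 0 ≤ lam / ε := by positivity
  have mem_iff : ∀ q : ℝ, (q, q * Real.tan (Real.arctan u)) ∈ Zl l + Vseg ε ↔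
      ∃ m n : ℤ, ¬ ((l : ℤ) ∣ m - n) ∧ q = m ∧ |m * u - n| ≤ ε := by
    intro q
    rw [Real.tan_arctan, Set.mem_add]
    constructor
    · rintro ⟨-, ⟨m, n, rfl, hmn⟩, ⟨v1, v2⟩, ⟨hv1, hv2⟩, h⟩
      rw [Prod.mk_add_mk, Prod.mk.injEq] at h
      have hv1' : v1 = 0 := hv1
      rw [hv1', add_zero] at h
      refine ⟨m, n, hmn, h.1.symm, ?_⟩
      rw [h.1, ← h.2, add_sub_cancel_left]
      exact abs_le.2 hv2
    · rintro ⟨m, n, hmn, rfl, h⟩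
      refine ⟨((m : ℝ), (n : ℝ)), ⟨m, n, rfl, hmn⟩, (0, m * u - n), ⟨rfl, abs_le.1 h⟩, ?_⟩
      rw [Prod.mk_add_mk, add_zero, add_sub_cancel]
  constructor
  · intro h m hm hmN p hp
    by_contra hcon
    have h1 : ((m : ℤ) : ℝ) ≤ lam / ε := by
      push_cast
      exact (Nat.le_floor_iff hN).1 hmN
    have h2 : qfree l ε (Real.arctan u) ≤ ENNReal.ofReal ((m : ℤ) : ℝ) := by
      refine iInf_le_of_le ⟨((m : ℤ) : ℝ), by exact_mod_cast hm, (mem_iff _).2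
        ⟨m, m - p, by simpa using hp, rfl, ?_⟩⟩ le_rfl
      rw [← abs_neg]
      refine le_trans (le_of_eq ?_) (not_lt.1 hcon)
      congr 1
      push_cast
      ring
    exact absurd (h.trans_le (h2.trans (ENNReal.ofReal_le_ofReal h1))) (lt_irrefl _)
  · intro h
    refine lt_of_lt_of_le ((ENNReal.ofReal_lt_ofReal_iff (by positivity)).2
      (Nat.lt_floor_add_one (lam / ε))) ?_
    refine le_iInf ?_
    rintro ⟨q, hq, hq2⟩
    obtain ⟨m, n, hmn, rfl, h2⟩ := (mem_iff q).1 hq2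
    refine ENNReal.ofReal_le_ofReal ?_
    have hm : 0 < m := by exact_mod_cast hq
    obtain ⟨k, rfl⟩ := Int.eq_ofNat_of_zero_le hm.le
    have hk : ⌊lam / ε⌋₊ < k := by
      by_contra hcon
      have h3 := h k (by exact_mod_cast hm) (not_lt.1 hcon) (k - n) hmn
      rw [← abs_neg] at h3
      refine absurd (lt_of_lt_of_le h3 (le_trans (le_of_eq ?_) h2)) (lt_irrefl _)
      congr 1
      push_cast
      ring
    push_cast
    exact_mod_cast hk

lemma measureReal_image_arctan {S : Set ℝ} (hS : MeasurableSet S) :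
    volume.real (Real.arctan '' S) = ∫ u in S, 1 / (1 + u ^ 2) := by
  have h := integral_image_eq_integral_abs_deriv_smul hS
    (fun x _ => (Real.hasDerivAt_arctan x).hasDerivWithinAt) Real.arctan_injective.injOn
    (fun _ => (1 : ℝ))
  rw [setIntegral_const, smul_eq_mul, mul_one] at h
  rw [h]
  refine integral_congr_ae (ae_of_all _ fun u => ?_)
  simp only [smul_eq_mul, mul_one]
  exact abs_of_pos (by positivity)

lemma Grep_eq {l : ℕ} {ε lam : ℝ} (hε : 0 < ε) (hlam : 0 < lam) {I : Set ℝ}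
    (hI : MeasurableSet I) :
    Grep l I ε lam =
      ∫ u in I ∩ (fun u => 1 - u) ⁻¹' freeSet l ε ⌊lam / ε⌋₊, 1 / (1 + u ^ 2) := by
  rw [← measureReal_image_arctan (hI.inter ((measurableSet_freeSet l ε _).preimage (by fun_prop))),
    Grep, Measure.real]
  congr 2
  ext ω
  constructor
  · rintro ⟨⟨u, hu, rfl⟩, h⟩
    exact ⟨u, ⟨hu, (lt_qfree_arctan_iff hε hlam u).1 h⟩, rfl⟩
  · rintro ⟨u, ⟨hu, h⟩, rfl⟩
    exact ⟨⟨u, hu, rfl⟩, (lt_qfree_arctan_iff hε hlam u).2 h⟩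

end FreePath

section Weight

lemma volume_ne_top_of_subset_Icc {S : Set ℝ} {a b : ℝ} (h : S ⊆ Icc a b) : volume S ≠ ∞ :=
  ((measure_mono h).trans_lt measure_Icc_lt_top).ne

lemma setIntegral_eq_integral_superlevel {S : Set ℝ} (h : S ⊆ Icc 0 1) :
    IntegrableOn (fun t => volume.real (S ∩ {u | t ≤ 1 / (1 + u ^ 2)})) (Ioc 0 1) ∧
      ∫ u in S, 1 / (1 + u ^ 2) =
        ∫ t in Ioc (0 : ℝ) 1, volume.real (S ∩ {u | t ≤ 1 / (1 + u ^ 2)}) := by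
  have hfin := volume_ne_top_of_subset_Icc h
  constructor
  · have ha : Antitone fun t => volume.real (S ∩ {u | t ≤ 1 / (1 + u ^ 2)}) := by
      intro s t hst
      refine measureReal_mono (inter_subset_inter_right _ fun u hu => ?_)
        (volume_ne_top_of_subset_Icc (inter_subset_left.trans h))
      exact hst.trans hu
    exact (ha.antitoneOn _).integrableOn_isCompact isCompact_Icc |>.mono_set Ioc_subset_Icc_self
  · have hm : Measurable fun u : ℝ => 1 / (1 + u ^ 2) := by fun_prop
    have hle : ∀ u : ℝ, 1 / (1 + u ^ 2) ≤ 1 := fun u => by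
      rw [div_le_one (by positivity)]; nlinarith [sq_nonneg u]
    have hi : IntegrableOn (fun u : ℝ => 1 / (1 + u ^ 2)) S := by
      refine Measure.integrableOn_of_bounded hfin hm.aestronglyMeasurable (M := 1)
        (ae_of_all _ fun u => ?_)
      rw [Real.norm_of_nonneg (by positivity)]
      exact hle u
    rw [hi.integral_eq_integral_Ioc_meas_le (ae_of_all _ fun u => by
      simp only [Pi.zero_apply]; positivity)
      (ae_of_all _ hle)]
    refine integral_congr_ae (ae_of_all _ fun t => ?_)
    simp only
    rw [measureReal_restrict_apply (measurableSet_le measurable_const hm), inter_comm]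

lemma abs_setIntegral_inter_sub_le {F : Set ℝ} {Y B G : ℝ}
    (h : ∀ J ⊆ Icc (0 : ℝ) 1, J.OrdConnected → volume.real J ≤ Y →
      |volume.real (J ∩ F) - volume.real J * G| ≤ B)
    {I : Set ℝ} (hI : I ⊆ Icc 0 1) (hO : I.OrdConnected) (hY : volume.real I ≤ Y) :
    |(∫ u in I ∩ F, 1 / (1 + u ^ 2)) - (∫ u in I, 1 / (1 + u ^ 2)) * G| ≤ B := by
  obtain ⟨i1, e1⟩ := setIntegral_eq_integral_superlevel hI
  obtain ⟨i2, e2⟩ := setIntegral_eq_integral_superlevel (inter_subset_left (t := F) |>.trans hI)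
  rw [e1, e2, ← integral_mul_const, ← integral_sub i2 (i1.mul_const G), ← Real.norm_eq_abs]
  refine (norm_setIntegral_le_of_norm_le_const (C := B) measure_Ioc_lt_top ?_).trans (by simp)
  intro t _
  have hs : I ∩ F ∩ {u | t ≤ 1 / (1 + u ^ 2)} = (I ∩ {u | t ≤ 1 / (1 + u ^ 2)}) ∩ F := by
    rw [inter_assoc, inter_assoc, inter_comm F]
  rw [hs]
  refine h _ (inter_subset_left.trans hI) ⟨?_⟩
    ((measureReal_mono inter_subset_left (volume_ne_top_of_subset_Icc hI)).trans hY)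
  rintro x ⟨hx, hx2⟩ y ⟨hy, hy2⟩ z hz
  refine ⟨hO.out hx hy hz, show t ≤ 1 / (1 + z ^ 2) from le_trans hy2 ?_⟩
  have h0 : 0 ≤ z := (hI hx).1.trans hz.1
  have := hz.2
  gcongr

end Weight

section Intervals

lemma exists_Ioc_ae_eq {J : Set ℝ} (hJ : J ⊆ Icc 0 1) (hO : J.OrdConnected) :
    ∃ α β : ℝ, 0 ≤ α ∧ α ≤ β ∧ β ≤ 1 ∧ J =ᵐ[volume] Ioc α β := by
  rcases J.eq_empty_or_nonempty with rfl | hne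
  · exact ⟨0, 0, le_rfl, le_rfl, zero_le_one, by simp⟩
  have hb : BddBelow J := bddBelow_Icc.mono hJ
  have hb2 : BddAbove J := bddAbove_Icc.mono hJ
  refine ⟨sInf J, sSup J, le_csInf hne fun x hx => (hJ hx).1, csInf_le_csSup hne hb hb2,
    csSup_le hne fun x hx => (hJ hx).2, ?_⟩
  have h1 : J ≤ᵐ[volume] Ioc (sInf J) (sSup J) :=
    (LE.le.eventuallyLE (subset_Icc_csInf_csSup hb hb2)).trans
      Ioc_ae_eq_Icc.symm.le
  have h2 : Ioc (sInf J) (sSup J) ≤ᵐ[volume] J := by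
    refine Ioo_ae_eq_Ioc.symm.le.trans (LE.le.eventuallyLE ?_)
    rintro x ⟨hx1, hx2⟩
    obtain ⟨a, ha, hax⟩ := exists_lt_of_csInf_lt hne hx1
    obtain ⟨b, hb, hbx⟩ := exists_lt_of_lt_csSup hne hx2
    exact hO.out ha hb ⟨hax.le, hbx.le⟩
  exact h1.antisymm h2

lemma abs_measureReal_inter_reflect_sub_le {F : Set ℝ} (hF : MeasurableSet F) {Y B G : ℝ}
    (h : ∀ α β : ℝ, 0 ≤ α → α ≤ β → β ≤ 1 → β - α ≤ Y →
      |volume.real (Ioc α β ∩ F) - (β - α) * G| ≤ B)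
    {J : Set ℝ} (hJ : J ⊆ Icc 0 1) (hO : J.OrdConnected) (hY : volume.real J ≤ Y) :
    |volume.real (J ∩ (fun u => 1 - u) ⁻¹' F) - volume.real J * G| ≤ B := by
  have hp : MeasurePreserving (fun u : ℝ => 1 - u) volume volume :=
    volume.measurePreserving_sub_left 1
  have hJ2 : (fun u : ℝ => 1 - u) ⁻¹' J ⊆ Icc 0 1 := fun u hu =>
    ⟨by have := (hJ hu).2; linarith, by have := (hJ hu).1; linarith⟩
  have hO2 : ((fun u : ℝ => 1 - u) ⁻¹' J).OrdConnected :=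
    hO.preimage_anti fun x y hxy => sub_le_sub_left hxy 1
  obtain ⟨α, β, h0, hαβ, h1, hae⟩ := exists_Ioc_ae_eq hJ2 hO2
  have e1 : volume.real J = β - α := by
    rw [← hp.measureReal_preimage hO.measurableSet.nullMeasurableSet, measureReal_congr hae,
      Real.volume_real_Ioc_of_le hαβ]
  have e2 : volume.real (J ∩ (fun u => 1 - u) ⁻¹' F) = volume.real (Ioc α β ∩ F) := by
    rw [← hp.measureReal_preimage
      (hO.measurableSet.inter (hF.preimage hp.measurable)).nullMeasurableSet]
    refine measureReal_congr ?_
    rw [preimage_inter, ← preimage_comp]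
    have : (fun u : ℝ => 1 - u) ∘ (fun u => 1 - u) = id := by funext u; simp
    rw [this, preimage_id]
    exact hae.inter (ae_eq_refl _)
  rw [e1, e2]
  exact h α β h0 hαβ h1 (e1 ▸ hY)

end Intervals

section ErrorTerm

lemma mul_equidistError_le {lam K c θ δ : ℝ} (hlam : 0 < lam) (hK : 1 ≤ K)
    (hδ : 0 < δ) (hθ1 : θ ≤ (1 + 3 * c) / 4) (hθ2 : θ ≤ 1 - c / 2) :
    ∃ C : ℝ, 0 < C ∧ ∀ ε : ℝ, 0 < ε → ε < 1 → ε ≤ lam →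
      ε * equidistError δ (K * ε ^ c) ⌊lam / ε⌋₊ * (2 + Real.log ⌊lam / ε⌋₊) ≤
        C * ε ^ (θ - 3 * δ) := by
  refine ⟨(lam ^ (3 / 4 + 3 * δ) * K ^ (3 / 4 : ℝ) + lam ^ (3 * δ)) * (2 + 1 / δ) ^ 2,
    by positivity, ?_⟩
  intro ε hε hε1 hεl
  have hN1 : 1 ≤ ⌊lam / ε⌋₊ := Nat.le_floor (by
    rw [Nat.cast_one, le_div_iff₀ hε]; linarith)
  have hN0 : (0 : ℝ) < ⌊lam / ε⌋₊ := by exact_mod_cast hN1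
  have hN2 : (⌊lam / ε⌋₊ : ℝ) ≤ lam / ε := Nat.floor_le (by positivity)
  set N := ⌊lam / ε⌋₊
  have hL0 := Real.log_natCast_nonneg N
  have hL : 2 + Real.log N ≤ (2 + 1 / δ) * (N : ℝ) ^ δ := by
    have h1 := Real.log_le_rpow_div hN0.le hδ
    have h2 : 1 ≤ (N : ℝ) ^ δ := Real.one_le_rpow (by exact_mod_cast hN1) hδ.le
    have h3 : (2 + 1 / δ) * (N : ℝ) ^ δ = 2 * (N : ℝ) ^ δ + (N : ℝ) ^ δ / δ := by ring
    linarith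
  have hec : 0 < ε ^ c := by positivity
  have pN : ∀ a : ℝ, 0 ≤ a → (N : ℝ) ^ a ≤ lam ^ a * ε ^ (-a) := fun a ha => by
    refine (Real.rpow_le_rpow hN0.le hN2 ha).trans (le_of_eq ?_)
    rw [Real.div_rpow hlam.le hε.le, Real.rpow_neg hε.le, div_eq_mul_inv]
  have t1 : ε * ((N : ℝ) ^ (3 / 4 + δ) * (K * ε ^ c) ^ (3 / 4 : ℝ)) * ((N : ℝ) ^ δ) ^ 2 ≤
      lam ^ (3 / 4 + 3 * δ) * K ^ (3 / 4 : ℝ) * ε ^ (θ - 3 * δ) := by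
    have e1 : (N : ℝ) ^ (3 / 4 + δ) * ((N : ℝ) ^ δ) ^ 2 = (N : ℝ) ^ (3 / 4 + 3 * δ) := by
      rw [← Real.rpow_natCast, ← Real.rpow_mul hN0.le, ← Real.rpow_add hN0]
      congr 1; push_cast; ring
    have e2 : (K * ε ^ c) ^ (3 / 4 : ℝ) = K ^ (3 / 4 : ℝ) * ε ^ (3 / 4 * c) := by
      rw [Real.mul_rpow (by linarith) hec.le, ← Real.rpow_mul hε.le, mul_comm c]
    have e3 : ε * ε ^ (-(3 / 4 + 3 * δ)) * ε ^ (3 / 4 * c) =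
        ε ^ ((1 + 3 * c) / 4 - 3 * δ) := by
      nth_rewrite 1 [← Real.rpow_one ε]
      rw [← Real.rpow_add hε, ← Real.rpow_add hε]
      congr 1; ring
    calc _ = ε * (N : ℝ) ^ (3 / 4 + 3 * δ) * (K ^ (3 / 4 : ℝ) * ε ^ (3 / 4 * c)) := by
          rw [← e1, e2]; ring
      _ ≤ ε * (lam ^ (3 / 4 + 3 * δ) * ε ^ (-(3 / 4 + 3 * δ))) *
            (K ^ (3 / 4 : ℝ) * ε ^ (3 / 4 * c)) := by
          gcongr
          exact pN _ (by positivity)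
      _ = lam ^ (3 / 4 + 3 * δ) * K ^ (3 / 4 : ℝ) * ε ^ ((1 + 3 * c) / 4 - 3 * δ) := by
          rw [← e3]; ring
      _ ≤ _ := by
          gcongr ?_ * ?_
          exact Real.rpow_le_rpow_of_exponent_ge hε hε1.le (by linarith)
  have t2 : ε * ((N : ℝ) ^ δ / √(K * ε ^ c)) * ((N : ℝ) ^ δ) ^ 2 ≤
      lam ^ (3 * δ) * ε ^ (θ - 3 * δ) := by
    have e1 : (N : ℝ) ^ δ * ((N : ℝ) ^ δ) ^ 2 = (N : ℝ) ^ (3 * δ) := by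
      rw [← Real.rpow_natCast, ← Real.rpow_mul hN0.le, ← Real.rpow_add hN0]
      congr 1; push_cast; ring
    have e2 : 1 / √(K * ε ^ c) ≤ ε ^ (-(c / 2)) := by
      have h1 : √(ε ^ c) = ε ^ (c / 2) := by
        rw [Real.sqrt_eq_rpow, ← Real.rpow_mul hε.le]
        congr 1; ring
      rw [Real.rpow_neg hε.le, ← one_div, ← h1]
      refine one_div_le_one_div_of_le (by positivity) (Real.sqrt_le_sqrt ?_)
      exact le_mul_of_one_le_left hec.le hK
    have e3 : ε * ε ^ (-(3 * δ)) * ε ^ (-(c / 2)) = ε ^ (1 - c / 2 - 3 * δ) := by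
      nth_rewrite 1 [← Real.rpow_one ε]
      rw [← Real.rpow_add hε, ← Real.rpow_add hε]
      congr 1; ring
    calc _ = ε * (N : ℝ) ^ (3 * δ) * (1 / √(K * ε ^ c)) := by
          rw [← e1]; ring
      _ ≤ ε * (lam ^ (3 * δ) * ε ^ (-(3 * δ))) * ε ^ (-(c / 2)) := by
          gcongr
          exact pN _ (by positivity)
      _ = lam ^ (3 * δ) * ε ^ (1 - c / 2 - 3 * δ) := by
          rw [← e3]; ring
      _ ≤ _ := by
          gcongr ?_ * ?_
          exact Real.rpow_le_rpow_of_exponent_ge hε hε1.le (by linarith)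
  have hD : 0 ≤ (N : ℝ) ^ (3 / 4 + δ) * (K * ε ^ c) ^ (3 / 4 : ℝ) + (N : ℝ) ^ δ / √(K * ε ^ c) := by
    positivity
  calc _ = ε * ((N : ℝ) ^ (3 / 4 + δ) * (K * ε ^ c) ^ (3 / 4 : ℝ) +
          (N : ℝ) ^ δ / √(K * ε ^ c)) * (2 + Real.log N) ^ 2 := by
        rw [equidistError]; ring
    _ ≤ ε * ((N : ℝ) ^ (3 / 4 + δ) * (K * ε ^ c) ^ (3 / 4 : ℝ) +
          (N : ℝ) ^ δ / √(K * ε ^ c)) * ((2 + 1 / δ) * (N : ℝ) ^ δ) ^ 2 := by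
        gcongr
    _ = (ε * ((N : ℝ) ^ (3 / 4 + δ) * (K * ε ^ c) ^ (3 / 4 : ℝ)) * ((N : ℝ) ^ δ) ^ 2 +
          ε * ((N : ℝ) ^ δ / √(K * ε ^ c)) * ((N : ℝ) ^ δ) ^ 2) * (2 + 1 / δ) ^ 2 := by
        ring
    _ ≤ (lam ^ (3 / 4 + 3 * δ) * K ^ (3 / 4 : ℝ) * ε ^ (θ - 3 * δ) +
          lam ^ (3 * δ) * ε ^ (θ - 3 * δ)) * (2 + 1 / δ) ^ 2 := by
        gcongr
    _ = _ := by ring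

end ErrorTerm

theorem statement1 (l : ℕ) (hl : 2 ≤ l) (c c₁ δ lam K : ℝ)
    (hc : c ∈ Set.Ioo (0 : ℝ) 1) (hc₁ : c₁ ∈ Set.Ioo (0 : ℝ) 1) (hδ : 0 < δ)
    (hlam : 0 < lam) (hK : 1 ≤ K) :
    ∃ C > 0, ∃ ε₀ > 0, ∀ ε : ℝ, 0 < ε → ε < ε₀ →
      ∀ I : Set ℝ, I ⊆ Set.Icc 0 1 → I.OrdConnected →
        K⁻¹ * ε ^ c ≤ (volume I).toReal → (volume I).toReal ≤ K * ε ^ c →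
        |Grep l I ε lam - (∫ u in I, 1 / (1 + u ^ 2)) * Gfun l lam| ≤
          C * ε ^ (min (c + c₁) (1 / 2 - 2 * c₁) - δ) := by
  have hm1 := min_le_left (c + c₁) (1 / 2 - 2 * c₁)
  have hm2 := min_le_right (c + c₁) (1 / 2 - 2 * c₁)
  obtain ⟨hc0, hc1⟩ := hc
  obtain ⟨hd0, -⟩ := hc₁
  obtain ⟨C₁, hC₁, h₁⟩ := abs_volume_real_freeSet_sub_le hl (div_pos hδ three_pos)
  obtain ⟨C₂, hC₂, h₂⟩ := mul_equidistError_le (c := c)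
    (θ := min (c + c₁) (1 / 2 - 2 * c₁)) hlam hK (div_pos hδ three_pos) (by linarith) (by linarith)
  have hK0 : 0 < K := by linarith
  refine ⟨C₁ * C₂, mul_pos hC₁ hC₂, min (1 / 2) (min lam (K⁻¹ ^ c⁻¹)),
    lt_min (by norm_num) (lt_min hlam (by positivity)), ?_⟩
  intro ε hε hε₀ I hI hO _ hIY
  have hε2 : ε < 1 / 2 := hε₀.trans_le (min_le_left _ _)
  have hεl : ε ≤ lam := (hε₀.trans_le ((min_le_right _ _).trans (min_le_left _ _))).le
  have hεK : ε ≤ K⁻¹ ^ c⁻¹ := (hε₀.trans_le ((min_le_right _ _).trans (min_le_right _ _))).le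
  have hY1 : K * ε ^ c ≤ 1 := by
    have h3 : ε ^ c ≤ K⁻¹ := by
      refine (Real.rpow_le_rpow hε.le hεK hc0.le).trans (le_of_eq ?_)
      rw [← Real.rpow_mul (by positivity), inv_mul_cancel₀ hc0.ne', Real.rpow_one]
    calc K * ε ^ c ≤ K * K⁻¹ := by gcongr
      _ = 1 := mul_inv_cancel₀ hK0.ne'
  have hF := measurableSet_freeSet l ε ⌊lam / ε⌋₊
  have h4 := h₂ ε hε (by linarith) hεl
  rw [show 3 * (δ / 3) = δ by ring] at h4
  rw [Grep_eq hε hlam hO.measurableSet]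
  refine abs_setIntegral_inter_sub_le ?_ hI hO hIY
  intro J hJ hJO hJY
  refine abs_measureReal_inter_reflect_sub_le hF ?_ hJ hJO hJY
  intro α β h0 hαβ hβ hαβY
  rw [← Gfun_eq]
  refine (h₁ α β (K * ε ^ c) ε lam h0 hαβ hβ hαβY (by positivity) hY1 hε hε2 hεl).trans ?_
  rw [mul_assoc C₁]
  exact mul_le_mul_of_nonneg_left h4 hC₁.le
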